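/- Let V_λ, V_μ, …, V_ν be irreducible polynomial representations of GL(r), and let N and ℓ be positive integers. The following are equivalent: (1) there exists δ with δ_1 ≤ ℓ and an inclusion of GL(r)-representations V_δ ⊆ V_λ ⊗ V_μ ⊗ … ⊗ V_ν; (2) there exists δ′ with δ′_1 ≤ Nℓ and an inclusion of GL(r)-representations V_{δ′} ⊆ V_{Nλ} ⊗ V_{Nμ} ⊗ … ⊗ V_{Nν}. -/

import Mathlib

noncomputable section

open Module Submodule

/-! ### Polynomial functions and the Zariski topology on a vector space -/

/-- Evaluation of a polynomial in linear functionals at a point of a vector space.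
These are exactly the polynomial functions on a finite-dimensional vector space. -/
def mEval (k : Type*) {M : Type*} [Field k] [AddCommGroup M] [Module k M]
    (x : M) (p : MvPolynomial (Module.Dual k M) k) : k :=
  MvPolynomial.eval (fun l : Module.Dual k M => l x) p

/-- The Zariski topology on a (finite-dimensional) vector space, generated by the
complements of zero sets of polynomial functions. -/
def mZariski (k M : Type*) [Field k] [AddCommGroup M] [Module k M] :
    TopologicalSpace M :=
  TopologicalSpace.generateFrom
    {U : Set M | ∃ p : MvPolynomial (Module.Dual k M) k, U = {x : M | mEval k x p ≠ 0}}

/-- The Zariski tangent space at a point `x` to a subset `A` of a vector space: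
the common kernel of the differentials at `x` of all polynomial functions vanishing on `A`. -/
def mTangent (k : Type*) {M : Type*} [Field k] [AddCommGroup M] [Module k M]
    (A : Set M) (x : M) : Submodule k M :=
  letI := Classical.decEq (Module.Dual k M)
  ⨅ p ∈ {p : MvPolynomial (Module.Dual k M) k | ∀ a ∈ A, mEval k a p = 0},
    LinearMap.ker (∑ l ∈ p.vars, mEval k x (MvPolynomial.pderiv l p) • (l : Module.Dual k M))

/-- `f : M → N` is a polynomial map on a subset `A ⊆ M`. -/
def IsPolyOn (k : Type*) {M N : Type*} [Field k] [AddCommGroup M] [Module k M]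
    [AddCommGroup N] [Module k N] (A : Set M) (f : M → N) : Prop :=
  ∀ l : Module.Dual k N, ∃ p : MvPolynomial (Module.Dual k M) k, ∀ x ∈ A, l (f x) = mEval k x p

/-- Dimension (topological Krull dimension) of a subset of a topological space. -/
def subDim {α : Type*} (t : TopologicalSpace α) (C : Set α) : WithBot ℕ∞ :=
  @topologicalKrullDim C (TopologicalSpace.induced (Subtype.val : C → α) t)

/-- The irreducible components of a subset `A` of a topological space
(for the subspace topology). -/
def subComponents {α : Type*} (t : TopologicalSpace α) (A : Set α) : Set (Set ↥A) :=
  @irreducibleComponents A (TopologicalSpace.induced (Subtype.val : A → α) t)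

/-- Dimension of a subset `C` of a subspace `A` of a topological space. -/
def compDim {α : Type*} (t : TopologicalSpace α) (A : Set α) (C : Set ↥A) : WithBot ℕ∞ :=
  subDim (TopologicalSpace.induced (Subtype.val : A → α) t) C

/-! ### Flags, Schubert cells and Schubert varieties -/

/-- A complete flag on a finite-dimensional vector space, recorded as the increasing
function sending `m` to the `m`-th member (of dimension `m`) of the flag. -/
def IsFlag {k M : Type*} [Field k] [AddCommGroup M] [Module k M]
    (E : ℕ → Submodule k M) : Prop :=
  Monotone E ∧ ∀ m : ℕ, finrank k ↥(E m) = min m (finrank k M)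

/-- Membership of `V` in the (open) Schubert cell `Ω°_I(E_•) ⊆ Gr(r, M)` attached to the
subset `I ⊆ [n]` recorded by the strictly increasing tuple `i : Fin r → Fin n`
(`0`-indexed: the `1`-based subset is `{i a + 1}`): `dim (V ∩ E_u) = #{a | i_a ≤ u}`. -/
def cellMem {k M : Type*} [Field k] [AddCommGroup M] [Module k M] {n r : ℕ}
    (i : Fin r → Fin n) (E : ℕ → Submodule k M) (V : Submodule k M) : Prop :=
  finrank k ↥V = r ∧
    ∀ u : ℕ, u ≤ n →
      finrank k ↥(V ⊓ E u) =
        (Finset.univ.filter (fun a : Fin r => (i a : ℕ) + 1 ≤ u)).card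

/-- Membership of `V` in the (closed) Schubert variety `Ω_I(E_•) ⊆ Gr(r, M)`:
`dim (V ∩ E_{i_a}) ≥ a` for `a = 1, …, r`. -/
def varMem {k M : Type*} [Field k] [AddCommGroup M] [Module k M] {n r : ℕ}
    (i : Fin r → Fin n) (E : ℕ → Submodule k M) (V : Submodule k M) : Prop :=
  finrank k ↥V = r ∧ ∀ a : Fin r, (a : ℕ) + 1 ≤ finrank k ↥(V ⊓ E ((i a : ℕ) + 1))

/-- The flag induced on a subspace `V` by a flag `E` on `M`: its `a`-th member is the
smallest subspace of the form `V ∩ E_u` of dimension `≥ a`. -/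
def indSub {k M : Type*} [Field k] [AddCommGroup M] [Module k M]
    (E : ℕ → Submodule k M) (V : Submodule k M) : ℕ → Submodule k ↥V := fun a =>
  ⨅ u ∈ {u : ℕ | a ≤ finrank k ↥(Submodule.comap V.subtype (E u))},
    Submodule.comap V.subtype (E u)

/-- The flag induced on the quotient `M ⧸ V` by a flag `E` on `M`: its `b`-th member is
the smallest subspace of the form `(E_u + V)/V` of dimension `≥ b`. -/
def indQuot {k M : Type*} [Field k] [AddCommGroup M] [Module k M]
    (E : ℕ → Submodule k M) (V : Submodule k M) : ℕ → Submodule k (M ⧸ V) := fun b =>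
  ⨅ u ∈ {u : ℕ | b ≤ finrank k ↥(Submodule.map V.mkQ (E u))},
    Submodule.map V.mkQ (E u)

/-- The flag spanned by a tuple of vectors (a complete flag when the tuple is a basis). -/
def spanFlag (k : Type*) {M : Type*} [Field k] [AddCommGroup M] [Module k M] {r : ℕ}
    (b : Fin r → M) : ℕ → Submodule k M := fun m =>
  Submodule.span k (b '' {a : Fin r | (a : ℕ) < m})

/-- `P` holds for a generic point of `Fl(M)^s` (`r = dim M`): there is a nonempty Zariski
open set of `s`-tuples of bases of `M` on which the associated tuples of complete flags
satisfy `P`. -/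
def GenericFlags (k : Type*) {M : Type*} [Field k] [AddCommGroup M] [Module k M]
    (s r : ℕ) (P : (Fin s → ℕ → Submodule k M) → Prop) : Prop :=
  ∃ U : Set (Fin s → Fin r → M),
    @IsOpen _ (mZariski k (Fin s → Fin r → M)) U ∧
    (∃ b ∈ U, ∀ j, LinearIndependent k (b j)) ∧
    ∀ b ∈ U, (∀ j, LinearIndependent k (b j)) → P (fun j => spanFlag k (b j))

/-- `P` holds for a generic point of `Fl(M)^s × Fl(Q)^s` (`r = dim M`, `q = dim Q`). -/
def GenericFlagPairs (k : Type*) {M Q : Type*} [Field k] [AddCommGroup M] [Module k M]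
    [AddCommGroup Q] [Module k Q] (s r q : ℕ)
    (P : (Fin s → ℕ → Submodule k M) → (Fin s → ℕ → Submodule k Q) → Prop) : Prop :=
  ∃ U : Set ((Fin s → Fin r → M) × (Fin s → Fin q → Q)),
    @IsOpen _ (mZariski k ((Fin s → Fin r → M) × (Fin s → Fin q → Q))) U ∧
    (∃ b ∈ U, (∀ j, LinearIndependent k (b.1 j)) ∧ ∀ j, LinearIndependent k (b.2 j)) ∧
    ∀ b ∈ U, ((∀ j, LinearIndependent k (b.1 j)) ∧ ∀ j, LinearIndependent k (b.2 j)) →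
      P (fun j => spanFlag k (b.1 j)) (fun j => spanFlag k (b.2 j))

/-! ### The spaces `Hom_𝓘(V, Q, 𝓕, 𝓖)` -/

/-- The subspace `{φ : M →ₗ Q | φ(p) ⊆ q}` of `Hom(M, Q)`. -/
def homConstraint {k M Q : Type*} [Field k] [AddCommGroup M] [Module k M]
    [AddCommGroup Q] [Module k Q] (p : Submodule k M) (q : Submodule k Q) :
    Submodule k (M →ₗ[k] Q) :=
  LinearMap.ker ((LinearMap.llcomp k ↥p Q (Q ⧸ q) q.mkQ).comp (LinearMap.lcomp k Q p.subtype))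

/-- `Hom_𝓘(M, Q, F, G) = {φ | φ(F^j_a) ⊆ G^j_{i^j_a - a} for all a = 1, …, r, j = 1, …, s}`. -/
def homSpace {k M Q : Type*} [Field k] [AddCommGroup M] [Module k M]
    [AddCommGroup Q] [Module k Q] {n r s : ℕ} (I : Fin s → Fin r → Fin n)
    (F : Fin s → ℕ → Submodule k M) (G : Fin s → ℕ → Submodule k Q) :
    Submodule k (M →ₗ[k] Q) :=
  ⨅ j : Fin s, ⨅ a : Fin r,
    homConstraint (F j ((a : ℕ) + 1)) (G j ((I j a : ℕ) - (a : ℕ)))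

/-! ### Charts on the Grassmannian, tangent spaces to Schubert cells -/

/-- The graph of `ψ : V →ₗ C`, a point of the Grassmannian chart around `V`
determined by a complement `C` of `V`. -/
def graphMap {k M : Type*} [Field k] [AddCommGroup M] [Module k M]
    (V C : Submodule k M) (ψ : ↥V →ₗ[k] ↥C) : Submodule k M :=
  LinearMap.range (V.subtype + C.subtype ∘ₗ ψ)

/-- The canonical identification `Hom(V, C) ≃ Hom(V, M/V)` (derivative of the chart). -/
def conjMap {k M : Type*} [Field k] [AddCommGroup M] [Module k M]
    (V C : Submodule k M) : (↥V →ₗ[k] ↥C) →ₗ[k] (↥V →ₗ[k] M ⧸ V) :=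
  LinearMap.llcomp k ↥V ↥C (M ⧸ V) (V.mkQ ∘ₗ C.subtype)

/-- The tangent space at `V` to a set `S` of points of the Grassmannian `Gr(r, M)`,
computed in the chart determined by a complement `C` of `V` and viewed inside
`Hom(V, M/V)` via the canonical identification. -/
def grTangent {k M : Type*} [Field k] [AddCommGroup M] [Module k M]
    (S : Set (Submodule k M)) (V C : Submodule k M) :
    Submodule k (↥V →ₗ[k] (M ⧸ V)) :=
  Submodule.map (conjMap V C)
    (mTangent k {ψ : ↥V →ₗ[k] ↥C | graphMap V C ψ ∈ S} 0)

/-- The Zariski topology on the Grassmannian of `r`-dimensional subspaces of `M`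
(as a topology on `Submodule k M`), coinduced from the Stiefel parameterization by
spanning `r`-tuples. -/
def grTop (k : Type*) {M : Type*} [Field k] [AddCommGroup M] [Module k M] (r : ℕ) :
    TopologicalSpace (Submodule k M) :=
  TopologicalSpace.coinduced (fun b : Fin r → M => Submodule.span k (Set.range b))
    (mZariski k (Fin r → M))

/-! ### Numerical quantities -/

/-- `codim ω_I = ∑_{a=1}^r (n - r + a - i_a)` (as an integer). -/
def codimZ (n r : ℕ) (i : Fin r → Fin n) : ℤ :=
  ∑ a : Fin r, ((n : ℤ) - (r : ℤ) + ((a : ℕ) : ℤ) - ((i a : ℕ) : ℤ))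

/-- The quantity `∑_j ∑_{a ∈ K^j} (n - r + a - i^j_a) - d(n - r)` of Inequality `(†^𝓘_𝓚)`. -/
def daggerZ (n r d : ℕ) {s : ℕ} (I : Fin s → Fin r → Fin n)
    (K : Fin s → Fin d → Fin r) : ℤ :=
  (∑ j : Fin s, ∑ t : Fin d,
      ((n : ℤ) - (r : ℤ) + ((K j t : ℕ) : ℤ) - ((I j (K j t) : ℕ) : ℤ)))
    - (d : ℤ) * ((n : ℤ) - (r : ℤ))

/-- The expected dimension `dim(S, M, 𝓕) = d(m - d) - ∑_j ∑_{t=1}^d (m - d + t - k^j_t)`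
of an intersection of Schubert cells `Ω°_{K^j}` in `Gr(d, m)`. -/
def eDimZ {s : ℕ} (m d : ℕ) (K : Fin s → Fin d → Fin m) : ℤ :=
  (d : ℤ) * ((m : ℤ) - (d : ℤ)) -
    ∑ j : Fin s, ∑ t : Fin d,
      ((m : ℤ) - (d : ℤ) + ((t : ℕ) : ℤ) - ((K j t : ℕ) : ℤ))

/-- `codim ω_I` as a natural number. -/
def codimN (n r : ℕ) (i : Fin r → Fin n) : ℕ :=
  ∑ a : Fin r, ((n - r + (a : ℕ)) - (i a : ℕ))

/-! ### The cohomology ring of the Grassmannian, Schubert classes -/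

/-- The ideal `(h_{n-r+1}, …, h_n)` of the polynomial ring in `r` variables
(`h_m` the complete homogeneous symmetric polynomials). -/
def grassIdeal (r n : ℕ) : Ideal (MvPolynomial (Fin r) ℤ) :=
  Ideal.span ((fun m : ℕ => MvPolynomial.hsymm (Fin r) ℤ m) '' Set.Icc (n - r + 1) n)

/-- A presentation of the cohomology (Chow) ring `H^*(Gr(r,n))`: products of Schubert
classes vanish here exactly when they vanish in `H^*(Gr(r,n))`. -/
abbrev grassRing (r n : ℕ) : Type :=
  MvPolynomial (Fin r) ℤ ⧸ grassIdeal r n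

/-- `h_m` for an integer `m` (zero for negative `m`). -/
def hkZ (r : ℕ) (m : ℤ) : MvPolynomial (Fin r) ℤ :=
  if 0 ≤ m then MvPolynomial.hsymm (Fin r) ℤ m.toNat else 0

/-- The Schur polynomial (Jacobi–Trudi determinant) of the partition
`λ_a = n - r + a - i_a` attached to the subset `I ⊆ [n]` recorded by `i`. -/
def schurI {n r : ℕ} (i : Fin r → Fin n) : MvPolynomial (Fin r) ℤ :=
  Matrix.det (Matrix.of fun a b : Fin r =>
    hkZ r ((n : ℤ) - (r : ℤ) + ((b : ℕ) : ℤ) - ((i a : ℕ) : ℤ)))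

/-- The Schubert class `ω_I ∈ H^*(Gr(r,n))` of the subset `I ⊆ [n]` recorded by the
strictly increasing tuple `i : Fin r → Fin n`. -/
def omegaCls {n r : ℕ} (i : Fin r → Fin n) : grassRing r n :=
  Ideal.Quotient.mk (grassIdeal r n) (schurI i)

/-- The class of a point in `H^*(Gr(r,n))`: the Schubert class of `I = {1, …, r}`. -/
def pointCls (r n : ℕ) (h : r ≤ n) : grassRing r n :=
  omegaCls (fun a : Fin r => Fin.castLE h a)

/-! ### Schur polynomials of partitions, Littlewood–Richardson coefficients -/

/-- The Schur polynomial of a partition with at most `r` parts, via Jacobi–Trudi. -/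
def schurP {r : ℕ} (lam : Fin r → ℕ) : MvPolynomial (Fin r) ℤ :=
  Matrix.det (Matrix.of fun a b : Fin r =>
    hkZ r (((lam a : ℕ) : ℤ) - ((a : ℕ) : ℤ) + ((b : ℕ) : ℤ)))

/-- The Vandermonde alternant `a_δ = det(x_a^{r-1-b})`. -/
def alternant (r : ℕ) : MvPolynomial (Fin r) ℤ :=
  Matrix.det (Matrix.of fun a b : Fin r => (MvPolynomial.X a) ^ (r - 1 - (b : ℕ)))

/-- The coefficient of the Schur polynomial `s_δ` in a symmetric polynomial `f`
(in `r` variables): the coefficient of the monomial `x^{δ + (r-1, …, 1, 0)}` in `f ⬝ a_δ`. -/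
def schurCoeff (r : ℕ) (f : MvPolynomial (Fin r) ℤ) (δ : Fin r → ℕ) : ℤ :=
  MvPolynomial.coeff
    (Finsupp.equivFunOnFinite.symm (fun a : Fin r => δ a + (r - 1 - (a : ℕ))))
    (f * alternant r)

/-- The Littlewood–Richardson coefficient `c^λ_{μ,ν}` (partitions with at most `r` parts):
the multiplicity of `V_λ` in `V_μ ⊗ V_ν`, i.e. of `s_λ` in `s_μ s_ν`. -/
def lrCoeff (r : ℕ) (lam mu nu : Fin r → ℕ) : ℤ :=
  schurCoeff r (schurP mu * schurP nu) lam

/-- The multiplicity of `V_δ` in `V_{Λ 1} ⊗ ⋯ ⊗ V_{Λ t}` (as `GL(r)`-representations),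
i.e. of `s_δ` in `∏_j s_{Λ j}`. -/
def multiCoeff (r : ℕ) {t : ℕ} (Λ : Fin t → Fin r → ℕ) (δ : Fin r → ℕ) : ℤ :=
  schurCoeff r (∏ j : Fin t, schurP (Λ j)) δ

set_option linter.unusedSectionVars false

namespace PadicLattice

section

variable {p : ℕ} [hp : Fact p.Prime] {V : Type*} [AddCommGroup V] [Module ℤ_[p] V]

/-- The `p`-adic valuation of the relative index of `A` in `B`. -/
def len (A B : Submodule ℤ_[p] V) : ℕ :=
  padicValNat p (A.toAddSubgroup.relIndex B.toAddSubgroup)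

/-- `B` is finitely generated and torsion modulo `A`. -/
def FinOver (A B : Submodule ℤ_[p] V) : Prop :=
  B.FG ∧ ∀ v ∈ B, ∃ n : ℕ, (p ^ n : ℕ) • v ∈ A

/-- The preimage of `A` under multiplication by `p ^ k`. -/
def up (k : ℕ) (A : Submodule ℤ_[p] V) : Submodule ℤ_[p] V :=
  A.comap ((p ^ k : ℕ) • LinearMap.id)

/-- The image of `A` under multiplication by `p ^ k`. -/
def dn (k : ℕ) (A : Submodule ℤ_[p] V) : Submodule ℤ_[p] V :=
  A.map ((p ^ k : ℕ) • LinearMap.id)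

@[simp] lemma mem_up {k : ℕ} {A : Submodule ℤ_[p] V} {v : V} :
    v ∈ up k A ↔ (p ^ k : ℕ) • v ∈ A := Iff.rfl

lemma mem_dn {k : ℕ} {A : Submodule ℤ_[p] V} {v : V} :
    v ∈ dn k A ↔ ∃ w ∈ A, (p ^ k : ℕ) • w = v := Iff.rfl

lemma up_mono (k : ℕ) {A B : Submodule ℤ_[p] V} (h : A ≤ B) : up k A ≤ up k B :=
  Submodule.comap_mono h

lemma dn_mono (k : ℕ) {A B : Submodule ℤ_[p] V} (h : A ≤ B) : dn k A ≤ dn k B :=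
  Submodule.map_mono h

lemma le_up (k : ℕ) (A : Submodule ℤ_[p] V) : A ≤ up k A := fun _ h =>
  A.toAddSubmonoid.nsmul_mem h _

lemma dn_le (k : ℕ) (A : Submodule ℤ_[p] V) : dn k A ≤ A := by
  rintro _ ⟨w, hw, rfl⟩
  exact A.toAddSubmonoid.nsmul_mem hw _

lemma dn_le_iff {k : ℕ} {A B : Submodule ℤ_[p] V} : dn k A ≤ B ↔ A ≤ up k B :=
  Submodule.map_le_iff_le_comap

lemma up_up (j k : ℕ) (A : Submodule ℤ_[p] V) : up j (up k A) = up (j + k) A := by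
  ext v
  rw [mem_up, mem_up, mem_up, ← mul_smul, ← pow_add, add_comm]

lemma up_zero (A : Submodule ℤ_[p] V) : up 0 A = A := by
  ext v; simp

lemma up_inf (k : ℕ) (A B : Submodule ℤ_[p] V) : up k (A ⊓ B) = up k A ⊓ up k B := rfl

lemma up_le_up_of_le {j k : ℕ} (h : j ≤ k) (A : Submodule ℤ_[p] V) : up j A ≤ up k A := by
  obtain ⟨c, rfl⟩ := Nat.exists_eq_add_of_le h
  rw [add_comm, ← up_up]
  exact le_up _ _

lemma FinOver.mono {A A' B B' : Submodule ℤ_[p] V} (h : FinOver A B) (hA : A ≤ A')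
    (hB : B' ≤ B) : FinOver A' B' := by
  refine ⟨?_, fun v hv => ?_⟩
  · have : IsNoetherian ℤ_[p] B := isNoetherian_of_fg_of_noetherian _ h.1
    exact (isNoetherian_submodule.1 ‹_›) B' hB
  · obtain ⟨n, hn⟩ := h.2 v (hB hv)
    exact ⟨n, hA hn⟩

lemma FinOver.exists_le_up {A B : Submodule ℤ_[p] V} (h : FinOver A B) : ∃ n, B ≤ up n A := by
  obtain ⟨s, hs⟩ := h.1
  have : ∀ v : V, ∃ n, v ∈ B → v ∈ up n A := fun v => by
    by_cases hv : v ∈ B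
    · obtain ⟨n, hn⟩ := h.2 v hv
      exact ⟨n, fun _ => hn⟩
    · exact ⟨0, fun h => absurd h hv⟩
  choose f hf using this
  refine ⟨s.sup f, ?_⟩
  conv_lhs => rw [← hs]
  rw [Submodule.span_le]
  intro v hv
  have hvB : v ∈ B := by rw [← hs]; exact Submodule.subset_span hv
  exact up_le_up_of_le (Finset.le_sup hv) _ (hf v hvB)

lemma FinOver.inf {A B A' : Submodule ℤ_[p] V} (h : FinOver A B) :
    FinOver (A ⊓ A') (B ⊓ A') := by
  refine ⟨(h.mono le_rfl inf_le_left).1, fun v hv => ?_⟩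
  obtain ⟨n, hn⟩ := h.2 v hv.1
  exact ⟨n, hn, A'.toAddSubmonoid.nsmul_mem hv.2 _⟩

lemma toAddSubgroup_mono' {A B : Submodule ℤ_[p] V} (h : A ≤ B) :
    A.toAddSubgroup ≤ B.toAddSubgroup := h

lemma relIndex_ne_zero_of_le_up_one {A B : Submodule ℤ_[p] V} (hB : B.FG) (h : B ≤ up 1 A) :
    A.toAddSubgroup.relIndex B.toAddSubgroup ≠ 0 := by
  obtain ⟨n, f, hf⟩ := (Submodule.fg_iff_exists_fin_linearMap _ _).1 hB
  have h1 : B.toAddSubgroup = (⊤ : AddSubgroup (Fin n → ℤ_[p])).map f.toAddMonoidHom := by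
    ext v
    rw [Submodule.mem_toAddSubgroup, ← hf]
    simp
  rw [h1, ← AddSubgroup.relIndex_comap, AddSubgroup.relIndex_top_right]
  let g : (Fin n → ℤ_[p]) →+ (Fin n → ZMod p) :=
    AddMonoidHom.pi fun i => (PadicInt.toZMod (p := p)).toAddMonoidHom.comp
      (Pi.evalAddMonoidHom _ i)
  have h2 : g.ker ≤ A.toAddSubgroup.comap f.toAddMonoidHom := by
    intro x hx
    have : ∀ i, ∃ y, x i = p * y := by
      intro i
      have h3 : PadicInt.toZMod (x i) = 0 := congrFun hx i
      have h4 : x i ∈ RingHom.ker (PadicInt.toZMod (p := p)) := h3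
      rw [PadicInt.ker_toZMod, PadicInt.maximalIdeal_eq_span_p,
        Ideal.mem_span_singleton] at h4
      exact h4
    choose y hy using this
    have hxy : x = (p : ℕ) • y := by
      ext i; simp [hy]
    have : f y ∈ B := by rw [← hf]; exact ⟨y, rfl⟩
    have := h this
    rw [mem_up, pow_one, ← map_nsmul, ← hxy] at this
    exact this
  have h3 : g.ker.index ≠ 0 := by
    rw [AddSubgroup.index_ker]
    exact Nat.card_pos.ne'
  intro h0
  have := AddSubgroup.index_dvd_of_le h2
  rw [h0] at this
  exact h3 (Nat.eq_zero_of_zero_dvd this)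

lemma FinOver.relIndex_ne_zero {A B : Submodule ℤ_[p] V} (h : FinOver A B) :
    A.toAddSubgroup.relIndex B.toAddSubgroup ≠ 0 := by
  obtain ⟨n, hn⟩ := h.exists_le_up
  have hB := h.1
  clear h
  induction n generalizing A with
  | zero =>
    rw [up_zero] at hn
    rw [AddSubgroup.relIndex_eq_one.2 (toAddSubgroup_mono' hn)]
    exact one_ne_zero
  | succ n ih =>
    have h1 := @ih (up 1 A ⊓ B) (le_inf (by rwa [up_up]) (le_up _ _) |>.trans (up_inf _ _ _).ge)
    have h2 : (A ⊓ B).toAddSubgroup.relIndex (up 1 A ⊓ B).toAddSubgroup ≠ 0 := by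
      refine relIndex_ne_zero_of_le_up_one ?_ ?_
      · have : IsNoetherian ℤ_[p] B := isNoetherian_of_fg_of_noetherian _ hB
        exact (isNoetherian_submodule.1 ‹_›) _ inf_le_right
      · rw [up_inf]; exact inf_le_inf le_rfl (le_up _ _)
    rw [← AddSubgroup.inf_relIndex_right, show A.toAddSubgroup ⊓ B.toAddSubgroup = (A ⊓ B).toAddSubgroup from rfl,
      ← AddSubgroup.relIndex_mul_relIndex _ _ _
      (toAddSubgroup_mono' (inf_le_inf (le_up 1 A) (le_refl B)))
      (toAddSubgroup_mono' inf_le_right)]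
    exact mul_ne_zero h2 h1

lemma len_inf_right (A B : Submodule ℤ_[p] V) : len (A ⊓ B) B = len A B :=
  congrArg (padicValNat p) (AddSubgroup.inf_relIndex_right A.toAddSubgroup B.toAddSubgroup)

lemma len_eq_zero_of_le {A B : Submodule ℤ_[p] V} (h : B ≤ A) : len A B = 0 := by
  unfold len
  rw [AddSubgroup.relIndex_eq_one.2 (toAddSubgroup_mono' h)]
  simp

lemma len_self (A : Submodule ℤ_[p] V) : len A A = 0 := len_eq_zero_of_le le_rfl

lemma len_add {A B C : Submodule ℤ_[p] V} (hAB : A ≤ B) (hBC : B ≤ C) (h : FinOver A C) :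
    len A B + len B C = len A C := by
  unfold len
  rw [← AddSubgroup.relIndex_mul_relIndex _ _ _ (toAddSubgroup_mono' hAB)
    (toAddSubgroup_mono' hBC), padicValNat.mul]
  · exact (h.mono le_rfl hBC).relIndex_ne_zero
  · exact (h.mono hAB le_rfl).relIndex_ne_zero

lemma len_sup (A B : Submodule ℤ_[p] V) : len A (A ⊔ B) = len A B := by
  unfold len
  rw [Submodule.sup_toAddSubgroup, AddSubgroup.relIndex_sup_left]

lemma len_le_of_le_left {A A' B : Submodule ℤ_[p] V} (hA : A ≤ A') (h : FinOver A B) :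
    len A' B ≤ len A B :=
  (padicValNat_dvd_iff_le h.relIndex_ne_zero).1
    ((pow_padicValNat_dvd).trans (AddSubgroup.relIndex_dvd_of_le_left _ (toAddSubgroup_mono' hA)))

lemma len_mono {A A' B B' : Submodule ℤ_[p] V} (hB : B ≤ B') (hA : B ⊓ A' ≤ A)
    (h : FinOver A' B') : len A B ≤ len A' B' := by
  have h1 : FinOver (A' ⊓ B') B' := by
    refine ⟨h.1, fun v hv => ?_⟩
    obtain ⟨n, hn⟩ := h.2 v hv
    exact ⟨n, hn, B'.toAddSubmonoid.nsmul_mem hv _⟩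
  have h2 : len A' B = len (A' ⊓ B') B := by
    rw [← len_inf_right A', ← len_inf_right (A' ⊓ B'), inf_assoc, inf_eq_right.2 hB]
  have h3 : FinOver A' B := h.mono le_rfl hB
  have h4 : len A B ≤ len A' B := by
    have : FinOver (A' ⊓ B) B := by
      refine ⟨h3.1, fun v hv => ?_⟩
      obtain ⟨n, hn⟩ := h3.2 v hv
      exact ⟨n, hn, B.toAddSubmonoid.nsmul_mem hv _⟩
    rw [← len_inf_right A' B]
    exact len_le_of_le_left (by rwa [inf_comm]) this
  refine h4.trans ?_
  rw [h2, ← len_sup, ← len_inf_right A' B', ← len_add le_sup_left (sup_le inf_le_right hB) h1]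
  omega

lemma len_le_of_le_right {A B B' : Submodule ℤ_[p] V} (hB : B ≤ B') (h : FinOver A B') :
    len A B ≤ len A B' := len_mono hB inf_le_right h

lemma relIndex_sup_span_singleton {U : Submodule ℤ_[p] V} {v : V} (hv : v ∉ U)
    (hpv : p • v ∈ U) : U.toAddSubgroup.relIndex (U ⊔ span ℤ_[p] {v}).toAddSubgroup = p := by
  rw [Submodule.sup_toAddSubgroup, AddSubgroup.relIndex_sup_left]
  let f : ℤ_[p] →ₗ[ℤ_[p]] V := LinearMap.toSpanSingleton ℤ_[p] V v
  have h1 : (span ℤ_[p] {v}).toAddSubgroup = (⊤ : AddSubgroup ℤ_[p]).map f.toAddMonoidHom := by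
    ext w
    rw [Submodule.mem_toAddSubgroup, Submodule.mem_span_singleton]
    simp [f]
  rw [h1, ← AddSubgroup.relIndex_comap, AddSubgroup.relIndex_top_right]
  have h2 : U.comap f = RingHom.ker (PadicInt.toZMod (p := p)) := by
    rw [PadicInt.ker_toZMod]
    symm
    apply (IsLocalRing.maximalIdeal.isMaximal ℤ_[p]).eq_of_le
    · intro h
      apply hv
      have : (1 : ℤ_[p]) ∈ U.comap f := by rw [h]; trivial
      simpa [f] using this
    · rw [PadicInt.maximalIdeal_eq_span_p, Ideal.span_singleton_le_iff_mem]
      simpa [f, Nat.cast_smul_eq_nsmul] using hpv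
  have h3 : U.toAddSubgroup.comap f.toAddMonoidHom
      = (PadicInt.toZMod (p := p)).toAddMonoidHom.ker := by
    ext x
    have := SetLike.ext_iff.1 h2 x
    exact this
  rw [h3, AddSubgroup.index_ker]
  have h4 : (PadicInt.toZMod (p := p)).toAddMonoidHom.range = ⊤ := by
    rw [AddMonoidHom.range_eq_top]
    exact ZMod.ringHom_surjective _
  rw [h4]
  simp

lemma len_sup_span_singleton {U : Submodule ℤ_[p] V} {v : V} (hv : v ∉ U)
    (hpv : p • v ∈ U) : len U (U ⊔ span ℤ_[p] {v}) = 1 := by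
  unfold len
  rw [relIndex_sup_span_singleton hv hpv, padicValNat_self]

lemma exists_notMem_smul_mem {A B : Submodule ℤ_[p] V} (h : FinOver A B) (hB : ¬ B ≤ A) :
    ∃ v ∈ B, v ∉ A ∧ p • v ∈ A := by
  classical
  obtain ⟨v, hv, hvA⟩ := SetLike.not_le_iff_exists.1 hB
  have hex := h.2 v hv
  have h0 : Nat.find hex ≠ 0 := by
    intro h0
    have := Nat.find_spec hex
    rw [h0] at this
    exact hvA (by simpa using this)
  obtain ⟨n, hn⟩ := Nat.exists_eq_succ_of_ne_zero h0
  refine ⟨p ^ n • v, B.toAddSubmonoid.nsmul_mem hv _, Nat.find_min hex (by omega), ?_⟩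
  have := Nat.find_spec hex
  rw [hn] at this
  rwa [← mul_smul, ← pow_succ']

lemma le_of_len_eq_zero {A B : Submodule ℤ_[p] V} (h : FinOver A B) (h0 : len A B = 0) :
    B ≤ A := by
  by_contra hB
  obtain ⟨v, hv, hvA, hpv⟩ := exists_notMem_smul_mem h hB
  have h1 : A ⊔ span ℤ_[p] {v} ≤ A ⊔ B :=
    sup_le_sup_left ((span_singleton_le_iff_mem _ _).2 hv) A
  have h2 := len_sup_span_singleton hvA hpv
  have h3 : len A (span ℤ_[p] {v}) ≤ len A B :=
    len_le_of_le_right ((span_singleton_le_iff_mem _ _).2 hv) h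
  rw [← len_sup] at h3
  omega

end

section

variable {p : ℕ} [hp : Fact p.Prime] {V : Type*} [AddCommGroup V] [Module ℤ_[p] V]
  [Module ℚ_[p] V] [IsScalarTower ℤ_[p] ℚ_[p] V]

/-- A subspace viewed as a `ℤ_[p]`-submodule. -/
abbrev rs (T : Submodule ℚ_[p] V) : Submodule ℤ_[p] V := T.restrictScalars ℤ_[p]

lemma p_ne : (p : ℚ_[p]) ≠ 0 := Nat.cast_ne_zero.2 hp.out.ne_zero

lemma pow_nsmul_inj {k : ℕ} {v w : V} (h : p ^ k • v = p ^ k • w) : v = w := by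
  have h1 : ((p : ℚ_[p]) ^ k) • v = ((p : ℚ_[p]) ^ k) • w := by
    rw [← Nat.cast_pow, Nat.cast_smul_eq_nsmul, Nat.cast_smul_eq_nsmul, h]
  exact smul_right_injective V (pow_ne_zero k p_ne) h1

variable (p) in
lemma exists_pow_nsmul_eq (k : ℕ) (v : V) : ∃ w : V, p ^ k • w = v := by
  refine ⟨((p : ℚ_[p]) ^ k)⁻¹ • v, ?_⟩
  rw [← Nat.cast_smul_eq_nsmul ℚ_[p], Nat.cast_pow, smul_inv_smul₀ (pow_ne_zero k p_ne)]

@[simp] lemma pow_nsmul_mem_iff {k : ℕ} {T : Submodule ℚ_[p] V} {v : V} :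
    p ^ k • v ∈ T ↔ v ∈ T := by
  rw [← Nat.cast_smul_eq_nsmul ℚ_[p], Nat.cast_pow]
  exact T.smul_mem_iff (pow_ne_zero k p_ne)

lemma up_rs (k : ℕ) (T : Submodule ℚ_[p] V) : up k (rs T) = rs T := by
  ext v; simp

lemma up_inf_rs (k : ℕ) (A : Submodule ℤ_[p] V) (T : Submodule ℚ_[p] V) :
    up k (A ⊓ rs T) = up k A ⊓ rs T := by rw [up_inf, up_rs]

lemma up_dn (k : ℕ) (A : Submodule ℤ_[p] V) : up k (dn k A) = A := by
  ext v
  rw [mem_up, mem_dn]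
  exact ⟨fun ⟨w, hw, h⟩ => pow_nsmul_inj h ▸ hw, fun h => ⟨v, h, rfl⟩⟩

lemma dn_up (k : ℕ) (A : Submodule ℤ_[p] V) : dn k (up k A) = A := by
  ext v
  rw [mem_dn]
  refine ⟨fun ⟨w, hw, h⟩ => h ▸ hw, fun h => ?_⟩
  obtain ⟨w, rfl⟩ := exists_pow_nsmul_eq p k v
  exact ⟨w, h, rfl⟩

lemma dn_inf (k : ℕ) (A B : Submodule ℤ_[p] V) : dn k (A ⊓ B) = dn k A ⊓ dn k B := by
  conv_rhs => rw [← dn_up k (dn k A ⊓ dn k B), up_inf, up_dn, up_dn]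

lemma dn_rs (k : ℕ) (T : Submodule ℚ_[p] V) : dn k (rs T) = rs T := by
  conv_rhs => rw [← dn_up k (rs T), up_rs]

lemma dn_inf_rs (k : ℕ) (A : Submodule ℤ_[p] V) (T : Submodule ℚ_[p] V) :
    dn k (A ⊓ rs T) = dn k A ⊓ rs T := by rw [dn_inf, dn_rs]

lemma up_sup (k : ℕ) (A B : Submodule ℤ_[p] V) : up k (A ⊔ B) = up k A ⊔ up k B := by
  conv_lhs => rw [← dn_up k A, ← dn_up k B]
  unfold dn
  rw [← Submodule.map_sup]
  exact up_dn k _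

lemma up_fg {k : ℕ} {A : Submodule ℤ_[p] V} (h : A.FG) : (up k A).FG := by
  refine Submodule.fg_of_fg_map_injective ((p ^ k : ℕ) • LinearMap.id) ?_ (?_ : (dn k _).FG)
  · intro v w h
    exact pow_nsmul_inj h
  · rwa [dn_up]

lemma len_up (k : ℕ) (A B : Submodule ℤ_[p] V) : len (up k A) (up k B) = len A B := by
  unfold len
  have h := AddSubgroup.relIndex_comap A.toAddSubgroup
    ((p ^ k : ℕ) • LinearMap.id : V →ₗ[ℤ_[p]] V).toAddMonoidHom (up k B).toAddSubgroup
  have h2 : (up k B).toAddSubgroup.map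
      ((p ^ k : ℕ) • LinearMap.id : V →ₗ[ℤ_[p]] V).toAddMonoidHom = B.toAddSubgroup :=
    congrArg Submodule.toAddSubgroup (dn_up k B)
  rw [h2] at h
  rw [← h]
  rfl

lemma len_dn (k : ℕ) (A B : Submodule ℤ_[p] V) : len (dn k A) (dn k B) = len A B := by
  rw [← len_up k, up_dn, up_dn]

lemma finOver_up {A : Submodule ℤ_[p] V} (h : A.FG) (k : ℕ) : FinOver A (PadicLattice.up k A) :=
  ⟨up_fg h, fun _ hv => ⟨k, hv⟩⟩

lemma len_up_one {A : Submodule ℤ_[p] V} (hA : A.FG) {T : Submodule ℚ_[p] V} (hAT : A ≤ rs T)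
    (hT : ∀ v ∈ T, ∃ n : ℕ, p ^ n • v ∈ A) : len A (up 1 A) = finrank ℚ_[p] T := by
  have : Module.Finite ℤ_[p] A := Module.Finite.iff_fg.2 hA
  have : Module.IsTorsionFree ℤ_[p] V := by
    exact Module.IsTorsionFree.trans_faithfulSMul ℤ_[p] ℚ_[p] V
  have : Module.Free ℤ_[p] A := inferInstance
  let b := Module.finBasis ℤ_[p] A
  set d := finrank ℤ_[p] A
  let b' : Fin d → V := fun i => (b i : V)
  have hli : LinearIndependent ℚ_[p] b' := by
    rw [← LinearIndependent.iff_fractionRing ℤ_[p] ℚ_[p]]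
    exact b.linearIndependent.map' A.subtype (Submodule.ker_subtype A)
  have hspanA : ∀ v ∈ A, v ∈ span ℚ_[p] (Set.range b') := by
    intro v hv
    have h1 := b.sum_repr ⟨v, hv⟩
    have h2 := congrArg (A.subtype) h1
    rw [map_sum] at h2
    simp only [Submodule.subtype_apply] at h2
    rw [← h2]
    refine Submodule.sum_mem _ fun i _ => ?_
    have : (b.repr ⟨v, hv⟩ i • (b i : V)) = (algebraMap ℤ_[p] ℚ_[p] (b.repr ⟨v, hv⟩ i)) • b' i := by
      rw [algebraMap_smul]
    rw [Submodule.coe_smul, this]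
    exact Submodule.smul_mem _ _ (Submodule.subset_span ⟨i, rfl⟩)
  have hspan : span ℚ_[p] (Set.range b') = T := by
    apply le_antisymm
    · rw [Submodule.span_le]
      rintro _ ⟨i, rfl⟩
      exact hAT (b i).2
    · intro v hv
      obtain ⟨n, hn⟩ := hT v hv
      exact pow_nsmul_mem_iff.1 (hspanA _ hn)
  have hd : finrank ℚ_[p] T = d := by
    rw [← hspan, finrank_span_eq_card hli, Fintype.card_fin]
  rw [hd]
  let g : A →+ (Fin d → ZMod p) :=
    AddMonoidHom.pi fun i => (PadicInt.toZMod (p := p)).toAddMonoidHom.comp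
      ((Finsupp.applyAddHom i).comp b.repr.toLinearMap.toAddMonoidHom)
  have hg : Function.Surjective g := by
    intro y
    choose x hx using fun i => ZMod.ringHom_surjective (PadicInt.toZMod (p := p)) (y i)
    refine ⟨b.repr.symm (Finsupp.equivFunOnFinite.symm x), ?_⟩
    ext i
    have : b.repr (b.repr.symm (Finsupp.equivFunOnFinite.symm x)) i = x i := by simp
    exact (congrArg _ this).trans (hx i)
  let f : A →+ V := (DistribSMul.toAddMonoidHom V ((p : ℚ_[p])⁻¹)).comp A.subtype.toAddMonoidHom
  have hf : ∀ a, p • f a = a := by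
    intro a
    show p • ((p : ℚ_[p])⁻¹ • (a : V)) = a
    rw [← Nat.cast_smul_eq_nsmul ℚ_[p], smul_inv_smul₀ p_ne]
  have h1 : (up 1 A).toAddSubgroup = (⊤ : AddSubgroup A).map f := by
    ext v
    rw [Submodule.mem_toAddSubgroup, mem_up, pow_one]
    constructor
    · intro h
      refine ⟨⟨_, h⟩, trivial, ?_⟩
      apply pow_nsmul_inj (p := p) (k := 1)
      rw [pow_one, hf]
    · rintro ⟨a, -, rfl⟩
      rw [hf]; exact a.2
  unfold len
  rw [h1, ← AddSubgroup.relIndex_comap, AddSubgroup.relIndex_top_right]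
  have h2 : A.toAddSubgroup.comap f = g.ker := by
    ext a
    constructor
    · intro h
      have h3 : a = p • (⟨f a, h⟩ : A) := Subtype.ext (hf a).symm
      ext i
      show PadicInt.toZMod (b.repr a i) = 0
      rw [h3]
      simp
    · intro h
      have h3 : ∀ i, ∃ y, b.repr a i = p * y := by
        intro i
        have h3 : PadicInt.toZMod (b.repr a i) = 0 := congrFun h i
        have h4 : b.repr a i ∈ RingHom.ker (PadicInt.toZMod (p := p)) := h3
        rw [PadicInt.ker_toZMod, PadicInt.maximalIdeal_eq_span_p,
          Ideal.mem_span_singleton] at h4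
        exact h4
      choose y hy using h3
      have h4 : a = p • b.repr.symm (Finsupp.equivFunOnFinite.symm y) := by
        apply b.repr.injective
        rw [map_nsmul]
        ext i
        simp [hy]
      show f a ∈ A
      have h5 : f a = (b.repr.symm (Finsupp.equivFunOnFinite.symm y) : A) := by
        apply pow_nsmul_inj (p := p) (k := 1)
        rw [pow_one, hf]
        exact congrArg A.subtype h4
      rw [h5]
      exact Subtype.coe_prop _
  rw [h2, AddSubgroup.index_ker, AddMonoidHom.range_eq_top.2 hg]
  simp

lemma len_up_eq {A : Submodule ℤ_[p] V} (hA : A.FG) {T : Submodule ℚ_[p] V} (hAT : A ≤ rs T)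
    (hT : ∀ v ∈ T, ∃ n : ℕ, p ^ n • v ∈ A) (k : ℕ) : len A (up k A) = k * finrank ℚ_[p] T := by
  induction k with
  | zero => rw [up_zero, len_self, zero_mul]
  | succ k ih =>
    rw [← len_add (le_up k A) (up_le_up_of_le k.le_succ A) (finOver_up hA _), ih,
      Nat.succ_eq_add_one, ← up_up, len_up, len_up_one hA hAT hT, add_mul, one_mul]

/-- A finitely generated submodule of full rank. -/
def IsLat (L : Submodule ℤ_[p] V) : Prop := L.FG ∧ ∀ v, ∃ n : ℕ, p ^ n • v ∈ L

lemma IsLat.finOver {L L' : Submodule ℤ_[p] V} (h : IsLat L) (h' : IsLat L') : FinOver L L' :=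
  ⟨h'.1, fun v _ => h.2 v⟩

lemma IsLat.finOver_inf {L L' : Submodule ℤ_[p] V} (h : IsLat L) (h' : IsLat L')
    (B : Submodule ℤ_[p] V) : FinOver (L ⊓ B) (L' ⊓ B) := (h.finOver h').inf

lemma IsLat.of_le {L L' B : Submodule ℤ_[p] V} (h : IsLat L) (h' : IsLat L') (h1 : L ≤ B)
    (h2 : B ≤ L') : IsLat B :=
  ⟨((h.finOver h').mono le_rfl h2).1, fun v => (h.2 v).imp fun _ hn => h1 hn⟩

lemma IsLat.up {L : Submodule ℤ_[p] V} (h : IsLat L) (k : ℕ) : IsLat (up k L) :=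
  ⟨up_fg h.1, fun v => (h.2 v).imp fun _ hn => le_up _ _ hn⟩

lemma IsLat.dn {L : Submodule ℤ_[p] V} (h : IsLat L) (k : ℕ) : IsLat (dn k L) := by
  refine ⟨h.1.map _, fun v => ?_⟩
  obtain ⟨n, hn⟩ := h.2 v
  exact ⟨n + k, by rw [add_comm, pow_add, mul_smul]; exact ⟨_, hn, rfl⟩⟩

lemma IsLat.sup {L L' : Submodule ℤ_[p] V} (h : IsLat L) (h' : IsLat L') : IsLat (L ⊔ L') :=
  ⟨h.1.sup h'.1, fun v => (h.2 v).imp fun _ hn => le_sup_left (a := L) hn⟩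

lemma IsLat.inf {L L' : Submodule ℤ_[p] V} (h : IsLat L) (h' : IsLat L') : IsLat (L ⊓ L') := by
  refine ⟨(h.finOver_inf h' L).1 |>.elim fun s hs => ⟨s, by rw [hs, inf_comm]⟩, fun v => ?_⟩
  obtain ⟨n, hn⟩ := h.2 v
  obtain ⟨m, hm⟩ := h'.2 v
  refine ⟨n + m, ?_, ?_⟩
  · rw [add_comm, pow_add, mul_smul]; exact L.toAddSubmonoid.nsmul_mem hn _
  · rw [pow_add, mul_smul]; exact L'.toAddSubmonoid.nsmul_mem hm _

lemma IsLat.inf_rs_fg {L : Submodule ℤ_[p] V} (h : IsLat L) (B : Submodule ℤ_[p] V) :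
    (L ⊓ B).FG := ((h.finOver h).mono le_rfl inf_le_left).1

lemma IsLat.len_inf_rs {L : Submodule ℤ_[p] V} (h : IsLat L) (T : Submodule ℚ_[p] V) (k : ℕ) :
    len (L ⊓ rs T) (PadicLattice.up k L ⊓ rs T) = k * finrank ℚ_[p] T := by
  rw [← up_inf_rs, len_up_eq (h.inf_rs_fg _) inf_le_right]
  intro v hv
  obtain ⟨n, hn⟩ := h.2 v
  exact ⟨n, hn, by simpa using hv⟩

lemma IsLat.len_up {L : Submodule ℤ_[p] V} (h : IsLat L) (k : ℕ) :
    len L (PadicLattice.up k L) = k * finrank ℚ_[p] V := by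
  rw [len_up_eq h.1 (T := ⊤) (fun _ _ => trivial) (fun v _ => h.2 v), finrank_top]

/-- Enlarge `L` by the vectors `v` with `p • v ∈ L ⊓ W`. -/
def enl (W : Submodule ℚ_[p] V) (L : Submodule ℤ_[p] V) : Submodule ℤ_[p] V :=
  L ⊔ (up 1 L ⊓ rs W)

lemma le_enl (W : Submodule ℚ_[p] V) (L : Submodule ℤ_[p] V) : L ≤ enl W L := le_sup_left

lemma enl_le_up (W : Submodule ℚ_[p] V) (L : Submodule ℤ_[p] V) : enl W L ≤ up 1 L :=
  sup_le (le_up _ _) inf_le_left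

lemma enl_mono (W : Submodule ℚ_[p] V) {L L' : Submodule ℤ_[p] V} (h : L ≤ L') :
    enl W L ≤ enl W L' := sup_le_sup h (inf_le_inf (up_mono 1 h) le_rfl)

lemma IsLat.enl {L : Submodule ℤ_[p] V} (h : IsLat L) (W : Submodule ℚ_[p] V) :
    IsLat (enl W L) := h.of_le (h.up 1) (le_enl W L) (enl_le_up W L)

lemma IsLat.len_enl {L : Submodule ℤ_[p] V} (h : IsLat L) (W : Submodule ℚ_[p] V) :
    len L (PadicLattice.enl W L) = finrank ℚ_[p] W := by
  unfold PadicLattice.enl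
  rw [len_sup, ← len_inf_right, ← inf_assoc, inf_eq_left.2 (le_up 1 L), h.len_inf_rs, one_mul]

lemma IsLat.le_len_enl_inf [FiniteDimensional ℚ_[p] V] {L : Submodule ℤ_[p] V} (h : IsLat L)
    (W S : Submodule ℚ_[p] V) :
    finrank ℚ_[p] (S ⊓ W : Submodule ℚ_[p] V)
      ≤ len (L ⊓ rs S) (PadicLattice.enl W L ⊓ rs S) := by
  have := h.len_inf_rs (S ⊓ W) 1
  rw [one_mul] at this
  rw [← this]
  refine len_mono ?_ ?_ (h.finOver_inf (h.enl W) _)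
  · refine le_inf ?_ ?_
    · refine le_trans ?_ le_sup_right
      exact inf_le_inf le_rfl fun v hv => hv.2
    · exact inf_le_right.trans fun v hv => hv.1
  · exact fun v hv => ⟨hv.2.1, hv.1.2⟩

end

section Compactness

variable {p : ℕ} [hp : Fact p.Prime] {r : ℕ}

variable (p r) in
/-- The standard lattice. -/
def stdLat : Submodule ℤ_[p] (Fin r → ℚ_[p]) :=
  LinearMap.range (LinearMap.pi fun i => (Algebra.linearMap ℤ_[p] ℚ_[p]).comp (LinearMap.proj i) :
    (Fin r → ℤ_[p]) →ₗ[ℤ_[p]] (Fin r → ℚ_[p]))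

lemma mem_stdLat {v : Fin r → ℚ_[p]} : v ∈ stdLat p r ↔ ∀ i, ‖v i‖ ≤ 1 := by
  constructor
  · rintro ⟨x, rfl⟩ i
    exact (x i).2
  · intro h
    exact ⟨fun i => ⟨v i, h i⟩, rfl⟩

lemma exists_pow_mul_norm_le (c : ℚ_[p]) : ∃ n, ∀ m, n ≤ m → ‖(p : ℚ_[p]) ^ m * c‖ ≤ 1 := by
  have h1 : (1 : ℝ) < p := by exact_mod_cast hp.out.one_lt
  obtain ⟨n, hn⟩ := pow_unbounded_of_one_lt ‖c‖ h1
  refine ⟨n, fun m hm => ?_⟩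
  rw [norm_mul, norm_pow, Padic.norm_p, inv_pow, inv_mul_le_iff₀ (by positivity), mul_one]
  exact hn.le.trans (pow_le_pow_right₀ h1.le hm)

lemma isLat_stdLat : IsLat (stdLat p r) := by
  refine ⟨?_, fun v => ?_⟩
  · unfold stdLat
    rw [LinearMap.range_eq_map]
    exact Module.Finite.fg_top.map _
  · choose f hf using fun i => exists_pow_mul_norm_le (v i)
    refine ⟨Finset.univ.sup f, mem_stdLat.2 fun i => ?_⟩
    have := hf i _ (Finset.le_sup (Finset.mem_univ i))
    rwa [Pi.smul_apply, nsmul_eq_mul, Nat.cast_pow]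

lemma isOpen_of_stdLat_le {M : Submodule ℤ_[p] (Fin r → ℚ_[p])} (hM : stdLat p r ≤ M) :
    IsOpen (M : Set (Fin r → ℚ_[p])) := by
  refine AddSubgroup.isOpen_of_mem_nhds M.toAddSubgroup (g := 0) ?_
  refine Filter.mem_of_superset (Metric.ball_mem_nhds 0 one_pos) fun v hv => hM ?_
  rw [mem_stdLat]
  intro i
  rw [mem_ball_zero_iff] at hv
  exact (norm_le_pi_norm v i).trans hv.le

lemma isClosed_of_stdLat_le {M : Submodule ℤ_[p] (Fin r → ℚ_[p])} (hM : stdLat p r ≤ M) :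
    IsClosed (M : Set (Fin r → ℚ_[p])) :=
  AddSubgroup.isClosed_of_isOpen M.toAddSubgroup (isOpen_of_stdLat_le hM)

lemma fg_inf_of_no_line {M : Submodule ℤ_[p] (Fin r → ℚ_[p])} (hM : stdLat p r ≤ M)
    (T : Submodule ℚ_[p] (Fin r → ℚ_[p]))
    (hT : ∀ v ∈ T, (∀ c : ℚ_[p], c • v ∈ M) → v = 0) : (M ⊓ rs T).FG := by
  let C : ℕ → Set (Fin r → ℚ_[p]) := fun n =>
    ((stdLat p r : Set (Fin r → ℚ_[p])) ∩ {v | ((p : ℚ_[p])⁻¹) • v ∉ stdLat p r}) ∩ (T : Set _) ∩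
      {v | ((p : ℚ_[p]) ^ n)⁻¹ • v ∈ M}
  have hO : IsCompact (stdLat p r : Set (Fin r → ℚ_[p])) := by
    refine (isCompact_closedBall (0 : Fin r → ℚ_[p]) 1).of_isClosed_subset
      (isClosed_of_stdLat_le le_rfl) fun v hv => ?_
    rw [mem_closedBall_zero_iff, pi_norm_le_iff_of_nonneg zero_le_one]
    exact mem_stdLat.1 hv
  have hC : ∀ n, IsClosed (C n) := by
    intro n
    refine IsClosed.inter (IsClosed.inter (IsClosed.inter (isClosed_of_stdLat_le le_rfl) ?_)
      T.closed_of_finiteDimensional) ?_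
    · exact ((isOpen_of_stdLat_le le_rfl).isClosed_compl).preimage (continuous_const_smul _)
    · exact (isClosed_of_stdLat_le hM).preimage (continuous_const_smul _)
  have hempty : ∃ n, C n = ∅ := by
    by_contra! hne
    obtain ⟨v, hv⟩ := IsCompact.nonempty_iInter_of_sequence_nonempty_isCompact_isClosed C
      (by
        rintro n v ⟨h1, h2⟩
        refine ⟨h1, ?_⟩
        have : ((p : ℚ_[p]) ^ n)⁻¹ • v = p • (((p : ℚ_[p]) ^ (n + 1))⁻¹ • v) := by
          rw [← Nat.cast_smul_eq_nsmul ℚ_[p], smul_smul]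
          congr 1
          have := p_ne (p := p)
          field_simp
          ring
        show _ ∈ M
        rw [this]
        exact M.toAddSubmonoid.nsmul_mem h2 _)
      hne
      (hO.of_isClosed_subset (hC 0) fun v hv => hv.1.1.1) hC
    rw [Set.mem_iInter] at hv
    have hv0 := hT v (hv 0).1.2 (fun c => by
      obtain ⟨n, hn⟩ := exists_pow_mul_norm_le c
      obtain ⟨x, hx⟩ : ∃ x : ℤ_[p], algebraMap ℤ_[p] ℚ_[p] x = (p : ℚ_[p]) ^ n * c :=
        ⟨⟨_, hn n le_rfl⟩, rfl⟩
      have h1 : c • v = x • (((p : ℚ_[p]) ^ n)⁻¹ • v) := by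
        rw [← algebraMap_smul ℚ_[p] x, smul_smul, hx]
        congr 1
        have := p_ne (p := p)
        field_simp
      rw [h1]
      exact M.smul_mem _ (hv n).2)
    apply (hv 0).1.1.2
    rw [hv0, smul_zero]
    exact Submodule.zero_mem _
  obtain ⟨n, hn⟩ := hempty
  have hle : M ⊓ rs T ≤ up n (stdLat p r) := by
    rintro v ⟨hvM, hvT⟩
    by_contra hv
    have hex := isLat_stdLat.2 v
    classical
    obtain ⟨m, hm⟩ : ∃ m, Nat.find hex = n + 1 + m := by
      apply Nat.exists_eq_add_of_le
      by_contra! hlt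
      exact hv (up_le_up_of_le (by omega) _ (Nat.find_spec hex))
    have hspec := Nat.find_spec hex
    have hmin := Nat.find_min hex (m := n + m) (by omega)
    rw [hm] at hspec
    have : p ^ (n + 1 + m) • v ∈ C n := by
      refine ⟨⟨⟨hspec, ?_⟩, pow_nsmul_mem_iff.2 hvT⟩, ?_⟩
      · have : ((p : ℚ_[p])⁻¹) • (p ^ (n + 1 + m) • v) = p ^ (n + m) • v := by
          rw [← Nat.cast_smul_eq_nsmul ℚ_[p], ← Nat.cast_smul_eq_nsmul ℚ_[p], smul_smul]
          congr 1
          have := p_ne (p := p)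
          push_cast
          field_simp
          ring
        rw [Set.mem_ofPred_eq, this]
        exact hmin
      · have : (((p : ℚ_[p]) ^ n)⁻¹) • (p ^ (n + 1 + m) • v) = p ^ (m + 1) • v := by
          rw [← Nat.cast_smul_eq_nsmul ℚ_[p], ← Nat.cast_smul_eq_nsmul ℚ_[p], smul_smul]
          congr 1
          have := p_ne (p := p)
          push_cast
          field_simp
          ring
        rw [Set.mem_ofPred_eq, this]
        exact M.toAddSubmonoid.nsmul_mem hvM _
    rw [hn] at this
    exact this
  have : IsNoetherian ℤ_[p] (up n (stdLat p r)) :=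
    isNoetherian_of_fg_of_noetherian _ (isLat_stdLat.up n).1
  exact (isNoetherian_submodule.1 this) _ hle

end Compactness

section Fixed

variable {p : ℕ} [hp : Fact p.Prime] {V : Type*} [AddCommGroup V] [Module ℤ_[p] V]
  [Module ℚ_[p] V] [IsScalarTower ℤ_[p] ℚ_[p] V]

/-- Successive enlargements along a list of subspaces. -/
def enls (Ws : List (Submodule ℚ_[p] V)) (L : Submodule ℤ_[p] V) : Submodule ℤ_[p] V :=
  Ws.foldl (fun L W => enl W L) L

lemma enls_cons (W : Submodule ℚ_[p] V) (Ws : List (Submodule ℚ_[p] V))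
    (L : Submodule ℤ_[p] V) : enls (W :: Ws) L = enls Ws (enl W L) := rfl

lemma enls_append (Ws Ws' : List (Submodule ℚ_[p] V))
    (L : Submodule ℤ_[p] V) : enls (Ws ++ Ws') L = enls Ws' (enls Ws L) := List.foldl_append

lemma IsLat.enls {L : Submodule ℤ_[p] V} (h : IsLat L) (Ws : List (Submodule ℚ_[p] V)) :
    IsLat (enls Ws L) := by
  induction Ws generalizing L with
  | nil => exact h
  | cons W Ws ih => exact ih (h.enl W)

lemma le_enls (Ws : List (Submodule ℚ_[p] V)) (L : Submodule ℤ_[p] V) : L ≤ enls Ws L := by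
  induction Ws generalizing L with
  | nil => exact le_rfl
  | cons W Ws ih => exact (le_enl W L).trans (ih _)

lemma enls_mono (Ws : List (Submodule ℚ_[p] V)) {L L' : Submodule ℤ_[p] V} (h : L ≤ L') :
    enls Ws L ≤ enls Ws L' := by
  induction Ws generalizing L L' with
  | nil => exact h
  | cons W Ws ih => exact ih (enl_mono W h)

lemma len_enl_enl {L L' : Submodule ℤ_[p] V} (hL : IsLat L) (hL' : IsLat L') (h : L ≤ L')
    (W : Submodule ℚ_[p] V) : len (enl W L) (enl W L') = len L L' := by
  have h1 := len_add h (le_enl W L') (hL.finOver (hL'.enl W))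
  have h2 := len_add (le_enl W L) (enl_mono W h) (hL.finOver (hL'.enl W))
  rw [hL'.len_enl] at h1
  rw [hL.len_enl] at h2
  omega

lemma len_enls_enls {L L' : Submodule ℤ_[p] V} (hL : IsLat L) (hL' : IsLat L') (h : L ≤ L')
    (Ws : List (Submodule ℚ_[p] V)) : len (enls Ws L) (enls Ws L') = len L L' := by
  induction Ws generalizing L L' with
  | nil => rfl
  | cons W Ws ih =>
    rw [enls_cons, enls_cons, ih (hL.enl W) (hL'.enl W) (enl_mono W h), len_enl_enl hL hL' h]

lemma exists_fg_le_sup {A Q B : Submodule ℤ_[p] V} (hA : A.FG)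
    (hQ : Q ≤ A ⊔ B) : ∃ Q₀ ≤ Q, Q₀.FG ∧ Q ≤ Q₀ ⊔ B := by
  classical
  have h1 : Q.map B.mkQ ≤ A.map B.mkQ := by
    refine (Submodule.map_mono hQ).trans ?_
    rw [Submodule.map_sup, Submodule.mkQ_map_self, sup_bot_eq]
  have h2 : (Q.map B.mkQ).FG := by
    have : IsNoetherian ℤ_[p] (A.map B.mkQ) := isNoetherian_of_fg_of_noetherian _ (hA.map _)
    exact (isNoetherian_submodule.1 this) _ h1
  obtain ⟨s, hs⟩ := h2
  have h3 : (s : Set (V ⧸ B)) ⊆ B.mkQ '' (Q : Set V) := by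
    intro x hx
    have : x ∈ Q.map B.mkQ := by rw [← hs]; exact Submodule.subset_span hx
    exact this
  obtain ⟨t, htQ, hts⟩ := Finset.subset_set_image_iff.1 h3
  refine ⟨span ℤ_[p] t, Submodule.span_le.2 htQ, ⟨t, rfl⟩, ?_⟩
  have h4 : Q.map B.mkQ = (span ℤ_[p] (t : Set V)).map B.mkQ := by
    rw [← hs, ← hts, Finset.coe_image, Submodule.map_span]
  have h5 : Q ≤ (Q.map B.mkQ).comap B.mkQ := Submodule.le_comap_map _ _
  rw [h4, Submodule.comap_map_mkQ, sup_comm] at h5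
  exact h5

lemma fg_le_of_directed {P : ℕ → Submodule ℤ_[p] V} (hP : Monotone P)
    {Q : Submodule ℤ_[p] V} (hQ : Q.FG) (h : ∀ v ∈ Q, ∃ n, v ∈ P n) : ∃ n, ∀ m, n ≤ m → Q ≤ P m := by
  obtain ⟨s, rfl⟩ := hQ
  have : ∀ v : V, ∃ n, v ∈ span ℤ_[p] (s : Set V) → v ∈ P n := fun v => by
    by_cases hv : v ∈ span ℤ_[p] (s : Set V)
    · exact (h v hv).imp fun _ h _ => h
    · exact ⟨0, fun h => absurd h hv⟩
  choose f hf using this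
  refine ⟨s.sup f, fun m hm => Submodule.span_le.2 fun v hv => ?_⟩
  exact hP ((Finset.le_sup hv).trans hm) (hf v (Submodule.subset_span hv))

/-- An increasing sequence of lattices absorbing `S` and stable modulo `S`. -/
structure Absorbs (P : ℕ → Submodule ℤ_[p] V) (S : Submodule ℚ_[p] V) : Prop where
  isLat : ∀ n, IsLat (P n)
  mono : Monotone P
  mem : ∀ v ∈ S, ∃ n, v ∈ P n
  stable : ∃ N, ∀ n, N ≤ n → ∀ m, P m ≤ P n ⊔ rs S

lemma Absorbs.enl {P : ℕ → Submodule ℤ_[p] V} {S : Submodule ℚ_[p] V} (h : Absorbs P S)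
    (W : Submodule ℚ_[p] V) : Absorbs (fun n => enl W (P n)) S := by
  refine ⟨fun n => (h.isLat n).enl W, fun a b hab => enl_mono W (h.mono hab),
    fun v hv => (h.mem v hv).imp fun n hn => le_enl W _ hn, ?_⟩
  obtain ⟨N, hN⟩ := h.stable
  let Q : Submodule ℤ_[p] V := up 1 (P N ⊔ rs S) ⊓ rs W
  have hQ : Q ≤ up 1 (P N) ⊔ rs S := by
    refine inf_le_left.trans ?_
    rw [up_sup, up_rs]
  obtain ⟨Q₀, hQ₀, hfg, hle⟩ := exists_fg_le_sup ((h.isLat N).up 1).1 hQ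
  obtain ⟨n₀, hn₀⟩ := fg_le_of_directed (P := fun n => up 1 (P n))
    (fun a b hab => up_mono 1 (h.mono hab)) hfg (fun v hv => by
      obtain ⟨y, hy, s, hs, hys⟩ := Submodule.mem_sup.1 (hQ₀ hv).1
      obtain ⟨m, hm⟩ := h.mem s hs
      refine ⟨max N m, ?_⟩
      show _ ∈ P _
      rw [← hys]
      exact add_mem (h.mono (le_max_left _ _) hy) (h.mono (le_max_right _ _) hm))
  refine ⟨max N n₀, fun n hn m => sup_le ?_ ?_⟩
  · exact (hN n ((le_max_left _ _).trans hn) m).trans (sup_le_sup (le_enl W _) le_rfl)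
  · have h1 : up 1 (P m) ⊓ rs W ≤ Q := inf_le_inf (up_mono 1 (hN N le_rfl m)) le_rfl
    refine h1.trans (hle.trans (sup_le_sup ?_ le_rfl))
    refine le_trans ?_ le_sup_right
    exact le_inf (hn₀ n ((le_max_right _ _).trans hn)) (hQ₀.trans inf_le_right)

lemma Absorbs.enl_inf_le {P : ℕ → Submodule ℤ_[p] V} {S : Submodule ℚ_[p] V} (h : Absorbs P S)
    (W : Submodule ℚ_[p] V) :
    ∃ N, ∀ n, N ≤ n → PadicLattice.enl W (P n) ⊓ rs S
      ≤ (P n ⊓ rs S) ⊔ (up 1 (P n) ⊓ rs (S ⊓ W)) := by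
  obtain ⟨N, hN⟩ := h.stable
  let Q : Submodule ℤ_[p] V := (P N ⊔ rs S) ⊓ rs W
  obtain ⟨Q₀, hQ₀, hfg, hle⟩ := exists_fg_le_sup (Q := Q) (h.isLat N).1 inf_le_left
  obtain ⟨n₀, hn₀⟩ := fg_le_of_directed h.mono hfg (fun v hv => by
      obtain ⟨y, hy, s, hs, hys⟩ := Submodule.mem_sup.1 (hQ₀ hv).1
      obtain ⟨m, hm⟩ := h.mem s hs
      refine ⟨max N m, ?_⟩
      rw [← hys]
      exact add_mem (h.mono (le_max_left _ _) hy) (h.mono (le_max_right _ _) hm))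
  refine ⟨max N n₀, fun n hn => ?_⟩
  rintro x ⟨hx, hxS⟩
  obtain ⟨y, hy, w, ⟨hw, hwW⟩, rfl⟩ := Submodule.mem_sup.1 hx
  have hwQ : w ∈ Q := by
    refine ⟨?_, hwW⟩
    have h1 : y ∈ P N ⊔ rs S := hN N le_rfl n hy
    have h2 : y + w ∈ P N ⊔ rs S := le_sup_right (a := P N) hxS
    simpa using sub_mem h2 h1
  obtain ⟨z, hz, s, hs, rfl⟩ := Submodule.mem_sup.1 (hle hwQ)
  have hzP : z ∈ P n := hn₀ n ((le_max_right _ _).trans hn) hz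
  rw [← add_assoc]
  refine Submodule.add_mem_sup ⟨add_mem hy hzP, ?_⟩ ⟨?_, hs, ?_⟩
  · have := sub_mem hxS hs
    simpa [← add_assoc] using this
  · have h1 := sub_mem hw (le_up 1 _ hzP)
    simpa using h1
  · have h1 := sub_mem hwW (hQ₀ hz).2
    simpa using h1

lemma Absorbs.enls {P : ℕ → Submodule ℤ_[p] V} {S : Submodule ℚ_[p] V} (h : Absorbs P S)
    (Ws : List (Submodule ℚ_[p] V)) :
    Absorbs (fun n => enls Ws (P n)) S ∧
      ∃ N, ∀ n, N ≤ n → len (P n ⊓ rs S) (PadicLattice.enls Ws (P n) ⊓ rs S)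
        ≤ (Ws.map fun W => finrank ℚ_[p] (S ⊓ W : Submodule ℚ_[p] V)).sum := by
  induction Ws generalizing P with
  | nil => exact ⟨h, 0, fun n _ => by simp [PadicLattice.enls, len_self]⟩
  | cons W Ws ih =>
    obtain ⟨h1, N, hN⟩ := ih (h.enl W)
    refine ⟨h1, ?_⟩
    obtain ⟨N', hN'⟩ := h.enl_inf_le W
    refine ⟨max N N', fun n hn => ?_⟩
    have hL := h.isLat n
    rw [List.map_cons, List.sum_cons, enls_cons,
      ← len_add (inf_le_inf (le_enl W _) le_rfl) (inf_le_inf (le_enls Ws _) le_rfl)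
        (hL.finOver_inf ((hL.enl W).enls Ws) _)]
    refine add_le_add ?_ (hN n ((le_max_left _ _).trans hn))
    have h2 := hL.len_inf_rs (S ⊓ W) 1
    rw [one_mul] at h2
    have hle1 : P n ⊓ rs S ⊔ up 1 (P n) ⊓ rs (S ⊓ W) ≤ up 1 (P n) ⊓ rs S :=
      sup_le (inf_le_inf (le_up 1 _) le_rfl) (inf_le_inf le_rfl fun v hv => hv.1)
    refine (len_le_of_le_right (hN' n ((le_max_right _ _).trans hn))
      ((hL.finOver_inf (hL.up 1) _).mono le_rfl hle1)).trans ?_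
    rw [len_sup, ← h2, ← len_inf_right]
    apply le_of_eq
    congr 1
    ext v
    constructor
    · rintro ⟨a, b⟩; exact ⟨a.1, b.2⟩
    · rintro ⟨a, b⟩; exact ⟨⟨a, b.1⟩, le_up 1 _ a, b⟩

end Fixed

section

variable {p : ℕ} [hp : Fact p.Prime] {V : Type*} [AddCommGroup V] [Module ℤ_[p] V]
  [Module ℚ_[p] V] [IsScalarTower ℤ_[p] ℚ_[p] V]

/-- The increasing sequence of lattices generated by `L` under `dn ℓ ∘ enls Ws`. -/
def growth (Ws : List (Submodule ℚ_[p] V)) (ℓ : ℕ) (L : Submodule ℤ_[p] V) :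
    ℕ → Submodule ℤ_[p] V
  | 0 => L
  | n + 1 => growth Ws ℓ L n ⊔ dn ℓ (enls Ws (growth Ws ℓ L n))

lemma growth_succ (Ws : List (Submodule ℚ_[p] V)) (ℓ : ℕ) (L : Submodule ℤ_[p] V) (n : ℕ) :
    growth Ws ℓ L (n + 1) = growth Ws ℓ L n ⊔ dn ℓ (enls Ws (growth Ws ℓ L n)) := rfl

lemma len_growth_succ (Ws : List (Submodule ℚ_[p] V)) (ℓ : ℕ) (L : Submodule ℤ_[p] V) (n : ℕ) :
    len (growth Ws ℓ L n) (growth Ws ℓ L (n + 1))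
      = len (growth Ws ℓ L n) (dn ℓ (enls Ws (growth Ws ℓ L n))) := by
  rw [growth_succ, len_sup]

lemma isLat_growth (Ws : List (Submodule ℚ_[p] V)) (ℓ : ℕ) {L : Submodule ℤ_[p] V}
    (hL : IsLat L) (n : ℕ) : IsLat (growth Ws ℓ L n) := by
  induction n with
  | zero => exact hL
  | succ n ih => exact ih.sup ((ih.enls Ws).dn ℓ)

lemma growth_mono (Ws : List (Submodule ℚ_[p] V)) (ℓ : ℕ) (L : Submodule ℤ_[p] V) :
    Monotone (growth Ws ℓ L) := monotone_nat_of_le_succ fun _ => le_sup_left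

lemma dn_enls_growth_le (Ws : List (Submodule ℚ_[p] V)) (ℓ : ℕ) (L : Submodule ℤ_[p] V) (n : ℕ) :
    dn ℓ (enls Ws (growth Ws ℓ L n)) ≤ growth Ws ℓ L (n + 1) := by
  rw [growth_succ]
  exact le_sup_right

lemma growth_defect_antitone (Ws : List (Submodule ℚ_[p] V)) (ℓ : ℕ) {L : Submodule ℤ_[p] V}
    (hL : IsLat L) : Antitone fun n => len (growth Ws ℓ L n) (growth Ws ℓ L (n + 1)) := by
  have hl := isLat_growth Ws ℓ hL
  have hΨ : ∀ n, IsLat (dn ℓ (enls Ws (growth Ws ℓ L n))) := fun n => ((hl n).enls Ws).dn ℓ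
  have key : ∀ n, len (growth Ws ℓ L (n + 1)) (growth Ws ℓ L (n + 1 + 1))
      ≤ len (growth Ws ℓ L n) (growth Ws ℓ L (n + 1)) := by
    intro n
    have h1 : len (growth Ws ℓ L n) (growth Ws ℓ L (n + 1))
        = len (dn ℓ (enls Ws (growth Ws ℓ L n))) (dn ℓ (enls Ws (growth Ws ℓ L (n + 1)))) := by
      rw [len_dn, len_enls_enls (hl n) (hl (n + 1)) (growth_mono Ws ℓ L n.le_succ) Ws]
    rw [len_growth_succ Ws ℓ L (n + 1), h1]
    exact len_le_of_le_left (dn_enls_growth_le Ws ℓ L n) ((hΨ n).finOver (hΨ (n + 1)))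
  exact antitone_nat_of_succ_le key

lemma exists_growth_stable (Ws : List (Submodule ℚ_[p] V)) (ℓ : ℕ) {L : Submodule ℤ_[p] V}
    (hL : IsLat L) : ∃ N, ∀ n, N ≤ n →
      growth Ws ℓ L (n + 1) ⊓ dn ℓ (enls Ws (growth Ws ℓ L (n + 1)))
        ≤ dn ℓ (enls Ws (growth Ws ℓ L n)) := by
  have hl := isLat_growth Ws ℓ hL
  obtain ⟨N, hN⟩ := WellFoundedLT.antitone_chain_condition
    (growth_defect_antitone Ws ℓ hL)
  refine ⟨N, fun n hn => ?_⟩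
  have hΨ : ∀ n, IsLat (dn ℓ (enls Ws (growth Ws ℓ L n))) := fun n => ((hl n).enls Ws).dn ℓ
  have h0 : len (growth Ws ℓ L n) (growth Ws ℓ L (n + 1))
      = len (growth Ws ℓ L (n + 1)) (growth Ws ℓ L (n + 1 + 1)) :=
    (hN n hn).symm.trans (hN (n + 1) (by omega))
  rw [len_growth_succ Ws ℓ L (n + 1), ← len_enls_enls (hl n) (hl (n + 1)) (growth_mono Ws ℓ L n.le_succ) Ws, ← len_dn ℓ,
    ← len_inf_right (growth Ws ℓ L (n + 1))] at h0
  have hle : dn ℓ (enls Ws (growth Ws ℓ L n))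
      ≤ growth Ws ℓ L (n + 1) ⊓ dn ℓ (enls Ws (growth Ws ℓ L (n + 1))) :=
    le_inf le_sup_right (dn_mono _ (enls_mono _ (growth_mono Ws ℓ L n.le_succ)))
  have h2 := len_add hle inf_le_right ((hΨ n).finOver (hΨ (n + 1)))
  exact le_of_len_eq_zero (((hΨ n).finOver (hΨ (n + 1))).mono le_rfl inf_le_right) (by omega)

end

section

variable {p : ℕ} [hp : Fact p.Prime] {r : ℕ}

theorem exists_isLat_enls_le_up (Ws : List (Submodule ℚ_[p] (Fin r → ℚ_[p]))) (ℓ : ℕ)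
    (hW : ∀ S : Submodule ℚ_[p] (Fin r → ℚ_[p]),
      (Ws.map fun W => finrank ℚ_[p] (S ⊓ W : Submodule ℚ_[p] (Fin r → ℚ_[p]))).sum
        ≤ ℓ * finrank ℚ_[p] S) :
    ∃ L : Submodule ℤ_[p] (Fin r → ℚ_[p]), IsLat L ∧ enls Ws L ≤ up ℓ L := by
  by_contra! hcon
  obtain ⟨N₀, hN₀⟩ := exists_growth_stable Ws ℓ (isLat_stdLat (p := p) (r := r))
  set P₀ := growth Ws ℓ (stdLat p r) with hP₀
  let P : ℕ → Submodule ℤ_[p] (Fin r → ℚ_[p]) := fun n => P₀ (N₀ + n)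
  have hlat : ∀ n, IsLat (P n) := fun n => isLat_growth Ws ℓ isLat_stdLat _
  have hmono : Monotone P := fun a b h => growth_mono Ws ℓ _ (by omega)
  let Ψ : ℕ → Submodule ℤ_[p] (Fin r → ℚ_[p]) := fun n => dn ℓ (enls Ws (P n))
  have hΨP : ∀ n, Ψ n ≤ P (n + 1) := fun n => le_sup_right
  have hstep : ∀ n, P (n + 1) ⊓ Ψ (n + 1) ≤ Ψ n := fun n => hN₀ (N₀ + n) (by omega)
  have hback : ∀ n k, P (n + 1) ⊓ Ψ (n + k) ≤ Ψ n := by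
    intro n k
    induction k with
    | zero => exact inf_le_right
    | succ k ih =>
      refine le_trans (le_inf inf_le_left ?_) ih
      exact le_trans (inf_le_inf (hmono (by omega)) le_rfl) (hstep (n + k))
  let S : Submodule ℚ_[p] (Fin r → ℚ_[p]) :=
    { carrier := {v | ∀ c : ℚ_[p], ∃ n, c • v ∈ P n}
      zero_mem' := fun c => ⟨0, by rw [smul_zero]; exact Submodule.zero_mem _⟩
      add_mem' := by
        intro a b ha hb c
        obtain ⟨n, hn⟩ := ha c
        obtain ⟨m, hm⟩ := hb c
        exact ⟨max n m, by
          rw [smul_add]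
          exact add_mem (hmono (le_max_left _ _) hn) (hmono (le_max_right _ _) hm)⟩
      smul_mem' := fun d v hv c => by
        obtain ⟨n, hn⟩ := hv (c * d)
        exact ⟨n, by rwa [smul_smul]⟩ }
  obtain ⟨T, hST⟩ := Submodule.exists_isCompl S
  have hmem : ∀ v, v ∈ (⨆ n, P n) ↔ ∃ n, v ∈ P n := fun v =>
    Submodule.mem_iSup_of_directed P hmono.directed_le
  have hfg : ((⨆ n, P n) ⊓ rs T).FG := by
    refine fg_inf_of_no_line ?_ T ?_
    · exact le_trans (growth_mono Ws ℓ _ (Nat.zero_le _)) (le_iSup P 0)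
    · intro v hvT hv
      have hvS : v ∈ S := fun c => (hmem _).1 (hv c)
      exact (Submodule.disjoint_def.1 hST.disjoint) v hvS hvT
  have habs : Absorbs P S := by
    refine ⟨hlat, hmono, fun v hv => by simpa using hv 1, ?_⟩
    obtain ⟨N, hN⟩ := fg_le_of_directed hmono hfg (fun v hv => (hmem v).1 hv.1)
    refine ⟨N, fun n hn m v hv => ?_⟩
    obtain ⟨s, hs, t, ht, rfl⟩ := Submodule.mem_sup.1
      (hST.sup_eq_top ▸ Submodule.mem_top : v ∈ S ⊔ T)
    obtain ⟨k, hk⟩ := hs 1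
    rw [one_smul] at hk
    have htP : t ∈ P (max m k) := by
      have h1 := sub_mem (hmono (le_max_left m k) hv) (hmono (le_max_right m k) hk)
      simpa using h1
    rw [add_comm]
    exact Submodule.add_mem_sup (hN n hn ⟨(hmem t).2 ⟨_, htP⟩, ht⟩) hs
  obtain ⟨habs', N₁, hN₁⟩ := habs.enls Ws
  obtain ⟨N₂, hN₂⟩ := habs'.stable
  have hA : ∀ n, P n ⊓ rs S ≤ Ψ n := by
    rintro n v ⟨hv, hvS⟩
    obtain ⟨w, hw⟩ := exists_pow_nsmul_eq p ℓ v
    have hwS : w ∈ S := by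
      have : p ^ ℓ • w ∈ S := by rw [hw]; exact hvS
      exact pow_nsmul_mem_iff.1 this
    obtain ⟨m, hm⟩ := habs.mem w hwS
    apply hback n m
    refine ⟨hmono n.le_succ hv, w, ?_, hw⟩
    exact le_enls Ws _ (hmono (by omega) hm)
  set n := max N₁ N₂ with hn
  have hSn : ∀ n, N₁ ≤ n → Ψ n ⊓ rs S ≤ P n := by
    intro n hn
    have h1 := hN₁ n hn
    have h2 : up ℓ (P n ⊓ rs S) ≤ enls Ws (P n) ⊓ rs S := by
      rw [up_inf_rs]
      refine le_inf ?_ inf_le_right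
      rw [← up_inf_rs]
      have := up_mono ℓ (hA n)
      rwa [up_dn] at this
    have h3 : len (P n ⊓ rs S) (up ℓ (P n ⊓ rs S)) = ℓ * finrank ℚ_[p] S := by
      rw [up_inf_rs, (hlat n).len_inf_rs]
    have h4 : FinOver (P n ⊓ rs S) (enls Ws (P n) ⊓ rs S) :=
      (hlat n).finOver_inf ((hlat n).enls Ws) _
    have h5 := len_add (le_up ℓ _) h2 h4
    have h6 := le_of_len_eq_zero (h4.mono (le_up ℓ _) le_rfl) (by have := hW S; omega)
    show dn ℓ _ ⊓ rs S ≤ _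
    rw [← dn_inf_rs, dn_le_iff]
    exact h6.trans (up_mono _ inf_le_left)
  refine hcon (P (n + 1)) (hlat _) (dn_le_iff.1 ?_)
  intro x hx
  have h1 : dn ℓ (enls Ws (P (n + 1))) ≤ Ψ n ⊔ rs S := by
    have := dn_mono ℓ (hN₂ n (le_max_right _ _) (n + 1))
    refine this.trans ?_
    unfold dn
    rw [Submodule.map_sup]
    exact sup_le_sup le_rfl (dn_le ℓ (rs S))
  obtain ⟨y, hy, s, hs, rfl⟩ := Submodule.mem_sup.1 (h1 hx)
  have hy1 : y ∈ Ψ (n + 1) := dn_mono _ (enls_mono _ (hmono n.le_succ)) hy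
  refine add_mem (hΨP n hy) (hSn (n + 1) (by omega) ⟨?_, hs⟩)
  have := sub_mem hx hy1
  simpa using this

end

section Columns

variable {r : ℕ}

/-- Column lengths of the diagram with row lengths `ν`. -/
def colLen (ν : Fin r → ℕ) (c : ℕ) : ℕ := (Finset.univ.filter fun a => c < ν a).card

/-- The number of boxes in the first `k` columns. -/
def colSum (ν : Fin r → ℕ) (k : ℕ) : ℕ := ∑ a, min (ν a) k

/-- Row lengths from column lengths supported in `[0, B)`. -/
def rowLen (r B : ℕ) (y : ℕ → ℕ) (a : Fin r) : ℕ :=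
  ((Finset.range B).filter fun c => (a : ℕ) < y c).card

@[simp] lemma colSum_zero (ν : Fin r → ℕ) : colSum ν 0 = 0 := by simp [colSum]

lemma colSum_succ (ν : Fin r → ℕ) (k : ℕ) : colSum ν (k + 1) = colSum ν k + colLen ν k := by
  unfold colSum colLen
  rw [Finset.card_filter, ← Finset.sum_add_distrib]
  refine Finset.sum_congr rfl fun a _ => ?_
  split_ifs <;> omega

lemma colSum_eq_sum (ν : Fin r → ℕ) (k : ℕ) : colSum ν k = ∑ c ∈ Finset.range k, colLen ν c := by
  induction k with
  | zero => simp
  | succ k ih => rw [colSum_succ, ih, Finset.sum_range_succ]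

lemma colSum_of_le {ν : Fin r → ℕ} {k : ℕ} (h : ∀ a, ν a ≤ k) : colSum ν k = ∑ a, ν a :=
  Finset.sum_congr rfl fun a _ => min_eq_left (h a)

lemma colLen_le (ν : Fin r → ℕ) (c : ℕ) : colLen ν c ≤ r :=
  (Finset.card_filter_le _ _).trans_eq (by simp)

lemma colLen_antitone (ν : Fin r → ℕ) : Antitone (colLen ν) := fun _ _ h =>
  Finset.card_le_card fun a => by
    simp only [Finset.mem_filter, Finset.mem_univ, true_and]; omega

lemma colLen_eq_zero {ν : Fin r → ℕ} {c : ℕ} (h : ∀ a, ν a ≤ c) : colLen ν c = 0 := by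
  unfold colLen
  rw [Finset.card_eq_zero, Finset.filter_eq_empty_iff]
  intro a _
  have := h a
  omega

/-- A decidable initial segment is determined by its cardinality. -/
lemma lt_card_filter_iff {n : ℕ} {P : ℕ → Prop} [DecidablePred P]
    (hP : ∀ i j, i ≤ j → P j → P i) {i : ℕ} (hi : i < n) :
    i < ((Finset.range n).filter P).card ↔ P i := by
  constructor
  · intro h
    by_contra hPi
    have : (Finset.range n).filter P ⊆ Finset.range i := by
      intro j hj
      rw [Finset.mem_filter] at hj
      rw [Finset.mem_range]
      by_contra hij
      exact hPi (hP i j (by omega) hj.2)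
    have := Finset.card_le_card this
    rw [Finset.card_range] at this
    omega
  · intro h
    have : Finset.range (i + 1) ⊆ (Finset.range n).filter P := by
      intro j hj
      rw [Finset.mem_range] at hj
      rw [Finset.mem_filter, Finset.mem_range]
      exact ⟨by omega, hP j i (by omega) h⟩
    have := Finset.card_le_card this
    rw [Finset.card_range] at this
    omega

lemma lt_colLen_iff {ν : Fin r → ℕ} (hν : Antitone ν) {a : Fin r} {c : ℕ} :
    (a : ℕ) < colLen ν c ↔ c < ν a := by
  classical
  let P : ℕ → Prop := fun i => ∃ h : i < r, c < ν ⟨i, h⟩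
  have h1 : colLen ν c = ((Finset.range r).filter P).card := by
    refine Finset.card_bij (fun a _ => (a : ℕ)) ?_ ?_ ?_
    · intro a ha
      rw [Finset.mem_filter] at ha
      rw [Finset.mem_filter, Finset.mem_range]
      exact ⟨a.2, a.2, ha.2⟩
    · intro a _ b _ h
      exact Fin.ext h
    · intro i hi
      rw [Finset.mem_filter] at hi
      obtain ⟨_, h, h'⟩ := hi
      exact ⟨⟨i, h⟩, by simpa using h', rfl⟩
  rw [h1, lt_card_filter_iff ?_ a.2]
  · exact ⟨fun ⟨_, h⟩ => h, fun h => ⟨a.2, h⟩⟩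
  · rintro i j hij ⟨h, h'⟩
    exact ⟨by omega, h'.trans_le (hν (by exact hij))⟩

lemma lt_rowLen_iff {B : ℕ} {y : ℕ → ℕ} (hy : Antitone y) (hB : ∀ c, B ≤ c → y c = 0)
    {a : Fin r} {c : ℕ} : c < rowLen r B y a ↔ (a : ℕ) < y c := by
  by_cases hc : c < B
  · exact lt_card_filter_iff (P := fun c => (a : ℕ) < y c)
      (fun i j hij h => h.trans_le (hy hij)) hc
  · have h1 : rowLen r B y a ≤ B := by
      exact (Finset.card_filter_le _ _).trans_eq (by simp)
    have h2 := hB c (by omega)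
    omega

lemma rowLen_antitone (r B : ℕ) (y : ℕ → ℕ) : Antitone (rowLen r B y) := fun _ _ h =>
  Finset.card_le_card fun c => by
    simp only [Finset.mem_filter]
    exact fun h' => ⟨h'.1, lt_of_le_of_lt h h'.2⟩

lemma colLen_rowLen {B : ℕ} {y : ℕ → ℕ} (hy : Antitone y) (hB : ∀ c, B ≤ c → y c = 0)
    (hr : ∀ c, y c ≤ r) (c : ℕ) : colLen (rowLen r B y) c = y c := by
  have h1 : (Finset.univ.filter fun a : Fin r => c < rowLen r B y a)
      = Finset.univ.filter fun a : Fin r => (a : ℕ) < y c := by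
    ext a
    simp [lt_rowLen_iff hy hB]
  unfold colLen
  rw [h1, Fin.card_filter_val_lt, min_eq_right (hr c)]

lemma eq_of_colLen_eq {ν ν' : Fin r → ℕ} (hν : Antitone ν) (hν' : Antitone ν')
    (h : ∀ c, colLen ν c = colLen ν' c) : ν = ν' := by
  ext a
  have : ∀ c, c < ν a ↔ c < ν' a := fun c => by
    rw [← lt_colLen_iff hν, ← lt_colLen_iff hν', h]
  have h1 := this (ν a)
  have h2 := this (ν' a)
  omega

lemma le_of_colLen_le {ν ν' : Fin r → ℕ} (hν : Antitone ν) (hν' : Antitone ν')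
    (h : ∀ c, colLen ν c ≤ colLen ν' c) (a : Fin r) : ν a ≤ ν' a := by
  by_contra! hlt
  have h1 := (lt_colLen_iff hν).2 hlt
  have h2 := (lt_colLen_iff hν' (a := a) (c := ν' a)).1 (h1.trans_le (h _))
  omega

lemma le_succ_of_colLen_le {ν ν' : Fin r → ℕ} (hν : Antitone ν) (hν' : Antitone ν')
    (h : ∀ c, colLen ν' (c + 1) ≤ colLen ν c) (a : Fin r) : ν' a ≤ ν a + 1 := by
  by_contra! hlt
  have h1 := (lt_colLen_iff hν').2 hlt
  have h2 := (lt_colLen_iff hν (a := a) (c := ν a)).1 (h1.trans_le (h _))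
  omega

lemma colLen_mono {ν ν' : Fin r → ℕ} (h : ∀ a, ν a ≤ ν' a) (c : ℕ) :
    colLen ν c ≤ colLen ν' c :=
  Finset.card_le_card fun a => by
    simp only [Finset.mem_filter, Finset.mem_univ, true_and]
    exact fun h' => h'.trans_le (h a)

lemma colLen_succ_le {ν ν' : Fin r → ℕ} (h : ∀ a, ν' a ≤ ν a + 1) (c : ℕ) :
    colLen ν' (c + 1) ≤ colLen ν c :=
  Finset.card_le_card fun a => by
    simp only [Finset.mem_filter, Finset.mem_univ, true_and]
    have := h a
    omega

lemma colSum_mono {ν ν' : Fin r → ℕ} (h : ∀ a, ν a ≤ ν' a) (k : ℕ) :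
    colSum ν k ≤ colSum ν' k :=
  Finset.sum_le_sum fun a _ => min_le_min_right _ (h a)

/-- A lattice-word path of vertical strips of sizes `κ 0, …, κ (m - 1)`. -/
structure LRPath (m : ℕ) (κ : ℕ → ℕ) (s : ℕ → Fin r → ℕ) : Prop where
  anti : ∀ i ≤ m, Antitone (s i)
  le : ∀ i < m, ∀ a, s i a ≤ s (i + 1) a
  le_succ : ∀ i < m, ∀ a, s (i + 1) a ≤ s i a + 1
  size : ∀ i < m, ∑ a, s (i + 1) a = ∑ a, s i a + κ i
  word : ∀ i, i + 1 < m → ∀ k, colSum (s (i + 2)) (k + 1) + colSum (s i) k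
    ≤ colSum (s (i + 1)) (k + 1) + colSum (s (i + 1)) k

end Columns

section Position

variable {p : ℕ} [hp : Fact p.Prime] {V : Type*} [AddCommGroup V] [Module ℤ_[p] V]
  [Module ℚ_[p] V] [IsScalarTower ℤ_[p] ℚ_[p] V] {r : ℕ}

/-- The invariant factors of `L` over `M` are given by `ν`. -/
structure HasPos (M L : Submodule ℤ_[p] V) (ν : Fin r → ℕ) : Prop where
  anti : Antitone ν
  len_eq : ∀ k, len M (L ⊓ up k M) = colSum ν k

lemma len_inf_add {M L L' : Submodule ℤ_[p] V} (hM : IsLat M) (hL' : IsLat L') (hML : M ≤ L)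
    (hLL' : L ≤ L') (k : ℕ) : len M (L ⊓ up k M) + len (L ⊓ up k M) (L' ⊓ up k M)
      = len M (L' ⊓ up k M) :=
  len_add (le_inf hML (le_up k M)) (inf_le_inf hLL' le_rfl)
    ((hM.finOver hL').mono le_rfl inf_le_left)

lemma len_up_succ {M L : Submodule ℤ_[p] V} (hM : IsLat M) (hL : IsLat L) (hML : M ≤ L) (k : ℕ) :
    len M (L ⊓ up k M) + len (L ⊓ up k M) (L ⊓ up (k + 1) M) = len M (L ⊓ up (k + 1) M) :=
  len_add (le_inf hML (le_up k M)) (inf_le_inf le_rfl (up_le_up_of_le k.le_succ M))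
    ((hM.finOver hL).mono le_rfl inf_le_left)

lemma HasPos.colLen_eq {M L : Submodule ℤ_[p] V} {ν : Fin r → ℕ} (h : HasPos M L ν)
    (hM : IsLat M) (hL : IsLat L) (hML : M ≤ L) (c : ℕ) :
    len (L ⊓ up c M) (L ⊓ up (c + 1) M) = colLen ν c := by
  have := len_up_succ hM hL hML c
  rw [h.len_eq, h.len_eq, colSum_succ] at this
  omega

lemma HasPos.len_total {M L : Submodule ℤ_[p] V} {ν : Fin r → ℕ} (h : HasPos M L ν)
    (hM : IsLat M) (hL : IsLat L) : len M L = ∑ a, ν a := by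
  obtain ⟨n, hn⟩ := (hM.finOver hL).exists_le_up
  have h1 := h.len_eq (n + ∑ a, ν a)
  rw [colSum_of_le (fun a => (Finset.single_le_sum (fun _ _ => Nat.zero_le _)
    (Finset.mem_univ a)).trans (Nat.le_add_left _ _)),
    inf_eq_left.2 (hn.trans (up_le_up_of_le (Nat.le_add_right _ _) M))] at h1
  exact h1

lemma exists_hasPos [FiniteDimensional ℚ_[p] V] (hr : finrank ℚ_[p] V = r)
    {M L : Submodule ℤ_[p] V} (hM : IsLat M) (hL : IsLat L) (hML : M ≤ L) :
    ∃ ν : Fin r → ℕ, HasPos M L ν := by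
  obtain ⟨B, hB⟩ := (hM.finOver hL).exists_le_up
  let y : ℕ → ℕ := fun c => len (L ⊓ up c M) (L ⊓ up (c + 1) M)
  have hX : ∀ c, IsLat (L ⊓ up c M) := fun c => hL.inf (hM.up c)
  have hle : ∀ c, L ⊓ up (c + 1) M ≤ up 1 (L ⊓ up c M) := fun c => by
    rw [up_inf, up_up, add_comm 1 c]
    exact inf_le_inf (le_up 1 L) le_rfl
  have hy : Antitone y := by
    refine antitone_nat_of_succ_le fun c => ?_
    show len _ _ ≤ len _ _
    rw [← len_up 1 (L ⊓ up c M)]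
    refine len_mono (hle (c + 1)) ?_ (((hX c).up 1).finOver ((hX (c + 1)).up 1))
    rw [up_inf, up_up, add_comm 1 c]
    exact fun v hv => ⟨hv.1.1, hv.2.2⟩
  have hyB : ∀ c, B ≤ c → y c = 0 := fun c hc => by
    apply len_eq_zero_of_le
    exact le_inf inf_le_left (inf_le_left.trans (hB.trans (up_le_up_of_le hc M)))
  have hyr : ∀ c, y c ≤ r := fun c => by
    have h1 := (hX c).len_up 1
    rw [one_mul, hr] at h1
    rw [← h1]
    exact len_le_of_le_right (hle c) ((hX c).finOver ((hX c).up 1))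
  refine ⟨rowLen r B y, rowLen_antitone r B y, fun k => ?_⟩
  induction k with
  | zero =>
    rw [up_zero, inf_eq_right.2 hML, len_self, colSum_zero]
  | succ k ih =>
    rw [← len_up_succ hM hL hML, ih, colSum_succ, colLen_rowLen hy hyB hyr]

/-- A chain of lattices each of whose steps is an elementary extension, with
consecutive steps compatible. -/
structure LatChain (m : ℕ) (L : ℕ → Submodule ℤ_[p] V) : Prop where
  isLat : ∀ i ≤ m, IsLat (L i)
  le : ∀ i < m, L i ≤ L (i + 1)
  le_up : ∀ i < m, L (i + 1) ≤ up 1 (L i)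
  inf_up_le : ∀ i, i + 1 < m → L (i + 2) ⊓ up 1 (L i) ≤ L (i + 1)

lemma LatChain.zero_le {m : ℕ} {L : ℕ → Submodule ℤ_[p] V} (h : LatChain m L) :
    ∀ i ≤ m, L 0 ≤ L i := by
  intro i
  induction i with
  | zero => exact fun _ => le_rfl
  | succ i ih => exact fun hi => (ih (by omega)).trans (h.le i (by omega))

lemma LatChain.lrPath {m : ℕ} {L : ℕ → Submodule ℤ_[p] V} (h : LatChain m L)
    {M : Submodule ℤ_[p] V} (hM : IsLat M) (hML : M ≤ L 0) {s : ℕ → Fin r → ℕ}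
    (hs : ∀ i ≤ m, HasPos M (L i) (s i)) : LRPath m (fun i => len (L i) (L (i + 1))) s := by
  have hMi : ∀ i ≤ m, M ≤ L i := fun i hi => hML.trans (h.zero_le i hi)
  refine ⟨fun i hi => (hs i hi).anti, fun i hi => ?_, fun i hi => ?_, fun i hi => ?_,
    fun i hi k => ?_⟩
  · refine le_of_colLen_le (hs i hi.le).anti (hs (i + 1) hi).anti fun c => ?_
    rw [← (hs i hi.le).colLen_eq hM (h.isLat i hi.le) (hMi i hi.le),
      ← (hs (i + 1) hi).colLen_eq hM (h.isLat (i + 1) hi) (hMi (i + 1) hi)]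
    refine len_mono (inf_le_inf (h.le i hi) le_rfl) ?_ ?_
    · exact fun v hv => ⟨hv.1.1, hv.2.2⟩
    · exact ((h.isLat (i + 1) hi).inf (hM.up _)).finOver ((h.isLat (i + 1) hi).inf (hM.up _))
  · refine le_succ_of_colLen_le (hs i hi.le).anti (hs (i + 1) hi).anti fun c => ?_
    rw [← (hs i hi.le).colLen_eq hM (h.isLat i hi.le) (hMi i hi.le),
      ← (hs (i + 1) hi).colLen_eq hM (h.isLat (i + 1) hi) (hMi (i + 1) hi),
      ← len_up 1 (L i ⊓ up c M), up_inf, up_inf, up_up, up_up, add_comm 1 c, add_comm 1 (c + 1)]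
    refine len_mono (inf_le_inf (h.le_up i hi) le_rfl) ?_ ?_
    · exact fun v hv => ⟨hv.1.1, hv.2.2⟩
    · exact (((h.isLat i hi.le).up 1).inf (hM.up _)).finOver
        (((h.isLat i hi.le).up 1).inf (hM.up _))
  · have h1 := (hs i hi.le).len_total hM (h.isLat i hi.le)
    have h2 := (hs (i + 1) hi).len_total hM (h.isLat (i + 1) hi)
    have h3 := len_add (hMi i hi.le) (h.le i hi) (hM.finOver (h.isLat (i + 1) hi))
    omega
  · have hi0 : i ≤ m := by omega
    have hi1 : i + 1 ≤ m := by omega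
    have hi2 : i + 2 ≤ m := by omega
    have h1 := len_inf_add hM (h.isLat (i + 1) hi1) (hMi i hi0) (h.le i (by omega)) k
    have h2 := len_inf_add hM (h.isLat (i + 2) hi2) (hMi (i + 1) hi1) (h.le (i + 1) hi) (k + 1)
    rw [(hs i hi0).len_eq, (hs (i + 1) hi1).len_eq] at h1
    rw [(hs (i + 2) hi2).len_eq, (hs (i + 1) hi1).len_eq] at h2
    have h3 : len (L (i + 1) ⊓ up (k + 1) M) (L (i + 2) ⊓ up (k + 1) M)
        ≤ len (L i ⊓ up k M) (L (i + 1) ⊓ up k M) := by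
      rw [← len_up 1 (L i ⊓ up k M), up_inf, up_inf, up_up, add_comm 1 k]
      refine len_mono (inf_le_inf (h.le_up (i + 1) hi) le_rfl) ?_ ?_
      · exact fun v hv => ⟨h.inf_up_le i hi ⟨hv.1.1, hv.2.1⟩, hv.1.2⟩
      · exact (((h.isLat i hi0).up 1).inf (hM.up _)).finOver
          (((h.isLat (i + 1) hi1).up 1).inf (hM.up _))
    omega

end Position

section Klein

variable {p : ℕ} [hp : Fact p.Prime] {V : Type*} [AddCommGroup V] [Module ℤ_[p] V]
  [Module ℚ_[p] V] [IsScalarTower ℤ_[p] ℚ_[p] V] {r : ℕ}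

lemma exists_notMem_notMem {A B C : Submodule ℤ_[p] V} (hA : ¬ C ≤ A) (hB : ¬ C ≤ B) :
    ∃ v ∈ C, v ∉ A ∧ v ∉ B := by
  obtain ⟨v, hv, hvA⟩ := SetLike.not_le_iff_exists.1 hA
  obtain ⟨w, hw, hwB⟩ := SetLike.not_le_iff_exists.1 hB
  by_cases hvB : v ∈ B
  · by_cases hwA : w ∈ A
    · refine ⟨v + w, C.add_mem hv hw, fun h => hvA ?_, fun h => hwB ?_⟩
      · exact (A.add_mem_iff_left hwA).1 h
      · exact (B.add_mem_iff_right hvB).1 h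
    · exact ⟨w, hw, hwA, hwB⟩
  · exact ⟨v, hv, hvA, hvB⟩

/-- Adjoining a vector that is `p`-torsion modulo `U` and lies outside `U ⊔ B`. -/
lemma sup_span_inf_le {U B : Submodule ℤ_[p] V} {v : V} (hpv : p • v ∈ U) (hv : v ∉ U ⊔ B) :
    (U ⊔ span ℤ_[p] {v}) ⊓ B ≤ U := by
  rintro x ⟨hx, hxB⟩
  obtain ⟨u, hu, y, hy, rfl⟩ := mem_sup.1 hx
  obtain ⟨c, rfl⟩ := mem_span_singleton.1 hy
  by_cases hc : IsUnit c
  · exfalso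
    apply hv
    obtain ⟨c, rfl⟩ := hc
    have h1 : v = (↑c⁻¹ : ℤ_[p]) • ((c : ℤ_[p]) • v) := by
      rw [smul_smul, Units.inv_mul, one_smul]
    rw [h1]
    refine smul_mem _ _ ?_
    have h2 : (c : ℤ_[p]) • v = -u + (u + (c : ℤ_[p]) • v) := by abel
    rw [h2]
    exact add_mem_sup (U.neg_mem hu) hxB
  · rw [PadicInt.not_isUnit_iff, PadicInt.norm_lt_one_iff_dvd] at hc
    obtain ⟨d, rfl⟩ := hc
    refine U.add_mem hu ?_
    rw [mul_comm, mul_smul, Nat.cast_smul_eq_nsmul]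
    exact U.smul_mem d hpv

/-- Partial solutions of the extension problem. -/
structure KleinExt (M L W : Submodule ℤ_[p] V) (ν' : Fin r → ℕ) (k n : ℕ)
    (U : Submodule ℤ_[p] V) : Prop where
  le : L ≤ U
  le_sup : U ≤ L ⊔ (up 1 L ⊓ up (k + 1) M)
  inf_up_le : U ⊓ up 1 W ≤ L
  len_eq : ∀ j ≤ k, len M (U ⊓ up j M) = colSum ν' j
  len_succ : len M (U ⊓ up (k + 1) M) = n

variable {M L W : Submodule ℤ_[p] V} {ν ν' : Fin r → ℕ}

lemma KleinExt.le_up {k n : ℕ} {U : Submodule ℤ_[p] V} (h : KleinExt M L W ν' k n U) :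
    U ≤ up 1 L := h.le_sup.trans (sup_le (PadicLattice.le_up 1 L) inf_le_left)

lemma KleinExt.step [FiniteDimensional ℚ_[p] V] (hr : finrank ℚ_[p] V = r)
    (hM : IsLat M) (hL : IsLat L) (hML : M ≤ L) (hWL : W ≤ L) (hLW : L ≤ up 1 W)
    (h : HasPos M L ν) (hle' : ∀ a, ν' a ≤ ν a + 1) {k n : ℕ}
    (hcond : colSum ν' (k + 1)
      ≤ colSum ν (k + 1) + len (up 1 W ⊓ up (k + 1) M) (up 1 L ⊓ up (k + 1) M))
    {U : Submodule ℤ_[p] V} (hU : KleinExt M L W ν' k n U) (hn : n < colSum ν' (k + 1)) :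
    ∃ U', KleinExt M L W ν' k (n + 1) U' := by
  have hUlat : IsLat U := hL.of_le (hL.up 1) hU.le hU.le_up
  have hP : IsLat (up 1 L ⊓ up k M) := (hL.up 1).inf (hM.up k)
  have hY : IsLat (up 1 L ⊓ up (k + 1) M) := (hL.up 1).inf (hM.up (k + 1))
  have hMU : M ≤ U := hML.trans hU.le
  have hPY : up 1 L ⊓ up k M ≤ up 1 L ⊓ up (k + 1) M :=
    inf_le_inf le_rfl (up_le_up_of_le k.le_succ M)
  have hQY : up 1 W ⊓ up (k + 1) M ≤ up 1 L ⊓ up (k + 1) M :=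
    inf_le_inf (up_mono 1 hWL) le_rfl
  have key : ∀ B, B ≤ up 1 L ⊓ up (k + 1) M → up 1 L ⊓ up (k + 1) M ≤ U ⊔ B →
      len B (up 1 L ⊓ up (k + 1) M) = len (U ⊓ up (k + 1) M ⊓ B) (U ⊓ up (k + 1) M) := by
    intro B hB hYB
    have h1 : up 1 L ⊓ up (k + 1) M = B ⊔ (U ⊓ up (k + 1) M) := by
      apply le_antisymm
      · intro y hy
        obtain ⟨u, hu, b, hb, rfl⟩ := mem_sup.1 (hYB hy)
        rw [sup_comm]
        refine add_mem_sup ⟨hu, ?_⟩ hb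
        exact ((up (k + 1) M).add_mem_iff_left (hB hb).2).1 hy.2
      · exact sup_le hB (inf_le_inf hU.le_up le_rfl)
    rw [h1, len_sup, ← len_inf_right, inf_comm B]
  have hA1 : ¬ up 1 L ⊓ up (k + 1) M ≤ U ⊔ (up 1 L ⊓ up k M) := by
    intro hle
    have h1 := key _ hPY hle
    have h2 : U ⊓ up (k + 1) M ⊓ (up 1 L ⊓ up k M) = U ⊓ up k M := by
      apply le_antisymm
      · exact fun v hv => ⟨hv.1.1, hv.2.2⟩
      · exact fun v hv => ⟨⟨hv.1, up_le_up_of_le k.le_succ M hv.2⟩, hU.le_up hv.1, hv.2⟩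
    rw [h2] at h1
    have h3 := len_up_succ hM hUlat hMU k
    rw [hU.len_eq k le_rfl, hU.len_succ, ← h1] at h3
    have h4 : colLen ν' k ≤ len (up 1 L ⊓ up k M) (up 1 L ⊓ up (k + 1) M) := by
      cases k with
      | zero =>
        rw [up_zero, inf_eq_right.2 (hML.trans (PadicLattice.le_up 1 L)),
          inf_eq_right.2 (up_mono (0 + 1) hML), zero_add, hM.len_up, one_mul, hr]
        exact colLen_le _ _
      | succ k =>
        rw [show up (k + 1 + 1) M = up 1 (up (k + 1) M) by rw [up_up, add_comm],
          show up (k + 1) M = up 1 (up k M) by rw [up_up, add_comm], ← up_inf, up_up 1 k M,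
          add_comm 1 k, ← up_inf, PadicLattice.len_up, h.colLen_eq hM hL hML]
        exact colLen_succ_le hle' k
    rw [colSum_succ] at hn
    omega
  have hA2 : ¬ up 1 L ⊓ up (k + 1) M ≤ U ⊔ (up 1 W ⊓ up (k + 1) M) := by
    intro hle
    have h1 := key _ hQY hle
    have h2 : U ⊓ up (k + 1) M ⊓ (up 1 W ⊓ up (k + 1) M) = L ⊓ up (k + 1) M := by
      apply le_antisymm
      · exact fun v hv => ⟨hU.inf_up_le ⟨hv.1.1, hv.2.1⟩, hv.2.2⟩
      · exact fun v hv => ⟨⟨hU.le hv.1, hv.2⟩, hLW hv.1, hv.2⟩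
    rw [h2] at h1
    have h3 := len_inf_add hM hUlat hML hU.le (k + 1)
    rw [h.len_eq, hU.len_succ] at h3
    omega
  obtain ⟨v, hvY, hv1, hv2⟩ := exists_notMem_notMem hA1 hA2
  have hpv : p • v ∈ L := by simpa using hvY.1
  have hpvU : p • v ∈ U := hU.le hpv
  have hvU : v ∉ U := fun hv => hv1 (le_sup_left (a := U) hv)
  have hspan : span ℤ_[p] {v} ≤ up 1 L ⊓ up (k + 1) M := by
    rw [span_singleton_le_iff_mem]; exact hvY
  have hPle := sup_span_inf_le hpvU hv1
  refine ⟨U ⊔ span ℤ_[p] {v}, hU.le.trans le_sup_left, ?_, ?_, fun j hj => ?_, ?_⟩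
  · exact sup_le hU.le_sup (hspan.trans le_sup_right)
  · rintro x ⟨hx, hxW⟩
    have hQle := sup_span_inf_le hpvU hv2
    have hxs : x ∈ L ⊔ (up 1 L ⊓ up (k + 1) M) :=
      (sup_le hU.le_sup (hspan.trans le_sup_right) : U ⊔ span ℤ_[p] {v} ≤ _) hx
    obtain ⟨l, hl, y, hy, rfl⟩ := mem_sup.1 hxs
    have hy1 : y ∈ up 1 W := ((up 1 W).add_mem_iff_right (hLW hl)).1 hxW
    have hy2 : y ∈ U ⊔ span ℤ_[p] {v} :=
      ((U ⊔ span ℤ_[p] {v}).add_mem_iff_right (le_sup_left (a := U) (hU.le hl))).1 hx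
    have hy3 := hQle ⟨hy2, hy1, hy.2⟩
    exact L.add_mem hl (hU.inf_up_le ⟨hy3, hy1⟩)
  · rw [← hU.len_eq j hj]
    congr 1
    apply le_antisymm
    · rintro x ⟨hx, hxj⟩
      refine ⟨hPle ⟨hx, ?_, up_le_up_of_le hj M hxj⟩, hxj⟩
      exact (sup_le hU.le_up (hspan.trans inf_le_left) : U ⊔ span ℤ_[p] {v} ≤ _) hx
    · exact inf_le_inf le_sup_left le_rfl
  · have h1 : (U ⊔ span ℤ_[p] {v}) ⊓ up (k + 1) M = U ⊓ up (k + 1) M ⊔ span ℤ_[p] {v} := by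
      rw [sup_comm, sup_inf_assoc_of_le _ (hspan.trans inf_le_right), sup_comm]
    have h2 : IsLat (U ⊔ span ℤ_[p] {v}) :=
      hL.of_le (hL.up 1) (hU.le.trans le_sup_left) (sup_le hU.le_up (hspan.trans inf_le_left))
    rw [← len_inf_add hM h2 hMU le_sup_left (k + 1), hU.len_succ, h1, len_sup_span_singleton]
    · exact fun hv => hvU hv.1
    · exact ⟨hpvU, (up (k + 1) M).smul_of_tower_mem p hvY.2⟩

lemma KleinExt.start (hM : IsLat M) (hL : IsLat L) (hML : M ≤ L) (h : HasPos M L ν)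
    {k : ℕ} {U : Submodule ℤ_[p] V} (hLU : L ≤ U) (hUP : U ≤ L ⊔ (up 1 L ⊓ up k M))
    (hUW : U ⊓ up 1 W ≤ L) (hlen : ∀ j ≤ k, len M (U ⊓ up j M) = colSum ν' j) :
    KleinExt M L W ν' k (colSum ν' k + colLen ν k) U := by
  have hUlat : IsLat U := hL.of_le (hL.up 1) hLU
    (hUP.trans (sup_le (PadicLattice.le_up 1 L) inf_le_left))
  refine ⟨hLU, hUP.trans (sup_le_sup le_rfl
    (inf_le_inf le_rfl (up_le_up_of_le k.le_succ M))), hUW, hlen, ?_⟩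
  have h1 : U ⊓ up (k + 1) M = (U ⊓ up k M) ⊔ (L ⊓ up (k + 1) M) := by
    apply le_antisymm
    · rintro x ⟨hx, hxZ⟩
      obtain ⟨l, hl, y, hy, rfl⟩ := mem_sup.1 (hUP hx)
      rw [sup_comm]
      refine add_mem_sup ⟨hl, ?_⟩ ⟨?_, hy.2⟩
      · exact ((up (k + 1) M).add_mem_iff_left (up_le_up_of_le k.le_succ M hy.2)).1 hxZ
      · exact (U.add_mem_iff_right (hLU hl)).1 hx
    · exact sup_le (inf_le_inf le_rfl (up_le_up_of_le k.le_succ M)) (inf_le_inf hLU le_rfl)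
  have h2 : U ⊓ up k M ⊓ (L ⊓ up (k + 1) M) = L ⊓ up k M := by
    apply le_antisymm
    · exact fun v hv => ⟨hv.2.1, hv.1.2⟩
    · exact fun v hv => ⟨⟨hLU hv.1, hv.2⟩, hv.1, up_le_up_of_le k.le_succ M hv.2⟩
  rw [← len_up_succ hM hUlat (hML.trans hLU) k, hlen k le_rfl, h1, len_sup, ← len_inf_right, h2,
    h.colLen_eq hM hL hML]

lemma exists_klein_ext [FiniteDimensional ℚ_[p] V] (hr : finrank ℚ_[p] V = r)
    (hM : IsLat M) (hL : IsLat L) (hML : M ≤ L) (hWL : W ≤ L) (hLW : L ≤ up 1 W)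
    (h : HasPos M L ν) (hν' : Antitone ν') (hle : ∀ a, ν a ≤ ν' a) (hle' : ∀ a, ν' a ≤ ν a + 1)
    (hcond : ∀ k, colSum ν' (k + 1)
      ≤ colSum ν (k + 1) + len (up 1 W ⊓ up (k + 1) M) (up 1 L ⊓ up (k + 1) M)) :
    ∃ L', IsLat L' ∧ L ≤ L' ∧ L' ≤ up 1 L ∧ L' ⊓ up 1 W ≤ L ∧ HasPos M L' ν' := by
  have main : ∀ k, ∃ U : Submodule ℤ_[p] V, L ≤ U ∧ U ≤ L ⊔ (up 1 L ⊓ up k M) ∧ U ⊓ up 1 W ≤ L ∧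
      ∀ j ≤ k, len M (U ⊓ up j M) = colSum ν' j := by
    intro k
    induction k with
    | zero =>
      refine ⟨L, le_rfl, le_sup_left, inf_le_left, fun j hj => ?_⟩
      obtain rfl := Nat.le_zero.1 hj
      rw [up_zero, inf_eq_right.2 hML, len_self, colSum_zero]
    | succ k ih =>
      obtain ⟨U, hLU, hUP, hUW, hlen⟩ := ih
      have h0 := KleinExt.start hM hL hML h hLU hUP hUW hlen
      have h1 : ∀ n, colSum ν' k + colLen ν k ≤ n → n ≤ colSum ν' (k + 1) →
          ∃ U', KleinExt M L W ν' k n U' := by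
        intro n hn
        induction n, hn using Nat.le_induction with
        | base => exact fun _ => ⟨U, h0⟩
        | succ n _ ih =>
          intro hn'
          obtain ⟨U', hU'⟩ := ih (by omega)
          exact hU'.step hr hM hL hML hWL hLW h hle' (hcond k) hn'
      obtain ⟨U', hU'⟩ := h1 (colSum ν' (k + 1))
        (by rw [colSum_succ]; exact Nat.add_le_add_left (colLen_mono hle k) _) le_rfl
      refine ⟨U', hU'.le, hU'.le_sup, hU'.inf_up_le, fun j hj => ?_⟩
      rcases Nat.lt_or_ge j (k + 1) with hj' | hj'
      · exact hU'.len_eq j (by omega)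
      · obtain rfl : j = k + 1 := by omega
        exact hU'.len_succ
  obtain ⟨B, hB⟩ := (hM.finOver (hL.up 1)).exists_le_up
  obtain ⟨U, hLU, hUP, hUW, hlen⟩ := main (B + ∑ a, ν' a)
  have hU1 : U ≤ up 1 L := hUP.trans (sup_le (le_up 1 L) inf_le_left)
  refine ⟨U, hL.of_le (hL.up 1) hLU hU1, hLU, hU1, hUW, hν', fun j => ?_⟩
  rcases Nat.le_total j (B + ∑ a, ν' a) with hj | hj
  · exact hlen j hj
  · have h1 : ∀ a, ν' a ≤ B + ∑ a, ν' a := fun a =>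
      (Finset.single_le_sum (fun _ _ => Nat.zero_le _) (Finset.mem_univ a)).trans
        (Nat.le_add_left _ _)
    have h2 := hlen _ le_rfl
    rw [inf_eq_left.2 ((hU1.trans hB).trans (up_le_up_of_le (Nat.le_add_right _ _) M)),
      colSum_of_le h1] at h2
    rw [inf_eq_left.2 ((hU1.trans hB).trans (up_le_up_of_le ((Nat.le_add_right _ _).trans hj) M)),
      colSum_of_le (fun a => (h1 a).trans hj), h2]

lemma LRPath.exists_latChain [FiniteDimensional ℚ_[p] V] (hr : finrank ℚ_[p] V = r) {m : ℕ}
    {κ : ℕ → ℕ} {s : ℕ → Fin r → ℕ} (hs : LRPath m κ s) (hM : IsLat M) (hL : IsLat L)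
    (hML : M ≤ L) (h0 : HasPos M L (s 0)) :
    ∃ C : ℕ → Submodule ℤ_[p] V, C 0 = L ∧ LatChain m C ∧ ∀ i ≤ m, HasPos M (C i) (s i) := by
  induction m with
  | zero =>
    refine ⟨fun _ => L, rfl, ⟨fun _ _ => hL, ?_, ?_, ?_⟩, fun i hi => ?_⟩
    · intro i hi; omega
    · intro i hi; omega
    · intro i hi; omega
    · obtain rfl := Nat.le_zero.1 hi
      exact h0
  | succ m ih =>
    obtain ⟨C, hC0, hC, hpos⟩ := ih ⟨fun i hi => hs.anti i (by omega), fun i hi => hs.le i (by omega),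
      fun i hi => hs.le_succ i (by omega), fun i hi => hs.size i (by omega),
      fun i hi => hs.word i (by omega)⟩
    have hMC : ∀ i ≤ m, M ≤ C i := fun i hi => (hC0 ▸ hML : M ≤ C 0).trans (hC.zero_le i hi)
    have hCm := hC.isLat m le_rfl
    have hposm := hpos m le_rfl
    have hle := hs.le m (by omega)
    have hle' := hs.le_succ m (by omega)
    have hanti := hs.anti (m + 1) le_rfl
    obtain ⟨L', hL', h1, h2, h3, h4⟩ : ∃ L', IsLat L' ∧ C m ≤ L' ∧ L' ≤ up 1 (C m) ∧
        (∀ j, j + 1 = m → L' ⊓ up 1 (C j) ≤ C m) ∧ HasPos M L' (s (m + 1)) := by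
      cases m with
      | zero =>
        obtain ⟨L', hL', h1, h2, -, h4⟩ := exists_klein_ext (W := dn 1 (C 0)) hr hM hCm
          (hMC 0 le_rfl) (dn_le 1 _) (up_dn 1 (C 0)).ge hposm hanti hle hle' (fun k => by
            have e1 := len_inf_add hM (hCm.up 1) (hMC 0 le_rfl) (le_up 1 _) (k + 1)
            have hlat := hCm.inf (hM.up k)
            have e2 := len_add (le_inf (hMC 0 le_rfl) (le_up k M)) (le_up 1 (C 0 ⊓ up k M))
              (hM.finOver (hlat.up 1))
            have e3 : colSum (s (0 + 1)) (k + 1) ≤ colSum (s 0) k + r := by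
              have : colSum (s 0) k + r = ∑ a, (min (s 0 a) k + 1) := by
                simp [colSum, Finset.sum_add_distrib]
              rw [this]
              refine Finset.sum_le_sum fun a _ => ?_
              have := hle' a
              omega
            rw [hlat.len_up, hr, one_mul, hposm.len_eq, up_inf, up_up, add_comm 1 k] at e2
            rw [hposm.len_eq] at e1
            rw [up_dn]
            omega)
        exact ⟨L', hL', h1, h2, fun j hj => by omega, h4⟩
      | succ m =>
        obtain ⟨L', hL', h1, h2, h3, h4⟩ := exists_klein_ext (W := C m) hr hM hCm
          (hMC _ le_rfl) (hC.le m (by omega)) (hC.le_up m (by omega)) hposm hanti hle hle'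
          (fun k => by
            have hCm' := hC.isLat m (by omega)
            have e1 := len_inf_add hM hCm (hMC m (by omega)) (hC.le m (by omega)) k
            rw [(hpos m (by omega)).len_eq, hposm.len_eq] at e1
            rw [show up (k + 1) M = up 1 (up k M) by rw [up_up, add_comm], ← up_inf, ← up_inf,
              PadicLattice.len_up]
            have : colSum (s (m + 1 + 1)) (k + 1) + colSum (s m) k
                ≤ colSum (s (m + 1)) (k + 1) + colSum (s (m + 1)) k := hs.word m (by omega) k
            omega)
        refine ⟨L', hL', h1, h2, fun j hj => ?_, h4⟩
        obtain rfl : j = m := by omega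
        exact h3
    refine ⟨fun i => if i = m + 1 then L' else C i, by simp [hC0], ⟨?_, ?_, ?_, ?_⟩, ?_⟩
    · intro i hi
      split_ifs with h
      · exact hL'
      · exact hC.isLat i (by omega)
    · intro i hi
      rcases Nat.lt_or_ge i m with h | h
      · simpa [show i ≠ m + 1 by omega, show i ≠ m by omega] using hC.le i h
      · obtain rfl : i = m := by omega
        simpa using h1
    · intro i hi
      rcases Nat.lt_or_ge i m with h | h
      · simpa [show i ≠ m + 1 by omega, show i ≠ m by omega] using hC.le_up i h
      · obtain rfl : i = m := by omega
        simpa using h2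
    · intro i hi
      rcases Nat.lt_or_ge (i + 1) m with h | h
      · simpa [show i ≠ m + 1 by omega, show i ≠ m by omega, show i + 1 ≠ m by omega]
          using hC.inf_up_le i h
      · obtain rfl : i + 1 = m := by omega
        simpa [show i ≠ i + 1 + 1 by omega] using h3 i rfl
    · intro i hi
      dsimp only
      split_ifs with h
      · rw [h]; exact h4
      · exact hpos i (by omega)

lemma LatChain.len_eq {m : ℕ} {κ : ℕ → ℕ} {s : ℕ → Fin r → ℕ} {C : ℕ → Submodule ℤ_[p] V}
    (hC : LatChain m C) (hs : LRPath m κ s) (hM : IsLat M) (hML : M ≤ C 0)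
    (hpos : ∀ i ≤ m, HasPos M (C i) (s i)) {i : ℕ} (hi : i < m) :
    len (C i) (C (i + 1)) = κ i := by
  have h1 := (hC.lrPath hM hML hpos).size i hi
  have h2 := hs.size i hi
  omega

end Klein

section Smith

variable {p : ℕ} [hp : Fact p.Prime] {V : Type*} [AddCommGroup V] [Module ℤ_[p] V]
  [Module ℚ_[p] V] [IsScalarTower ℤ_[p] ℚ_[p] V]

lemma norm_algebraMap_le (c : ℤ_[p]) : ‖algebraMap ℤ_[p] ℚ_[p] c‖ ≤ 1 := PadicInt.norm_le_one c

lemma IsLat.exists_basis {A : Submodule ℤ_[p] V} (hA : IsLat A) {ι : Type*} [Fintype ι]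
    (b : Basis ι ℤ_[p] A) : ∃ B : Basis ι ℚ_[p] V, (∀ i, B i = b i) ∧
      ∀ v, v ∈ A ↔ ∀ i, ‖B.repr v i‖ ≤ 1 := by
  let b' : ι → V := fun i => (b i : V)
  have hli : LinearIndependent ℚ_[p] b' := by
    rw [← LinearIndependent.iff_fractionRing ℤ_[p] ℚ_[p]]
    exact b.linearIndependent.map' A.subtype (Submodule.ker_subtype A)
  have hsum : ∀ v : A, (v : V) = ∑ i, algebraMap ℤ_[p] ℚ_[p] (b.repr v i) • b' i := by
    intro v
    have h1 := congrArg (A.subtype) (b.sum_repr v)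
    rw [map_sum] at h1
    simp only [Submodule.subtype_apply, Submodule.coe_smul] at h1
    rw [← h1]
    exact Finset.sum_congr rfl fun i _ => (algebraMap_smul ℚ_[p] _ _).symm
  have hspan : ⊤ ≤ span ℚ_[p] (Set.range b') := by
    intro v _
    obtain ⟨n, hn⟩ := hA.2 v
    refine (pow_nsmul_mem_iff (p := p) (k := n)).1 ?_
    have h1 : p ^ n • v = ∑ i, algebraMap ℤ_[p] ℚ_[p] (b.repr ⟨_, hn⟩ i) • b' i := hsum ⟨_, hn⟩
    rw [h1]
    exact Submodule.sum_mem _ fun i _ => Submodule.smul_mem _ _ (Submodule.subset_span ⟨i, rfl⟩)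
  let B := Basis.mk hli hspan
  have hB : ∀ i, B i = b i := fun i => Basis.mk_apply hli hspan i
  refine ⟨B, hB, fun v => ⟨fun hv i => ?_, fun hv => ?_⟩⟩
  · have h1 : v = ∑ i, algebraMap ℤ_[p] ℚ_[p] (b.repr ⟨v, hv⟩ i) • B i := by
      refine (hsum ⟨v, hv⟩).trans ?_
      exact Finset.sum_congr rfl fun i _ => by rw [hB]
    rw [h1, B.repr_sum_self]
    exact norm_algebraMap_le _
  · rw [← B.sum_repr v]
    refine Submodule.sum_mem _ fun i _ => ?_
    obtain ⟨c, hc⟩ : ∃ c : ℤ_[p], algebraMap ℤ_[p] ℚ_[p] c = B.repr v i := ⟨⟨_, hv i⟩, rfl⟩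
    rw [← hc, algebraMap_smul, hB]
    exact A.smul_mem _ (b i).2

lemma exists_smith_basis {M L : Submodule ℤ_[p] V} (hM : IsLat M) (hL : IsLat L) (hML : M ≤ L) :
    ∃ (d : ℕ) (B : Basis (Fin d) ℚ_[p] V) (n : Fin d → ℕ),
      (∀ v, v ∈ L ↔ ∀ i, ‖B.repr v i‖ ≤ 1) ∧
      (∀ v, v ∈ M ↔ ∀ i, ‖B.repr v i‖ ≤ ‖(p : ℚ_[p])‖ ^ n i) := by
  have : Module.IsTorsionFree ℤ_[p] V := Module.IsTorsionFree.trans_faithfulSMul ℤ_[p] ℚ_[p] V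
  have : Module.Finite ℤ_[p] L := Module.Finite.iff_fg.2 hL.1
  have : Module.Finite ℤ_[p] M := Module.Finite.iff_fg.2 hM.1
  have hrk : ∀ A : Submodule ℤ_[p] V, IsLat A → finrank ℤ_[p] A = finrank ℚ_[p] V := by
    intro A hA
    have : Module.Finite ℤ_[p] A := Module.Finite.iff_fg.2 hA.1
    obtain ⟨B, -, -⟩ := hA.exists_basis (Module.finBasis ℤ_[p] A)
    rw [finrank_eq_card_basis B, Fintype.card_fin]
  let e := Submodule.comapSubtypeEquivOfLe hML
  obtain ⟨b, a, c, hc⟩ := Submodule.exists_smith_normal_form_of_rank_eq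
    (Module.finBasis ℤ_[p] L) (N := M.comap L.subtype) (by
      rw [e.finrank_eq, hrk M hM, hrk L hL])
  obtain ⟨B, hB, hBL⟩ := hL.exists_basis b
  obtain ⟨C, hC, hCM⟩ := hM.exists_basis (c.map e)
  have hCB : ∀ i, C i = algebraMap ℤ_[p] ℚ_[p] (a i) • B i := by
    intro i
    rw [hC, hB, algebraMap_smul, ← Submodule.coe_smul, ← hc]
    rfl
  have ha : ∀ i, a i ≠ 0 := by
    intro i h
    apply C.ne_zero i
    rw [hCB, h, map_zero, zero_smul]
  have hrepr : ∀ v i, B.repr v i = algebraMap ℤ_[p] ℚ_[p] (a i) * C.repr v i := by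
    intro v i
    have h1 : v = ∑ i, (C.repr v i * algebraMap ℤ_[p] ℚ_[p] (a i)) • B i := by
      conv_lhs => rw [← C.sum_repr v]
      exact Finset.sum_congr rfl fun i _ => by rw [hCB, smul_smul]
    conv_lhs => rw [h1, B.repr_sum_self]
    rw [mul_comm]
  refine ⟨_, B, fun i => (a i).valuation, hBL, fun v => ?_⟩
  rw [hCM]
  refine forall_congr' fun i => ?_
  have h1 : ‖(p : ℚ_[p])‖ ^ (a i).valuation = ‖algebraMap ℤ_[p] ℚ_[p] (a i)‖ := by
    refine Eq.trans ?_ (PadicInt.norm_eq_zpow_neg_valuation (ha i)).symm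
    rw [Padic.norm_p, inv_pow, zpow_neg, zpow_natCast]
  have h2 : 0 < ‖algebraMap ℤ_[p] ℚ_[p] (a i)‖ := norm_pos_iff.2 fun h =>
      ha i (Subtype.coe_injective h)
  rw [hrepr, norm_mul, h1]
  exact (mul_le_iff_le_one_right h2).symm

lemma LatChain.eq_inf_up {m : ℕ} {C : ℕ → Submodule ℤ_[p] V} (h : LatChain m C) {i : ℕ}
    (hi : i ≤ m) : C i = C m ⊓ up i (C 0) := by
  have step : ∀ i, i < m → C (i + 1) ⊓ up i (C 0) = C i := by
    intro i
    induction i with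
    | zero =>
      intro hi
      rw [up_zero, inf_eq_right.2 (h.le 0 hi)]
    | succ i ih =>
      intro hi
      have h1 := ih (by omega)
      have h2 : C (i + 1) ≤ up 1 (C i) := h.le_up i (by omega)
      have h3 : up 1 (C i) ⊓ C (i + 2) = C (i + 1) :=
        le_antisymm (fun v hv => h.inf_up_le i hi ⟨hv.2, hv.1⟩)
          (le_inf h2 (h.le (i + 1) hi))
      have h4 : C (i + 1) ≤ up (i + 1) (C 0) := by
        rw [add_comm i 1, ← up_up, add_comm 1 i]
        exact h2.trans (up_mono 1 (h1 ▸ inf_le_right))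
      refine le_antisymm ?_ (le_inf (h.le (i + 1) hi) h4)
      intro v hv
      rw [← h3]
      refine ⟨?_, hv.1⟩
      rw [← h1, up_inf, up_up, add_comm 1 i]
      exact ⟨h.le_up (i + 1) hi hv.1, hv.2⟩
  obtain ⟨c, rfl⟩ := Nat.exists_eq_add_of_le hi
  have : ∀ c', i + c' ≤ i + c → C i = C (i + c') ⊓ up i (C 0) := by
    intro c'
    induction c' with
    | zero =>
      intro _
      refine (inf_eq_left.2 ?_).symm
      cases i with
      | zero => rw [up_zero]
      | succ i =>
        rw [add_comm i 1, ← up_up, add_comm 1 i]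
        refine (h.le_up i (by omega)).trans (up_mono 1 ?_)
        rw [← step i (by omega)]
        exact inf_le_right
    | succ c' ih =>
      intro hc
      rw [ih (by omega)]
      apply le_antisymm
      · exact inf_le_inf (h.le (i + c') (by omega)) le_rfl
      · intro v hv
        rw [← step (i + c') (by omega)]
        exact ⟨⟨hv.1, up_le_up_of_le (Nat.le_add_right _ _) _ hv.2⟩, hv.2⟩
  exact this c le_rfl

lemma LatChain.exists_filtration {m : ℕ} {C : ℕ → Submodule ℤ_[p] V} (h : LatChain m C) :
    ∃ F : ℕ → Submodule ℚ_[p] V, Antitone F ∧ ∀ i < m, C (i + 1) = enl (F i) (C i) := by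
  have hC0 := h.isLat 0 (Nat.zero_le m)
  have hCm := h.isLat m le_rfl
  obtain ⟨d, B, n, hL, hM⟩ := exists_smith_basis hC0 hCm (h.zero_le m le_rfl)
  have hp0 : 0 < ‖(p : ℚ_[p])‖ := norm_pos_iff.2 p_ne
  have hp1 : ‖(p : ℚ_[p])‖ ≤ 1 := Padic.norm_p_lt_one.le
  have hup : ∀ k v, v ∈ up k (C 0) ↔ ∀ i, ‖(p : ℚ_[p])‖ ^ k * ‖B.repr v i‖
      ≤ ‖(p : ℚ_[p])‖ ^ n i := by
    intro k v
    rw [mem_up, hM]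
    refine forall_congr' fun i => ?_
    rw [← Nat.cast_smul_eq_nsmul ℚ_[p], map_smul, Finsupp.smul_apply, smul_eq_mul, norm_mul,
      Nat.cast_pow, norm_pow]
  let F : ℕ → Submodule ℚ_[p] V := fun i =>
    { carrier := {v | ∀ j, n j ≤ i → B.repr v j = 0}
      add_mem' := fun {v w} hv hw j hj => by simp [hv j hj, hw j hj]
      zero_mem' := fun j _ => by simp
      smul_mem' := fun c v hv j hj => by simp [hv j hj] }
  have hF : ∀ i v, v ∈ F i ↔ ∀ j, n j ≤ i → B.repr v j = 0 := fun _ _ => Iff.rfl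
  refine ⟨F, fun i j hij v hv k hk => hv k (hk.trans hij), fun i hi => ?_⟩
  rw [LatChain.eq_inf_up h hi, LatChain.eq_inf_up h hi.le]
  apply le_antisymm
  · intro v hv
    let w : V := B.equivFun.symm fun j => if n j ≤ i then B.repr v j else 0
    have hw : ∀ j, B.repr w j = if n j ≤ i then B.repr v j else 0 := fun j => by
      rw [← B.equivFun_apply, LinearEquiv.apply_symm_apply]
    have hwC : w ∈ C m ⊓ up i (C 0) := by
      refine ⟨(hL w).2 fun j => ?_, (hup i w).2 fun j => ?_⟩
      · rw [hw]
        split_ifs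
        · exact (hL v).1 hv.1 j
        · simp
      · rw [hw]
        split_ifs with hj
        · calc _ ≤ ‖(p : ℚ_[p])‖ ^ i * 1 :=
                mul_le_mul_of_nonneg_left ((hL v).1 hv.1 j) (by positivity)
            _ ≤ _ := by
                rw [mul_one]
                exact pow_le_pow_of_le_one hp0.le hp1 hj
        · simp only [norm_zero, mul_zero]; positivity
    have hvw : v = w + (v - w) := by abel
    rw [hvw]
    refine add_mem_sup hwC ⟨?_, (hF i _).2 fun j hj => ?_⟩
    · rw [up_inf, up_up, add_comm 1 i]
      refine sub_mem ⟨PadicLattice.le_up 1 _ hv.1, hv.2⟩ ⟨PadicLattice.le_up 1 _ hwC.1, ?_⟩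
      exact up_le_up_of_le i.le_succ _ hwC.2
    · rw [map_sub, Finsupp.sub_apply, hw, if_pos hj, sub_self]
  · refine sup_le (inf_le_inf le_rfl (up_le_up_of_le i.le_succ _)) ?_
    rintro v ⟨hv, hvF⟩
    rw [up_inf, up_up, add_comm 1 i] at hv
    refine ⟨(hL v).2 fun j => ?_, hv.2⟩
    by_cases hj : n j ≤ i
    · rw [(hF i v).1 hvF j hj]; simp
    · have h1 := (hup (i + 1) v).1 hv.2 j
      have h2 : ‖(p : ℚ_[p])‖ ^ n j ≤ ‖(p : ℚ_[p])‖ ^ (i + 1) :=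
        pow_le_pow_of_le_one hp0.le hp1 (by omega)
      have h3 : 0 < ‖(p : ℚ_[p])‖ ^ (i + 1) := by positivity
      by_contra! h4
      nlinarith [mul_lt_mul_of_pos_left h4 h3]

end Smith

/-- Concatenations of lattice-word paths of length `B` with the prescribed contents. -/
def Reach {r : ℕ} (B : ℕ) : List (ℕ → ℕ) → (Fin r → ℕ) → (Fin r → ℕ) → Prop
  | [], s, s' => s = s'
  | κ :: κs, s, s' => ∃ f : ℕ → Fin r → ℕ, LRPath B κ f ∧ f 0 = s ∧ Reach B κs (f B) s'

lemma Reach.antitone {r B : ℕ} {κs : List (ℕ → ℕ)} {s s' : Fin r → ℕ} (h : Reach B κs s s')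
    (hs : Antitone s) : Antitone s' := by
  induction κs generalizing s with
  | nil => exact h ▸ hs
  | cons κ κs ih =>
    obtain ⟨f, hf, -, h'⟩ := h
    exact ih h' (hf.anti B le_rfl)

section Semistable

variable {p : ℕ} [hp : Fact p.Prime] {V : Type*} [AddCommGroup V] [Module ℤ_[p] V]
  [Module ℚ_[p] V] [IsScalarTower ℤ_[p] ℚ_[p] V] {r : ℕ}

lemma hasPos_zero (M : Submodule ℤ_[p] V) : HasPos M M (0 : Fin r → ℕ) := by
  refine ⟨fun _ _ _ => le_rfl, fun k => ?_⟩
  rw [inf_eq_left.2 (le_up k M), len_self]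
  simp [colSum]

lemma HasPos.le_up {M L : Submodule ℤ_[p] V} {ν : Fin r → ℕ} (h : HasPos M L ν) (hM : IsLat M)
    (hL : IsLat L) (hML : M ≤ L) {ℓ : ℕ} (hν : ∀ a, ν a ≤ ℓ) : L ≤ up ℓ M := by
  have h1 := h.len_eq ℓ
  rw [colSum_of_le hν, ← h.len_total hM hL,
    ← len_add (le_inf hML (PadicLattice.le_up ℓ M)) inf_le_left (hM.finOver hL)] at h1
  have h2 := le_of_len_eq_zero ((hL.inf (hM.up ℓ)).finOver hL)
    (by omega : len (L ⊓ up ℓ M) L = 0)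
  exact h2.trans inf_le_right

lemma HasPos.le_of_le_up {M L : Submodule ℤ_[p] V} {ν : Fin r → ℕ} (h : HasPos M L ν)
    (hM : IsLat M) (hL : IsLat L) (hML : M ≤ L) {ℓ : ℕ} (hle : L ≤ up ℓ M) (a : Fin r) :
    ν a ≤ ℓ := by
  have h1 := h.colLen_eq hM hL hML ℓ
  rw [len_eq_zero_of_le (le_inf inf_le_left (inf_le_left.trans hle))] at h1
  by_contra! h2
  have := (lt_colLen_iff h.anti).2 h2
  omega

/-- Antitone filtrations with the prescribed dimensions. -/
def IsFiltr (B : ℕ) (κ : ℕ → ℕ) (F : ℕ → Submodule ℚ_[p] V) : Prop :=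
  Antitone F ∧ ∀ i < B, finrank ℚ_[p] (F i) = κ i

/-- The total slope of the filtration induced on `S`. -/
def totDim (B : ℕ) (F : ℕ → Submodule ℚ_[p] V) (S : Submodule ℚ_[p] V) : ℕ :=
  ∑ i ∈ Finset.range B, finrank ℚ_[p] (S ⊓ F i : Submodule ℚ_[p] V)

/-- There are filtrations with the prescribed dimensions all of whose induced slopes are at
most `ℓ`. -/
def Semi (p : ℕ) [Fact p.Prime] (V : Type*) [AddCommGroup V] [Module ℚ_[p] V] (B ℓ : ℕ)
    (κs : List (ℕ → ℕ)) : Prop :=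
  ∃ Fs : List (ℕ → Submodule ℚ_[p] V), List.Forall₂ (IsFiltr B) κs Fs ∧
    ∀ S : Submodule ℚ_[p] V, (Fs.map fun F => totDim B F S).sum ≤ ℓ * finrank ℚ_[p] S

lemma LatChain.totDim_le [FiniteDimensional ℚ_[p] V] {m : ℕ} {C : ℕ → Submodule ℤ_[p] V}
    (h : LatChain m C) {F : ℕ → Submodule ℚ_[p] V} (hF : ∀ i < m, C (i + 1) = enl (F i) (C i))
    (S : Submodule ℚ_[p] V) : totDim m F S ≤ len (C 0 ⊓ rs S) (C m ⊓ rs S) := by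
  have : ∀ k ≤ m, totDim k F S ≤ len (C 0 ⊓ rs S) (C k ⊓ rs S) := by
    intro k
    induction k with
    | zero => exact fun _ => by simp [totDim]
    | succ k ih =>
      intro hk
      have h0 := h.isLat 0 (Nat.zero_le m)
      have h1 := h.isLat (k + 1) hk
      rw [← len_add (inf_le_inf (h.zero_le k (by omega)) le_rfl)
        (inf_le_inf (h.le k (by omega)) le_rfl) (h0.finOver_inf h1 _), totDim,
        Finset.sum_range_succ]
      refine Nat.add_le_add (ih (by omega)) ?_
      rw [hF k (by omega)]
      exact (h.isLat k (by omega)).le_len_enl_inf _ _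
  exact this m le_rfl

lemma Reach.exists_filtr [FiniteDimensional ℚ_[p] V] (hr : finrank ℚ_[p] V = r) {B : ℕ}
    {κs : List (ℕ → ℕ)} {s s' : Fin r → ℕ} (h : Reach B κs s s') {M L : Submodule ℤ_[p] V}
    (hM : IsLat M) (hL : IsLat L) (hML : M ≤ L) (hpos : HasPos M L s) :
    ∃ L', IsLat L' ∧ L ≤ L' ∧ HasPos M L' s' ∧ ∃ Fs : List (ℕ → Submodule ℚ_[p] V),
      List.Forall₂ (IsFiltr B) κs Fs ∧
      ∀ S : Submodule ℚ_[p] V, (Fs.map fun F => totDim B F S).sum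
        ≤ len (L ⊓ rs S) (L' ⊓ rs S) := by
  induction κs generalizing s L with
  | nil =>
    obtain rfl : s = s' := h
    exact ⟨L, hL, le_rfl, hpos, [], List.Forall₂.nil, fun S => by simp⟩
  | cons κ κs ih =>
    obtain ⟨f, hf, rfl, h'⟩ := h
    obtain ⟨C, rfl, hC, hCpos⟩ := hf.exists_latChain hr hM hL hML hpos
    have hCB := hC.isLat B le_rfl
    have hle := hC.zero_le B le_rfl
    obtain ⟨L', hL', hCL', hpos', Fs, hFs, hdim⟩ :=
      ih h' hCB (hML.trans hle) (hCpos B le_rfl)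
    obtain ⟨F, hF, hFC⟩ := hC.exists_filtration
    refine ⟨L', hL', hle.trans hCL', hpos', F :: Fs, List.Forall₂.cons ⟨hF, fun i hi => ?_⟩ hFs,
      fun S => ?_⟩
    · rw [← (hC.isLat i hi.le).len_enl, ← hFC i hi, hC.len_eq hf hM hML hCpos hi]
    · rw [List.map_cons, List.sum_cons, ← len_add (inf_le_inf hle le_rfl)
        (inf_le_inf hCL' le_rfl) (hL.finOver_inf hL' _)]
      exact Nat.add_le_add (hC.totDim_le hFC S) (hdim S)

lemma Reach.semi [FiniteDimensional ℚ_[p] V] (hr : finrank ℚ_[p] V = r) {B ℓ : ℕ}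
    {κs : List (ℕ → ℕ)} {δ : Fin r → ℕ} (h : Reach B κs 0 δ) (hδ : ∀ a, δ a ≤ ℓ)
    {M : Submodule ℤ_[p] V} (hM : IsLat M) : Semi p V B ℓ κs := by
  obtain ⟨L', hL', hle, hpos, Fs, hFs, hdim⟩ := h.exists_filtr hr hM hM le_rfl (hasPos_zero M)
  refine ⟨Fs, hFs, fun S => (hdim S).trans ?_⟩
  rw [← hM.len_inf_rs]
  exact len_le_of_le_right (inf_le_inf (hpos.le_up hM hL' hle hδ) le_rfl)
    (hM.finOver_inf (hM.up ℓ) _)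

lemma latChain_enls {m : ℕ} {F : ℕ → Submodule ℚ_[p] V} (hF : Antitone F)
    {L : Submodule ℤ_[p] V} (hL : IsLat L) :
    LatChain m (fun i => enls ((List.range i).map F) L) := by
  have hsucc : ∀ i, enls ((List.range (i + 1)).map F) L
      = enl (F i) (enls ((List.range i).map F) L) := by
    intro i
    rw [List.range_succ, List.map_append, enls_append]
    rfl
  refine ⟨fun i _ => hL.enls _, fun i _ => ?_, fun i _ => ?_, fun i _ => ?_⟩
  · rw [hsucc]; exact le_enl _ _
  · rw [hsucc]; exact enl_le_up _ _
  · rw [hsucc (i + 1)]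
    rintro v ⟨hv, hv'⟩
    have h1 : enls ((List.range (i + 1)).map F) L ≤ up 1 (enls ((List.range i).map F) L) := by
      rw [hsucc]; exact enl_le_up _ _
    obtain ⟨c, hc, w, hw, rfl⟩ := mem_sup.1 hv
    refine add_mem hc ?_
    have hw' := ((up 1 _).add_mem_iff_right (h1 hc)).1 hv'
    rw [hsucc]
    exact le_sup_right (a := enls ((List.range i).map F) L) ⟨hw', hF i.le_succ hw.2⟩

lemma exists_reach [FiniteDimensional ℚ_[p] V] (hr : finrank ℚ_[p] V = r) {B : ℕ}
    {κs : List (ℕ → ℕ)} {Fs : List (ℕ → Submodule ℚ_[p] V)}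
    (h : List.Forall₂ (IsFiltr B) κs Fs) {M L : Submodule ℤ_[p] V}
    (hM : IsLat M) (hL : IsLat L) (hML : M ≤ L) {s : Fin r → ℕ} (hpos : HasPos M L s) :
    ∃ s' : Fin r → ℕ, Reach B κs s s' ∧
      HasPos M (enls (Fs.flatMap fun F => (List.range B).map F) L) s' := by
  induction h generalizing s L with
  | nil => exact ⟨s, rfl, hpos⟩
  | @cons κ F κs Fs hF _ ih =>
    have hC := latChain_enls (m := B) hF.1 hL
    have hex : ∀ i, ∃ ν : Fin r → ℕ, HasPos M (enls ((List.range i).map F) L) ν ∧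
        (i = 0 → ν = s) := by
      intro i
      rcases Nat.eq_zero_or_pos i with rfl | hi
      · exact ⟨s, hpos, fun _ => rfl⟩
      · obtain ⟨ν, hν⟩ := exists_hasPos hr hM (hL.enls ((List.range i).map F))
          (hML.trans (le_enls _ _))
        exact ⟨ν, hν, fun h => by omega⟩
    choose f hf hf0 using hex
    have hpath := hC.lrPath hM hML (s := f) (fun i _ => hf i)
    obtain ⟨s', hs', hpos'⟩ := ih (hL.enls ((List.range B).map F)) (hML.trans (le_enls _ _)) (hf B)
    refine ⟨s', ⟨f, ⟨hpath.anti, hpath.le, hpath.le_succ, fun i hi => ?_, hpath.word⟩,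
      hf0 0 rfl, hs'⟩, ?_⟩
    · rw [hpath.size i hi, ← hF.2 i hi, ← (hL.enls ((List.range i).map F)).len_enl,
        List.range_succ, List.map_append, enls_append]
      rfl
    · rw [List.flatMap_cons, enls_append]
      exact hpos'

lemma sum_finrank_flatMap (B : ℕ) (Fs : List (ℕ → Submodule ℚ_[p] V)) (S : Submodule ℚ_[p] V) :
    ((Fs.flatMap fun F => (List.range B).map F).map fun W =>
      finrank ℚ_[p] (S ⊓ W : Submodule ℚ_[p] V)).sum = (Fs.map fun F => totDim B F S).sum := by
  induction Fs with
  | nil => rfl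
  | cons F Fs ih =>
    rw [List.flatMap_cons, List.map_append, List.sum_append, ih, List.map_cons, List.sum_cons,
      totDim, List.map_map]
    congr 1

lemma Semi.exists_reach {B ℓ : ℕ} {κs : List (ℕ → ℕ)} (h : Semi p (Fin r → ℚ_[p]) B ℓ κs) :
    ∃ δ : Fin r → ℕ, (∀ a, δ a ≤ ℓ) ∧ Reach B κs 0 δ := by
  obtain ⟨Fs, hFs, hdim⟩ := h
  obtain ⟨L, hL, hle⟩ := exists_isLat_enls_le_up (Fs.flatMap fun F => (List.range B).map F) ℓ
    (fun S => (sum_finrank_flatMap B Fs S).trans_le (hdim S))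
  obtain ⟨δ, hδ, hpos⟩ := PadicLattice.exists_reach (r := r) (by simp) hFs hL hL le_rfl
    (hasPos_zero L)
  exact ⟨δ, hpos.le_of_le_up hL (hL.enls _) (le_enls _ _) hle, hδ⟩

lemma sum_range_mul_div (N B : ℕ) (f : ℕ → ℕ) :
    ∑ i ∈ Finset.range (N * B), f i = ∑ i ∈ Finset.range B, ∑ x ∈ Finset.range N, f (N * i + x) := by
  induction B with
  | zero => simp
  | succ B ih => rw [Nat.mul_succ, Finset.sum_range_add, ih, Finset.sum_range_succ]

lemma Semi.mul {B ℓ N : ℕ} (hN : 0 < N) {κs : List (ℕ → ℕ)} (h : Semi p V B ℓ κs) :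
    Semi p V (N * B) (N * ℓ) (κs.map fun κ i => κ (i / N)) := by
  obtain ⟨Fs, hFs, hdim⟩ := h
  refine ⟨Fs.map fun F i => F (i / N), ?_, fun S => ?_⟩
  · rw [List.forall₂_map_left_iff, List.forall₂_map_right_iff]
    refine hFs.imp fun κ F hF => ⟨fun i j hij => hF.1 (Nat.div_le_div_right hij), fun i hi => ?_⟩
    exact hF.2 _ (Nat.div_lt_of_lt_mul hi)
  · have : ∀ F : ℕ → Submodule ℚ_[p] V,
        totDim (N * B) (fun i => F (i / N)) S = N * totDim B F S := by
      intro F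
      unfold totDim
      rw [sum_range_mul_div, Finset.mul_sum]
      refine Finset.sum_congr rfl fun i _ => ?_
      rw [Finset.sum_congr rfl (g := fun _ => finrank ℚ_[p] (S ⊓ F i : Submodule ℚ_[p] V)),
        Finset.sum_const, Finset.card_range, smul_eq_mul]
      intro x hx
      have h1 : (N * i + x) / N = i := by
        rw [Nat.mul_add_div hN, Nat.div_eq_of_lt (Finset.mem_range.1 hx), add_zero]
      show finrank ℚ_[p] (S ⊓ F ((N * i + x) / N) : Submodule ℚ_[p] V) = _
      exact congrArg (fun j => finrank ℚ_[p] (S ⊓ F j : Submodule ℚ_[p] V)) h1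
    rw [List.map_map]
    simp only [Function.comp_def, this]
    rw [List.sum_map_mul_left, mul_assoc]
    exact Nat.mul_le_mul_left N (hdim S)

lemma Semi.of_mul [FiniteDimensional ℚ_[p] V] {B ℓ N : ℕ} (hN : 0 < N) {κs : List (ℕ → ℕ)}
    (h : Semi p V (N * B) (N * ℓ) (κs.map fun κ i => κ (i / N))) : Semi p V B ℓ κs := by
  obtain ⟨Fs, hFs, hdim⟩ := h
  rw [List.forall₂_map_left_iff] at hFs
  refine ⟨Fs.map fun F i => F (N * i + (N - 1)), ?_, fun S => ?_⟩
  · rw [List.forall₂_map_right_iff]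
    refine hFs.imp fun κ F hF => ⟨fun i j hij => hF.1 ?_, fun i hi => ?_⟩
    · exact Nat.add_le_add_right (Nat.mul_le_mul_left N hij) _
    · have : N * (i + 1) ≤ N * B := Nat.mul_le_mul_left N hi
      rw [Nat.mul_succ] at this
      refine (hF.2 _ (by omega)).trans ?_
      dsimp only
      rw [Nat.mul_add_div hN, Nat.div_eq_of_lt (by omega), add_zero]
  · refine Nat.le_of_mul_le_mul_left ?_ hN
    rw [← mul_assoc]
    refine le_trans ?_ (hdim S)
    rw [← List.sum_map_mul_left, List.map_map]
    have hanti : ∀ F ∈ Fs, Antitone F := by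
      clear hdim
      induction hFs with
      | nil => simp
      | cons h _ ih =>
        intro F hF
        rcases List.mem_cons.1 hF with rfl | hF
        · exact h.1
        · exact ih F hF
    refine List.sum_le_sum fun F hF => ?_
    show N * ∑ i ∈ Finset.range B, _ ≤ ∑ i ∈ Finset.range (N * B), _
    rw [sum_range_mul_div, Finset.mul_sum]
    refine Finset.sum_le_sum fun i _ => ?_
    have h1 : ∀ x ∈ Finset.range N,
        finrank ℚ_[p] (S ⊓ F (N * i + (N - 1)) : Submodule ℚ_[p] V)
          ≤ finrank ℚ_[p] (S ⊓ F (N * i + x) : Submodule ℚ_[p] V) := fun x hx => by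
      have := Finset.mem_range.1 hx
      exact Submodule.finrank_mono (inf_le_inf le_rfl (hanti F hF (by omega)))
    simpa using Finset.card_nsmul_le_sum _ _ _ h1

end Semistable

/-- Saturation for concatenated lattice-word paths of bounded width. -/
theorem exists_reach_iff {r B ℓ N : ℕ} (hN : 0 < N) (κs : List (ℕ → ℕ)) :
    (∃ δ : Fin r → ℕ, (∀ a, δ a ≤ ℓ) ∧ Reach B κs 0 δ) ↔
    ∃ δ : Fin r → ℕ, (∀ a, δ a ≤ N * ℓ) ∧
      Reach (N * B) (κs.map fun κ i => κ (i / N)) 0 δ := by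
  have h2 : finrank ℚ_[2] (Fin r → ℚ_[2]) = r := by simp
  constructor
  · rintro ⟨δ, hδ, h⟩
    exact ((h.semi h2 hδ (isLat_stdLat (p := 2))).mul hN).exists_reach
  · rintro ⟨δ, hδ, h⟩
    exact ((h.semi h2 hδ (isLat_stdLat (p := 2))).of_mul hN).exists_reach

section JacobiTrudi

variable {r : ℕ}

lemma coeff_prod_mk_pow (n : ℕ) :
    PowerSeries.coeff n (∏ i : Fin r,
      PowerSeries.mk fun k => (MvPolynomial.X i : MvPolynomial (Fin r) ℤ) ^ k) =
    MvPolynomial.hsymm (Fin r) ℤ n := by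
  rw [PowerSeries.coeff_prod, MvPolynomial.hsymm]
  refine Finset.sum_bij (fun l hl => ⟨Finsupp.toMultiset l, ?_⟩) (fun _ _ => Finset.mem_univ _)
    ?_ ?_ ?_
  · rw [Finset.mem_finsuppAntidiag] at hl
    rw [Finsupp.card_toMultiset, Finsupp.sum_fintype _ _ (fun _ => rfl)]
    exact hl.1
  · intro a ha b hb h
    have h1 : Finsupp.toMultiset a = Finsupp.toMultiset b := congrArg Subtype.val h
    simpa using congrArg Multiset.toFinsupp h1
  · intro s _
    refine ⟨Multiset.toFinsupp s.1, ?_, Subtype.ext (Multiset.toFinsupp_toMultiset s.1)⟩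
    rw [Finset.mem_finsuppAntidiag]
    refine ⟨?_, Finset.subset_univ _⟩
    have := Finsupp.card_toMultiset (Multiset.toFinsupp s.1)
    rw [Multiset.toFinsupp_toMultiset, Finsupp.sum_fintype _ _ (fun _ => rfl)] at this
    exact this.symm.trans s.2
  · intro l hl
    simp only [PowerSeries.coeff_mk]
    show _ = (Multiset.map _ (Finsupp.toMultiset l)).prod
    rw [Finsupp.toMultiset_map, Finsupp.prod_toMultiset, Finsupp.prod_mapDomain_index (by simp)
      (by intros; rw [pow_add]), Finsupp.prod_fintype _ _ (by simp)]

/-- The generating polynomial of the signed elementary symmetric polynomials in all the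
variables but `l`. -/
def elemGen (l : Fin r) : Polynomial (MvPolynomial (Fin r) ℤ) :=
  ∏ i ∈ Finset.univ.erase l, (1 - Polynomial.C (MvPolynomial.X i) * Polynomial.X)

lemma natDegree_elemGen (l : Fin r) : (elemGen l).natDegree < r := by
  have hr : 0 < r := l.pos
  have h : (elemGen l).natDegree ≤ ∑ i ∈ Finset.univ.erase l, 1 := by
    refine (Polynomial.natDegree_prod_le _ _).trans (Finset.sum_le_sum fun i _ => ?_)
    refine (Polynomial.natDegree_sub_le _ _).trans ?_
    rw [Polynomial.natDegree_one, max_eq_right (Nat.zero_le _)]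
    exact (Polynomial.natDegree_C_mul_le _ _).trans Polynomial.natDegree_X_le
  rw [Finset.sum_const, Finset.card_erase_of_mem (Finset.mem_univ _), Finset.card_univ,
    Fintype.card_fin] at h
  simp at h
  omega

lemma mk_pow_mul_one_sub {R : Type*} [CommRing R] (x : R) :
    (PowerSeries.mk fun k => x ^ k) * (1 - PowerSeries.C x * PowerSeries.X) = 1 := by
  ext n
  rw [mul_sub, mul_one, map_sub, mul_comm (PowerSeries.C x), ← mul_assoc, PowerSeries.coeff_mul_C]
  cases n with
  | zero => simp
  | succ n => simp [PowerSeries.coeff_succ_mul_X, pow_succ, PowerSeries.coeff_one]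

lemma hsymm_elemGen (l : Fin r) (n : ℕ) :
    ∑ k ∈ Finset.range (n + 1),
      (elemGen l).coeff k * MvPolynomial.hsymm (Fin r) ℤ (n - k) = MvPolynomial.X l ^ n := by
  have h : ((elemGen l : Polynomial _) : PowerSeries (MvPolynomial (Fin r) ℤ)) *
      (∏ i : Fin r, PowerSeries.mk fun k => (MvPolynomial.X i : MvPolynomial (Fin r) ℤ) ^ k) =
      PowerSeries.mk fun k => (MvPolynomial.X l : MvPolynomial (Fin r) ℤ) ^ k := by
    have : ((elemGen l : Polynomial _) : PowerSeries (MvPolynomial (Fin r) ℤ)) =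
        ∏ i ∈ Finset.univ.erase l,
          (1 - PowerSeries.C (MvPolynomial.X i : MvPolynomial (Fin r) ℤ) * PowerSeries.X) := by
      rw [elemGen, ← Polynomial.coeToPowerSeries.ringHom_apply, map_prod]
      simp
    rw [this, mul_comm, ← Finset.mul_prod_erase _ _ (Finset.mem_univ l), mul_assoc, ← Finset.prod_mul_distrib,
      Finset.prod_eq_one, mul_one]
    intro i _
    exact mk_pow_mul_one_sub _
  have := congrArg (PowerSeries.coeff n) h
  rw [PowerSeries.coeff_mul, PowerSeries.coeff_mk,
    Finset.Nat.sum_antidiagonal_eq_sum_range_succ_mk] at this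
  rw [← this]
  refine Finset.sum_congr rfl fun k _ => ?_
  rw [coeff_prod_mk_pow, Polynomial.coeff_coe]

lemma sum_elemGen_hkZ (l : Fin r) (n : ℕ) :
    ∑ k ∈ Finset.range r, (elemGen l).coeff k * hkZ r ((n : ℤ) - k) = MvPolynomial.X l ^ n := by
  have h1 : Finset.range r ⊆ Finset.range (r + (n + 1)) := Finset.range_subset_range.2 (by omega)
  have h2 : Finset.range (n + 1) ⊆ Finset.range (r + (n + 1)) :=
    Finset.range_subset_range.2 (by omega)
  rw [← hsymm_elemGen l n, Finset.sum_subset h1, ← Finset.sum_subset h2]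
  · refine Finset.sum_congr rfl fun k hk => ?_
    have := Finset.mem_range.1 hk
    rw [hkZ, if_pos (by omega)]
    congr 2
    omega
  · intro k _ hk
    rw [Finset.mem_range] at hk
    rw [hkZ, if_neg (by omega), mul_zero]
  · intro k _ hk
    rw [Finset.mem_range, not_lt] at hk
    rw [Polynomial.coeff_eq_zero_of_natDegree_lt ((natDegree_elemGen l).trans_le hk), zero_mul]

/-- The alternant with exponents `α`. -/
def alt (α : Fin r → ℕ) : MvPolynomial (Fin r) ℤ :=
  Matrix.det (Matrix.of fun a b => MvPolynomial.X a ^ α b)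

/-- The alternant whose quotient by the Vandermonde alternant is the Schur polynomial of `ν`. -/
def altRho (ν : Fin r → ℕ) : MvPolynomial (Fin r) ℤ :=
  alt fun b => ν b + (r - 1 - (b : ℕ))

lemma altRho_zero : altRho (0 : Fin r → ℕ) = alternant r := by
  simp [altRho, alt, alternant]

/-- The matrix of signed elementary symmetric polynomials. -/
def elemMatrix (r : ℕ) : Matrix (Fin r) (Fin r) (MvPolynomial (Fin r) ℤ) :=
  Matrix.of fun l j => (elemGen l).coeff (r - 1 - (j : ℕ))

lemma det_elemMatrix_mul_schurP (μ : Fin r → ℕ) : (elemMatrix r).det * schurP μ = altRho μ := by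
  rw [schurP, ← Matrix.det_transpose (Matrix.of fun a b : Fin r => hkZ r _), ← Matrix.det_mul,
    altRho, alt]
  congr 1
  ext1 l i
  rw [Matrix.mul_apply, Matrix.of_apply, ← sum_elemGen_hkZ l, ← Finset.sum_range_reflect,
    ← Fin.sum_univ_eq_sum_range (fun j => (elemGen l).coeff (r - 1 - j) *
      hkZ r (((μ i + (r - 1 - (i : ℕ)) : ℕ) : ℤ) - ((r - 1 - j : ℕ) : ℤ)))]
  refine Finset.sum_congr rfl fun j _ => ?_
  rw [elemMatrix, Matrix.of_apply, Matrix.transpose_apply, Matrix.of_apply]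
  congr 2
  omega

lemma schurP_zero : schurP (0 : Fin r → ℕ) = 1 := by
  rw [schurP, Matrix.det_of_isUpperTriangular]
  · refine Finset.prod_eq_one fun i _ => ?_
    simp [hkZ]
  · intro i j hij
    have : (j : ℕ) < i := hij
    rw [Matrix.of_apply, hkZ, if_neg]
    simp only [Pi.zero_apply]
    omega

/-- The bialternant formula for Schur polynomials. -/
lemma schurP_mul_alternant (μ : Fin r → ℕ) : schurP μ * altRho 0 = altRho μ := by
  rw [← det_elemMatrix_mul_schurP 0, schurP_zero, mul_one, mul_comm, det_elemMatrix_mul_schurP]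

end JacobiTrudi

section Pieri

variable {r : ℕ}

lemma alt_eq_zero {α : Fin r → ℕ} {a b : Fin r} (hab : a ≠ b) (h : α a = α b) : alt α = 0 :=
  Matrix.det_zero_of_column_eq hab fun k => by simp [h]

/-- Add one box to the rows in `D`. -/
def addBoxes (ν : Fin r → ℕ) (D : Finset (Fin r)) : Fin r → ℕ := fun a => ν a + if a ∈ D then 1 else 0

lemma addBoxes_injective (ν : Fin r → ℕ) : Function.Injective (addBoxes ν) := by
  intro D E h
  ext a
  have := congrFun h a
  simp only [addBoxes] at this
  by_cases h1 : a ∈ D <;> by_cases h2 : a ∈ E <;> simp_all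

lemma sum_addBoxes (ν : Fin r → ℕ) (D : Finset (Fin r)) :
    ∑ a, addBoxes ν D a = ∑ a, ν a + D.card := by
  simp [addBoxes, Finset.sum_add_distrib]

lemma esymm_mul_alt (k : ℕ) (α : Fin r → ℕ) :
    MvPolynomial.esymm (Fin r) ℤ k * alt α =
      ∑ D ∈ Finset.powersetCard k Finset.univ, alt (addBoxes α D) := by
  simp only [alt, Matrix.det_apply, MvPolynomial.esymm, Matrix.of_apply]
  rw [Finset.sum_comm, Finset.mul_sum]
  refine Finset.sum_congr rfl fun σ _ => ?_
  rw [mul_smul_comm, ← Finset.smul_sum, Finset.sum_mul]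
  congr 1
  refine (Finset.sum_bij (fun D _ => D.map σ.toEmbedding) ?_ ?_ ?_ ?_).symm
  · intro D hD
    rw [Finset.mem_powersetCard] at hD ⊢
    exact ⟨Finset.subset_univ _, by rw [Finset.card_map]; exact hD.2⟩
  · intro D _ E _ h
    exact Finset.map_injective _ h
  · intro T hT
    refine ⟨T.map σ.symm.toEmbedding, ?_, ?_⟩
    · rw [Finset.mem_powersetCard] at hT ⊢
      exact ⟨Finset.subset_univ _, by rw [Finset.card_map]; exact hT.2⟩
    · ext a
      simp
  · intro D _
    rw [Finset.prod_map]
    simp only [addBoxes, pow_add, Finset.prod_mul_distrib, pow_ite, pow_one, pow_zero]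
    rw [mul_comm, Finset.prod_ite_mem, Finset.univ_inter]
    rfl

lemma altRho_addBoxes (ν : Fin r → ℕ) (D : Finset (Fin r)) :
    alt (addBoxes (fun b => ν b + (r - 1 - (b : ℕ))) D) = altRho (addBoxes ν D) := by
  rw [altRho]
  congr 1
  ext a
  simp only [addBoxes]
  omega

lemma exists_succ_lt_of_not_antitone {ν : Fin r → ℕ} (h : ¬ Antitone ν) :
    ∃ a b : Fin r, (b : ℕ) = a + 1 ∧ ν a < ν b := by
  by_contra! hc
  apply h
  cases r with
  | zero => exact fun a => a.elim0
  | succ n =>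
    rw [Fin.antitone_iff_succ_le]
    intro i
    exact hc _ _ (by simp)

lemma altRho_addBoxes_eq_zero {ν : Fin r → ℕ} (hν : Antitone ν) {D : Finset (Fin r)}
    (h : ¬ Antitone (addBoxes ν D)) : altRho (addBoxes ν D) = 0 := by
  obtain ⟨a, b, hab, hlt⟩ := exists_succ_lt_of_not_antitone h
  have h1 : ν b ≤ ν a := hν (Fin.le_def.2 (by omega))
  have h2 : addBoxes ν D a + 1 = addBoxes ν D b := by
    simp only [addBoxes] at hlt ⊢
    split_ifs at hlt ⊢ <;> omega
  refine alt_eq_zero (a := a) (b := b) (by rintro rfl; omega) ?_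
  show addBoxes ν D a + (r - 1 - (a : ℕ)) = addBoxes ν D b + (r - 1 - (b : ℕ))
  omega

open Classical in
/-- The partitions obtained from `ν` by adding a vertical strip. -/
def strips (ν : Fin r → ℕ) : Finset (Fin r → ℕ) :=
  (Finset.univ.image (addBoxes ν)).filter Antitone

lemma mem_strips {ν ν' : Fin r → ℕ} :
    ν' ∈ strips ν ↔ Antitone ν' ∧ (∀ a, ν a ≤ ν' a) ∧ ∀ a, ν' a ≤ ν a + 1 := by
  rw [strips, Finset.mem_filter, Finset.mem_image, and_comm]
  refine and_congr_right fun _ => ⟨?_, fun ⟨h1, h2⟩ => ?_⟩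
  · rintro ⟨D, -, rfl⟩
    simp only [addBoxes]
    refine ⟨fun a => by omega, fun a => by split_ifs <;> omega⟩
  · refine ⟨Finset.univ.filter fun a => ν a < ν' a, Finset.mem_univ _, ?_⟩
    ext a
    have := h1 a
    have := h2 a
    simp only [addBoxes, Finset.mem_filter, Finset.mem_univ, true_and]
    split_ifs <;> omega

/-- `e_k` for an integer `k` (zero for negative `k`). -/
def ekZ (r : ℕ) (k : ℤ) : MvPolynomial (Fin r) ℤ :=
  if 0 ≤ k then MvPolynomial.esymm (Fin r) ℤ k.toNat else 0

/-- The indicator that `ν'` has `k` more boxes than `ν`. -/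
def sizeInd (ν ν' : Fin r → ℕ) (k : ℤ) : MvPolynomial (Fin r) ℤ :=
  if ((∑ a, ν' a : ℕ) : ℤ) = (∑ a, ν a : ℕ) + k then 1 else 0

/-- The Pieri rule for multiplication by elementary symmetric polynomials. -/
lemma ekZ_mul_altRho (k : ℤ) {ν : Fin r → ℕ} (hν : Antitone ν) :
    ekZ r k * altRho ν = ∑ ν' ∈ strips ν, sizeInd ν ν' k * altRho ν' := by
  classical
  have key : ∑ ν' ∈ strips ν, sizeInd ν ν' k * altRho ν' =
      ∑ D : Finset (Fin r), if ((D.card : ℕ) : ℤ) = k then altRho (addBoxes ν D) else 0 := by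
    rw [strips, Finset.sum_filter, Finset.sum_image fun D _ E _ h => addBoxes_injective ν h]
    refine Finset.sum_congr rfl fun D _ => ?_
    by_cases h : Antitone (addBoxes ν D)
    · rw [if_pos h, sizeInd, sum_addBoxes, ite_mul, one_mul, zero_mul]
      push_cast
      simp only [add_right_inj]
    · rw [if_neg h, altRho_addBoxes_eq_zero hν h, ite_self]
  rw [key, ekZ]
  split_ifs with hk
  · obtain ⟨k, rfl⟩ := Int.eq_ofNat_of_zero_le hk
    rw [Int.toNat_natCast, altRho, esymm_mul_alt, ← Finset.sum_filter]
    refine Finset.sum_congr ?_ fun D _ => altRho_addBoxes ν D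
    ext D
    simp [Finset.mem_powersetCard]
  · rw [zero_mul, Finset.sum_eq_zero]
    intro D _
    rw [if_neg (by omega)]

lemma perm_eq_one_of_strictMono {n : ℕ} {σ : Equiv.Perm (Fin n)} (h : StrictMono σ) : σ = 1 := by
  have : StrictMono.orderIsoOfSurjective σ h σ.surjective = OrderIso.refl _ :=
    Subsingleton.elim _ _
  ext1 a
  exact congrArg (fun e : Fin n ≃o Fin n => e a) this

lemma coeff_altRho {δ ν : Fin r → ℕ} (hδ : Antitone δ) (hν : Antitone ν) :
    MvPolynomial.coeff (Finsupp.equivFunOnFinite.symm fun a : Fin r => δ a + (r - 1 - (a : ℕ)))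
      (altRho ν) = if δ = ν then 1 else 0 := by
  have hanti : ∀ {ν : Fin r → ℕ}, Antitone ν →
      StrictAnti fun a : Fin r => ν a + (r - 1 - (a : ℕ)) := by
    intro ν hν a b hab
    have := hν hab.le
    have : (a : ℕ) < b := hab
    show ν b + (r - 1 - (b : ℕ)) < ν a + (r - 1 - (a : ℕ))
    omega
  have hprod : ∀ σ : Equiv.Perm (Fin r),
      ∏ i, (MvPolynomial.X (σ i) : MvPolynomial (Fin r) ℤ) ^ (ν i + (r - 1 - (i : ℕ))) =
      MvPolynomial.monomial (Finsupp.equivFunOnFinite.symm fun a : Fin r =>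
        ν (σ.symm a) + (r - 1 - ((σ.symm a : Fin r) : ℕ))) 1 := by
    intro σ
    rw [← Equiv.prod_comp σ.symm, MvPolynomial.monomial_eq, Finsupp.prod_fintype _ _ (by simp)]
    simp
  rw [altRho, alt, Matrix.det_apply, MvPolynomial.coeff_sum]
  simp only [Matrix.of_apply, hprod]
  rw [Finset.sum_eq_single 1]
  · simp only [Equiv.Perm.sign_one, one_smul, MvPolynomial.coeff_monomial, EmbeddingLike.apply_eq_iff_eq]
    refine if_congr ⟨fun h => ?_, fun h => ?_⟩ rfl rfl
    · ext a
      have : ν a + (r - 1 - (a : ℕ)) = δ a + (r - 1 - (a : ℕ)) := congrFun h a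
      omega
    · subst h
      rfl
  · intro σ _ hσ
    have h0 : MvPolynomial.coeff
        (Finsupp.equivFunOnFinite.symm fun a : Fin r => δ a + (r - 1 - (a : ℕ)))
        (MvPolynomial.monomial (Finsupp.equivFunOnFinite.symm fun a : Fin r =>
          ν (σ.symm a) + (r - 1 - ((σ.symm a : Fin r) : ℕ))) (1 : ℤ)) = 0 := by
      rw [MvPolynomial.coeff_monomial, if_neg]
      intro h
      have h := Finsupp.equivFunOnFinite.symm.injective h
      have hmono : StrictMono σ.symm := by
        intro a b hab
        refine (hanti hν).lt_iff_gt.1 ?_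
        have h1 := congrFun h a
        have h2 := congrFun h b
        have h3 : δ b + (r - 1 - (b : ℕ)) < δ a + (r - 1 - (a : ℕ)) := hanti hδ hab
        show ν (σ.symm b) + (r - 1 - ((σ.symm b : Fin r) : ℕ)) <
          ν (σ.symm a) + (r - 1 - ((σ.symm a : Fin r) : ℕ))
        omega
      have := perm_eq_one_of_strictMono hmono
      exact hσ (by rw [← σ.symm_symm, this]; rfl)
    rcases Int.units_eq_one_or (Equiv.Perm.sign σ) with h | h
    · rw [h, one_smul, h0]
    · rw [h, Units.neg_smul, one_smul, MvPolynomial.coeff_neg, h0, neg_zero]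
  · simp

end Pieri

section Paths

variable {r : ℕ}

/-- Continue the path `p` after time `m` by the constant `ν`. -/
def extend (p : ℕ → Fin r → ℕ) (m : ℕ) (ν : Fin r → ℕ) : ℕ → Fin r → ℕ :=
  fun i => if i ≤ m then p i else ν

open Classical in
/-- Sequences of `m` vertical strips starting at `ν`, extended constantly. -/
def paths (ν : Fin r → ℕ) : ℕ → Finset (ℕ → Fin r → ℕ)
  | 0 => {fun _ => ν}
  | m + 1 => (paths ν m).biUnion fun p => (strips (p m)).image (extend p m)

lemma mem_paths {ν : Fin r → ℕ} {m : ℕ} {p : ℕ → Fin r → ℕ} :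
    p ∈ paths ν m ↔ p 0 = ν ∧ (∀ i < m, p (i + 1) ∈ strips (p i)) ∧ ∀ i, m ≤ i → p i = p m := by
  induction m generalizing p with
  | zero =>
    rw [paths, Finset.mem_singleton]
    constructor
    · rintro rfl
      simp
    · rintro ⟨h, -, h1⟩
      funext i
      rw [h1 i (Nat.zero_le _), h]
  | succ m ih =>
    simp only [paths, Finset.mem_biUnion, Finset.mem_image, ih]
    constructor
    · rintro ⟨q, ⟨h0, h1, h2⟩, μ, hμ, rfl⟩
      refine ⟨by simpa [extend] using h0, fun i hi => ?_, fun i hi => ?_⟩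
      · rcases Nat.lt_succ_iff_lt_or_eq.1 hi with hi | rfl
        · simpa [extend, hi.le, Nat.succ_le_of_lt hi] using h1 i hi
        · simpa [extend] using hμ
      · have h3 : ¬ i ≤ m := by omega
        simp [extend, h3]
    · rintro ⟨h0, h1, h2⟩
      refine ⟨extend p m (p m), ⟨by simpa [extend] using h0, fun i hi => ?_, fun i hi => ?_⟩,
        p (m + 1), by simpa [extend] using h1 m (Nat.lt_succ_self m), ?_⟩
      · simpa [extend, hi.le, Nat.succ_le_of_lt hi] using h1 i (hi.trans (Nat.lt_succ_self m))
      · rcases hi.eq_or_lt with rfl | hi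
        · rfl
        · simp [extend, hi.not_ge]
      · funext i
        by_cases hi : i ≤ m
        · simp [extend, hi]
        · simp only [extend, hi, if_false]
          exact (h2 i (by omega)).symm

lemma sum_paths_succ {M : Type*} [AddCommMonoid M] (ν : Fin r → ℕ) (m : ℕ)
    (F : (ℕ → Fin r → ℕ) → M) :
    ∑ p ∈ paths ν (m + 1), F p = ∑ p ∈ paths ν m, ∑ μ ∈ strips (p m), F (extend p m μ) := by
  classical
  rw [paths, Finset.sum_biUnion]
  · refine Finset.sum_congr rfl fun p _ => Finset.sum_image fun μ _ μ' _ h => ?_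
    simpa [extend] using congrFun h (m + 1)
  · intro p hp q hq hpq
    rw [Function.onFun, Finset.disjoint_left]
    intro s hs hs'
    obtain ⟨μ, -, rfl⟩ := Finset.mem_image.1 hs
    obtain ⟨μ', -, h⟩ := Finset.mem_image.1 hs'
    apply hpq
    have hpq' : ∀ i ≤ m, p i = q i := fun i hi => by
      simpa [extend, hi] using (congrFun h i).symm
    funext i
    rcases le_total i m with hi | hi
    · exact hpq' i hi
    · rw [(mem_paths.1 hp).2.2 i hi, (mem_paths.1 hq).2.2 i hi, hpq' m le_rfl]

lemma antitone_of_mem_paths {ν : Fin r → ℕ} (hν : Antitone ν) {m : ℕ} {p : ℕ → Fin r → ℕ}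
    (hp : p ∈ paths ν m) (i : ℕ) : Antitone (p i) := by
  obtain ⟨h0, h1, h2⟩ := mem_paths.1 hp
  have : ∀ i ≤ m, Antitone (p i) := by
    intro i hi
    cases i with
    | zero => rwa [h0]
    | succ i => exact (mem_strips.1 (h1 i hi)).1
  rcases le_total i m with hi | hi
  · exact this i hi
  · rw [h2 i hi]
    exact this m le_rfl

lemma prod_ekZ_mul_altRho {ν : Fin r → ℕ} (hν : Antitone ν) (m : ℕ) (k : ℕ → ℤ) :
    (∏ i ∈ Finset.range m, ekZ r (k i)) * altRho ν =
      ∑ p ∈ paths ν m, (∏ i ∈ Finset.range m, sizeInd (p i) (p (i + 1)) (k i)) * altRho (p m) := by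
  induction m with
  | zero => simp [paths]
  | succ m ih =>
    rw [Finset.prod_range_succ, mul_comm _ (ekZ r (k m)), mul_assoc, ih, Finset.mul_sum,
      sum_paths_succ]
    refine Finset.sum_congr rfl fun p hp => ?_
    rw [mul_left_comm, ekZ_mul_altRho _ (antitone_of_mem_paths hν hp m), Finset.mul_sum]
    refine Finset.sum_congr rfl fun μ _ => ?_
    rw [Finset.prod_range_succ, mul_assoc]
    congr 1
    · refine Finset.prod_congr rfl fun i hi => ?_
      have := Finset.mem_range.1 hi
      simp [extend, this.le, Nat.succ_le_of_lt this]
    · simp [extend]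

/-- The dual Jacobi–Trudi determinant with column lengths `κ`. -/
def dualSchur (r m : ℕ) (κ : ℕ → ℕ) : MvPolynomial (Fin r) ℤ :=
  Matrix.det (Matrix.of fun j i : Fin m => ekZ r ((κ j : ℤ) - (j : ℕ) + (i : ℕ)))

/-- The signed weight of a path in the expansion of the dual Jacobi–Trudi determinant. -/
def pathWt (m : ℕ) (κ : ℕ → ℕ) (p : ℕ → Fin r → ℕ) : MvPolynomial (Fin r) ℤ :=
  Matrix.det (Matrix.of fun j i : Fin m =>
    sizeInd (p i) (p (i + 1)) ((κ j : ℤ) - (j : ℕ) + (i : ℕ)))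

lemma dualSchur_mul_altRho {ν : Fin r → ℕ} (hν : Antitone ν) (m : ℕ) (κ : ℕ → ℕ) :
    dualSchur r m κ * altRho ν = ∑ p ∈ paths ν m, pathWt m κ p * altRho (p m) := by
  simp only [dualSchur, pathWt, Matrix.det_apply, Matrix.of_apply, Finset.sum_mul]
  rw [Finset.sum_comm]
  refine Finset.sum_congr rfl fun σ _ => ?_
  have hσ : ∃ k : ℕ → ℤ, ∀ i : Fin m, k i = (κ (σ i) : ℤ) - ((σ i : Fin m) : ℕ) + (i : ℕ) :=
    ⟨fun i => if h : i < m then (κ (σ ⟨i, h⟩) : ℤ) - ((σ ⟨i, h⟩ : Fin m) : ℕ) + i else 0,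
      fun i => by simp⟩
  obtain ⟨k, hk⟩ := hσ
  have := prod_ekZ_mul_altRho hν m k
  simp only [Finset.prod_range, hk] at this
  simp only [smul_mul_assoc]
  rw [this, Finset.smul_sum]

end Paths

section ColumnToggle

/-- Column lengths of two consecutive vertical strips. -/
structure Interlace (x y z : ℕ → ℕ) : Prop where
  le_left : ∀ c, x c ≤ y c
  le_right : ∀ c, y c ≤ z c
  succ_left : ∀ c, y (c + 1) ≤ x c
  succ_right : ∀ c, z (c + 1) ≤ y c

/-- Failure of the lattice-word condition at column `k`. -/
def ColViol (x y z : ℕ → ℕ) (k : ℕ) : Prop :=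
  ∑ c ∈ Finset.range (k + 1), y c + ∑ c ∈ Finset.range k, y c <
    ∑ c ∈ Finset.range (k + 1), z c + ∑ c ∈ Finset.range k, x c

/-- The Bender–Knuth type toggle from column `k` on. -/
def colToggle (k : ℕ) (x y z : ℕ → ℕ) (c : ℕ) : ℕ :=
  if c < k then y c
  else if c = k then
    (∑ c ∈ Finset.range (k + 1), z c + ∑ c ∈ Finset.range k, x c) -
      (∑ c ∈ Finset.range (k + 1), y c + ∑ c ∈ Finset.range k, y c) - 1 + max (x k) (z (k + 1))
  else max (x c) (z (c + 1)) + min (x (c - 1)) (z c) - y c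

variable {x y z : ℕ → ℕ} {k : ℕ}

lemma colToggle_of_lt {c : ℕ} (hc : c < k) : colToggle k x y z c = y c := if_pos hc

lemma sum_colToggle_of_le {j : ℕ} (hj : j ≤ k) :
    ∑ c ∈ Finset.range j, colToggle k x y z c = ∑ c ∈ Finset.range j, y c :=
  Finset.sum_congr rfl fun _ hc => colToggle_of_lt ((Finset.mem_range.1 hc).trans_le hj)

lemma colToggle_self (hv : ColViol x y z k) :
    colToggle k x y z k + 1 + (∑ c ∈ Finset.range (k + 1), y c + ∑ c ∈ Finset.range k, y c) =
      ∑ c ∈ Finset.range (k + 1), z c + ∑ c ∈ Finset.range k, x c + max (x k) (z (k + 1)) := by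
  unfold ColViol at hv
  simp only [colToggle, lt_irrefl, if_false, if_true]
  omega

lemma Interlace.colToggle_of_gt (h : Interlace x y z) {c : ℕ} (hc : k < c) :
    colToggle k x y z c + y c = max (x c) (z (c + 1)) + min (x (c - 1)) (z c) := by
  have h1 := h.le_left c
  have h2 := h.le_right c
  have h3 := h.succ_left (c - 1)
  have h4 := h.succ_right c
  rw [Nat.sub_add_cancel (by omega)] at h3
  simp only [colToggle, hc.not_gt, hc.ne', if_false]
  omega

lemma Interlace.colToggle (h : Interlace x y z) (hv : ColViol x y z k)
    (hmin : ∀ j < k, ¬ ColViol x y z j) : Interlace x (colToggle k x y z) z := by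
  have hself := colToggle_self hv
  have key : ∀ c, max (x c) (z (c + 1)) ≤ PadicLattice.colToggle k x y z c ∧
      PadicLattice.colToggle k x y z c ≤ z c ∧
      (0 < c → PadicLattice.colToggle k x y z c ≤ x (c - 1)) := by
    intro c
    have h1 := h.le_left c
    have h2 := h.le_right c
    have h3 := h.succ_left (c - 1)
    have h4 := h.succ_right c
    rcases lt_trichotomy c k with hc | rfl | hc
    · rw [colToggle_of_lt hc]
      refine ⟨by omega, h2, fun hc => ?_⟩
      rwa [Nat.sub_add_cancel hc] at h3
    · unfold ColViol at hv hmin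
      rw [Finset.sum_range_succ, Finset.sum_range_succ] at hself hv
      rcases Nat.eq_zero_or_pos c with rfl | hpos
      · simp only [Finset.sum_range_zero] at hself hv
        omega
      · obtain ⟨b, rfl⟩ : ∃ b, c = b + 1 := ⟨c - 1, by omega⟩
        have h5 := hmin b (by omega)
        have h6 := h.succ_right b
        have h7 := h.le_left b
        simp only [Finset.sum_range_succ, Nat.add_sub_cancel] at hself hv h5 h3 ⊢
        omega
    · have := h.colToggle_of_gt hc
      rw [Nat.sub_add_cancel (by omega)] at h3
      omega
  refine ⟨fun c => (le_max_left _ _).trans (key c).1, fun c => (key c).2.1, fun c => ?_,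
    fun c => (le_max_right _ _).trans (key c).1⟩
  exact (key (c + 1)).2.2 (Nat.succ_pos c)

lemma Interlace.sum_colToggle (h : Interlace x y z) (hv : ColViol x y z k) {j : ℕ} (hj : k < j) :
    ∑ c ∈ Finset.range j, PadicLattice.colToggle k x y z c + ∑ c ∈ Finset.range j, y c +
      min (x (j - 1)) (z j) + 1 =
    ∑ c ∈ Finset.range j, x c + ∑ c ∈ Finset.range (j + 1), z c := by
  induction j, hj using Nat.le_induction with
  | base =>
    have hself := colToggle_self hv
    simp only [Finset.sum_range_succ, sum_colToggle_of_le (le_refl k), Nat.succ_eq_add_one,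
      Nat.add_sub_cancel] at hself ⊢
    omega
  | succ j hj ih =>
    have := h.colToggle_of_gt (k := k) (c := j) hj
    simp only [Finset.sum_range_succ, Nat.add_sub_cancel] at ih ⊢
    omega

lemma Interlace.colViol_colToggle (h : Interlace x y z) (hv : ColViol x y z k) :
    ColViol x (PadicLattice.colToggle k x y z) z k := by
  have hself := colToggle_self hv
  have h1 := h.le_left k
  have h4 := h.succ_right k
  unfold ColViol at hv ⊢
  simp only [Finset.sum_range_succ, sum_colToggle_of_le (le_refl k)] at hv hself ⊢
  omega

lemma Interlace.colToggle_colToggle (h : Interlace x y z) (hv : ColViol x y z k)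
    (hmin : ∀ j < k, ¬ ColViol x y z j) :
    PadicLattice.colToggle k x (PadicLattice.colToggle k x y z) z = y := by
  funext c
  rcases lt_trichotomy c k with hc | rfl | hc
  · rw [colToggle_of_lt hc, colToggle_of_lt hc]
  · have h1 := colToggle_self hv
    have h2 := colToggle_self (h.colViol_colToggle hv)
    simp only [Finset.sum_range_succ, sum_colToggle_of_le (le_refl c)] at h1 h2
    omega
  · have h1 := h.colToggle_of_gt hc
    have h2 := (h.colToggle hv hmin).colToggle_of_gt hc
    omega

end ColumnToggle

section FirstViolation

/-- The lattice-word condition fails at step `i` and column `k` of the sequence `C` of column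
lengths; the pair is extremal with this property. -/
structure FirstViol (m : ℕ) (C : ℕ → ℕ → ℕ) (i k : ℕ) : Prop where
  lt : i + 1 < m
  viol : ColViol (C i) (C (i + 1)) (C (i + 2)) k
  min : ∀ j, j + 1 < m → ∀ k' < k, ¬ ColViol (C j) (C (j + 1)) (C (j + 2)) k'
  max : ∀ j, j + 1 < m → i < j → ¬ ColViol (C j) (C (j + 1)) (C (j + 2)) k

variable {m : ℕ} {C : ℕ → ℕ → ℕ} {i k : ℕ}

lemma exists_firstViol (h : ∃ j k, j + 1 < m ∧ ColViol (C j) (C (j + 1)) (C (j + 2)) k) :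
    ∃ i k, FirstViol m C i k := by
  classical
  have h' : ∃ k j, j + 1 < m ∧ ColViol (C j) (C (j + 1)) (C (j + 2)) k := by
    obtain ⟨j, k, h⟩ := h
    exact ⟨k, j, h⟩
  obtain ⟨j, hj⟩ := Nat.find_spec h'
  have hi := Nat.findGreatest_spec
    (P := fun j => j + 1 < m ∧ ColViol (C j) (C (j + 1)) (C (j + 2)) (Nat.find h'))
    (show j ≤ m by omega) hj
  refine ⟨_, _, hi.1, hi.2, fun j hj k' hk' hv => Nat.find_min h' hk' ⟨j, hj, hv⟩,
    fun j hj hlt hv => ?_⟩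
  exact Nat.findGreatest_is_greatest hlt (by omega) ⟨hj, hv⟩

lemma FirstViol.unique {i' k' : ℕ} (h : FirstViol m C i k) (h' : FirstViol m C i' k') :
    i = i' ∧ k = k' := by
  have hk : k = k' := by
    rcases lt_trichotomy k k' with hlt | he | hlt
    · exact absurd h.viol (h'.min _ h.lt _ hlt)
    · exact he
    · exact absurd h'.viol (h.min _ h'.lt _ hlt)
  subst hk
  refine ⟨?_, rfl⟩
  rcases lt_trichotomy i i' with hlt | he | hlt
  · exact absurd h'.viol (h.max _ h'.lt hlt)
  · exact he
  · exact absurd h.viol (h'.max _ h.lt hlt)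

/-- Toggle the sequence of column lengths at its first violation. -/
def seqToggle (C : ℕ → ℕ → ℕ) (i k : ℕ) : ℕ → ℕ → ℕ :=
  Function.update C (i + 1) (colToggle k (C i) (C (i + 1)) (C (i + 2)))

lemma seqToggle_self : seqToggle C i k (i + 1) = colToggle k (C i) (C (i + 1)) (C (i + 2)) :=
  Function.update_self ..

lemma seqToggle_of_ne {j : ℕ} (hj : j ≠ i + 1) : seqToggle C i k j = C j :=
  Function.update_of_ne hj ..

lemma sum_seqToggle (l : ℕ) {j : ℕ} (hj : j ≤ k) :
    ∑ c ∈ Finset.range j, seqToggle C i k l c = ∑ c ∈ Finset.range j, C l c := by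
  by_cases hl : l = i + 1
  · subst hl
    rw [seqToggle_self, sum_colToggle_of_le hj]
  · rw [seqToggle_of_ne hl]

lemma FirstViol.seqToggle (h : FirstViol m C i k)
    (hC : Interlace (C i) (C (i + 1)) (C (i + 2))) :
    FirstViol m (seqToggle C i k) i k := by
  refine ⟨h.lt, ?_, fun j hj k' hk' => ?_, fun j hj hij => ?_⟩
  · rw [seqToggle_self, seqToggle_of_ne (by omega), seqToggle_of_ne (by omega)]
    exact hC.colViol_colToggle h.viol
  · have := h.min j hj k' hk'
    unfold ColViol at this ⊢
    rwa [sum_seqToggle _ hk', sum_seqToggle _ hk', sum_seqToggle _ hk'.le, sum_seqToggle _ hk'.le]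
  · have := h.max j hj hij
    unfold ColViol at this ⊢
    rwa [sum_seqToggle j le_rfl, seqToggle_of_ne (by omega), seqToggle_of_ne (by omega)]

lemma FirstViol.seqToggle_seqToggle (h : FirstViol m C i k)
    (hC : Interlace (C i) (C (i + 1)) (C (i + 2))) :
    PadicLattice.seqToggle (PadicLattice.seqToggle C i k) i k = C := by
  rw [PadicLattice.seqToggle, seqToggle_self, seqToggle_of_ne (by omega), seqToggle_of_ne (by omega),
    hC.colToggle_colToggle h.viol (h.min i h.lt)]
  simp [PadicLattice.seqToggle]

lemma FirstViol.le (h : FirstViol m C i k) {B : ℕ} (h0 : ∀ c, B ≤ c → C i c = 0)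
    (h1 : ∀ c, B ≤ c → C (i + 1) c = 0) (h2 : ∀ c, B ≤ c → C (i + 2) c = 0) : k ≤ B := by
  by_contra! hk
  obtain ⟨b, rfl⟩ : ∃ b, k = b + 1 := ⟨k - 1, by omega⟩
  have hv := h.viol
  have := h.min i h.lt b (Nat.lt_succ_self b)
  have := h0 b (by omega)
  have := h1 b (by omega)
  have := h1 (b + 1) (by omega)
  have := h2 (b + 1) (by omega)
  unfold ColViol at *
  simp only [Finset.sum_range_succ] at *
  omega

end FirstViolation

section PathToggle

variable {r : ℕ}

/-- The column lengths along a path. -/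
def pathCols (p : ℕ → Fin r → ℕ) (i : ℕ) : ℕ → ℕ := colLen (p i)

lemma interlace_of_mem_strips {x y z : Fin r → ℕ} (hy : y ∈ strips x) (hz : z ∈ strips y) :
    Interlace (colLen x) (colLen y) (colLen z) := by
  rw [mem_strips] at hy hz
  exact ⟨colLen_mono hy.2.1, colLen_mono hz.2.1, colLen_succ_le hy.2.2, colLen_succ_le hz.2.2⟩

/-- Toggle a path at its first violation. -/
def pathToggle (B : ℕ) (p : ℕ → Fin r → ℕ) (i k : ℕ) : ℕ → Fin r → ℕ :=
  Function.update p (i + 1) (rowLen r (B + 1) (seqToggle (pathCols p) i k (i + 1)))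

lemma pathToggle_of_ne {B : ℕ} {p : ℕ → Fin r → ℕ} {i k j : ℕ} (hj : j ≠ i + 1) :
    pathToggle B p i k j = p j :=
  Function.update_of_ne hj ..

lemma le_of_mem_paths {ν : Fin r → ℕ} {m : ℕ} {p : ℕ → Fin r → ℕ} (hp : p ∈ paths ν m) (i : ℕ)
    (a : Fin r) : p i a ≤ ν a + m := by
  obtain ⟨h0, h1, h2⟩ := mem_paths.1 hp
  have : ∀ i ≤ m, p i a ≤ ν a + i := by
    intro i hi
    induction i with
    | zero => rw [h0]; rfl
    | succ i ih =>
      have := (mem_strips.1 (h1 i hi)).2.2 a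
      have := ih (by omega)
      omega
  rcases le_total i m with hi | hi
  · exact (this i hi).trans (by omega)
  · rw [h2 i hi]
    exact this m le_rfl

variable {ν : Fin r → ℕ} {m B : ℕ} {p : ℕ → Fin r → ℕ} {i k : ℕ}

lemma interlace_pathCols (hp : p ∈ paths ν m) (hi : i + 1 < m) :
    Interlace (pathCols p i) (pathCols p (i + 1)) (pathCols p (i + 2)) :=
  interlace_of_mem_strips ((mem_paths.1 hp).2.1 i (by omega)) ((mem_paths.1 hp).2.1 (i + 1) hi)

lemma pathCols_eq_zero (hB : ∀ a, ν a + m ≤ B) (hp : p ∈ paths ν m) (j : ℕ) {c : ℕ} (hc : B ≤ c) :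
    pathCols p j c = 0 :=
  colLen_eq_zero fun a => (le_of_mem_paths hp j a).trans ((hB a).trans hc)

lemma interlace_seqToggle (hp : p ∈ paths ν m) (h : FirstViol m (pathCols p) i k) :
    Interlace (pathCols p i) (seqToggle (pathCols p) i k (i + 1)) (pathCols p (i + 2)) := by
  rw [seqToggle_self]
  exact (interlace_pathCols hp h.lt).colToggle h.viol (h.min i h.lt)

lemma pathCols_pathToggle (hB : ∀ a, ν a + m ≤ B) (hp : p ∈ paths ν m)
    (h : FirstViol m (pathCols p) i k) :
    pathCols (pathToggle B p i k) = seqToggle (pathCols p) i k := by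
  funext j
  by_cases hj : j = i + 1
  · subst hj
    have hI := interlace_seqToggle hp h
    rw [pathCols, pathToggle, Function.update_self]
    funext c
    refine colLen_rowLen (antitone_nat_of_succ_le fun c => (hI.succ_left c).trans (hI.le_left c))
      (fun c hc => ?_) (fun c => (hI.le_right c).trans (colLen_le _ c)) c
    exact Nat.eq_zero_of_le_zero
      ((hI.le_right c).trans_eq (pathCols_eq_zero hB hp _ (by omega)))
  · rw [pathCols, pathToggle_of_ne hj, seqToggle_of_ne hj, pathCols]

lemma pathToggle_antitone (hν : Antitone ν) (hp : p ∈ paths ν m) (j : ℕ) :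
    Antitone (pathToggle B p i k j) := by
  by_cases hj : j = i + 1
  · subst hj
    rw [pathToggle, Function.update_self]
    exact rowLen_antitone _ _ _
  · rw [pathToggle_of_ne hj]
    exact antitone_of_mem_paths hν hp j

lemma pathToggle_mem_paths (hν : Antitone ν) (hB : ∀ a, ν a + m ≤ B) (hp : p ∈ paths ν m)
    (h : FirstViol m (pathCols p) i k) : pathToggle B p i k ∈ paths ν m := by
  have hcols := pathCols_pathToggle hB hp h
  have hI := interlace_seqToggle hp h
  have hself : colLen (pathToggle B p i k (i + 1)) = seqToggle (pathCols p) i k (i + 1) :=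
    congrFun hcols (i + 1)
  have hanti := pathToggle_antitone (B := B) (i := i) (k := k) hν hp
  have hlt := h.lt
  obtain ⟨h0, h1, h2⟩ := mem_paths.1 hp
  refine mem_paths.2 ⟨by rw [pathToggle_of_ne (by omega), h0], fun j hj => ?_, fun j hj => ?_⟩
  · rw [mem_strips]
    refine ⟨hanti _, ?_⟩
    by_cases hj1 : j = i
    · subst hj1
      have hpj : pathToggle B p j k j = p j := pathToggle_of_ne (by omega)
      refine ⟨le_of_colLen_le (hanti _) (hanti _) fun c => ?_,
        le_succ_of_colLen_le (hanti _) (hanti _) fun c => ?_⟩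
      · rw [hself, hpj]
        exact hI.le_left c
      · rw [hself, hpj]
        exact hI.succ_left c
    · by_cases hj2 : j = i + 1
      · subst hj2
        have hpj : pathToggle B p i k (i + 2) = p (i + 2) := pathToggle_of_ne (by omega)
        refine ⟨le_of_colLen_le (hanti _) (hanti _) fun c => ?_,
          le_succ_of_colLen_le (hanti _) (hanti _) fun c => ?_⟩
        · rw [hself, hpj]
          exact hI.le_right c
        · rw [hself, hpj]
          exact hI.succ_right c
      · rw [pathToggle_of_ne hj2, pathToggle_of_ne (by omega)]
        exact (mem_strips.1 (h1 j hj)).2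
  · rw [pathToggle_of_ne (by omega), pathToggle_of_ne (by omega), h2 j hj]

lemma firstViol_pathToggle (hB : ∀ a, ν a + m ≤ B) (hp : p ∈ paths ν m)
    (h : FirstViol m (pathCols p) i k) : FirstViol m (pathCols (pathToggle B p i k)) i k := by
  rw [pathCols_pathToggle hB hp h]
  exact h.seqToggle (interlace_pathCols hp h.lt)

lemma pathToggle_pathToggle (hν : Antitone ν) (hB : ∀ a, ν a + m ≤ B) (hp : p ∈ paths ν m)
    (h : FirstViol m (pathCols p) i k) : pathToggle B (pathToggle B p i k) i k = p := by
  have hq := pathToggle_mem_paths hν hB hp h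
  have hv := firstViol_pathToggle hB hp h
  funext j
  refine eq_of_colLen_eq (pathToggle_antitone hν hq j) (antitone_of_mem_paths hν hp j) fun c => ?_
  have := pathCols_pathToggle hB hq hv
  rw [pathCols_pathToggle hB hp h, h.seqToggle_seqToggle (interlace_pathCols hp h.lt)] at this
  exact congrFun (congrFun this j) c

lemma sum_pathToggle (hν : Antitone ν) (hB : ∀ a, ν a + m ≤ B) (hp : p ∈ paths ν m)
    (h : FirstViol m (pathCols p) i k) :
    ∑ a, pathToggle B p i k (i + 1) a + ∑ a, p (i + 1) a + 1 =
      ∑ a, p i a + ∑ a, p (i + 2) a := by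
  have hz := fun j c hc => pathCols_eq_zero hB hp j (c := c) hc
  have hk : k ≤ B := h.le (hz _) (hz _) (hz _)
  have hI := interlace_pathCols hp h.lt
  have key := hI.sum_colToggle h.viol (j := B + 1) (Nat.lt_succ_of_le hk)
  have hself : colLen (pathToggle B p i k (i + 1)) =
      colToggle k (pathCols p i) (pathCols p (i + 1)) (pathCols p (i + 2)) :=
    (congrFun (pathCols_pathToggle hB hp h) (i + 1)).trans seqToggle_self
  have hsum : ∀ q ∈ paths ν m, ∀ j n, B ≤ n → colSum (q j) n = ∑ a, q j a := fun q hq j n hn =>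
    colSum_of_le fun a => ((le_of_mem_paths hq j a).trans (hB a)).trans hn
  rw [← hself, hz (i + 2) (B + 1) (by omega), Nat.min_zero] at key
  simp only [pathCols, ← colSum_eq_sum] at key
  rw [hsum _ (pathToggle_mem_paths hν hB hp h) _ _ (by omega), hsum p hp _ _ (by omega),
    hsum p hp _ _ (by omega), hsum p hp _ _ (by omega), add_zero] at key
  exact key

end PathToggle

section Cancellation

variable {r : ℕ} {ν : Fin r → ℕ} {m B : ℕ} {p : ℕ → Fin r → ℕ} {i k : ℕ} {κ : ℕ → ℕ}

lemma pathWt_pathToggle (κ : ℕ → ℕ) (hν : Antitone ν) (hB : ∀ a, ν a + m ≤ B) (hp : p ∈ paths ν m)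
    (h : FirstViol m (pathCols p) i k) : pathWt m κ (pathToggle B p i k) = - pathWt m κ p := by
  have hlt := h.lt
  set a : Fin m := ⟨i, by omega⟩
  set b : Fin m := ⟨i + 1, hlt⟩
  have hab : a ≠ b := fun h => by simp [a, b] at h
  have hsum := sum_pathToggle hν hB hp h
  have hpi : pathToggle B p i k i = p i := pathToggle_of_ne (by omega)
  have hpi2 : pathToggle B p i k (i + 2) = p (i + 2) := pathToggle_of_ne (by omega)
  have key : pathWt m κ (pathToggle B p i k) = Matrix.det ((Matrix.of fun j l : Fin m =>
      sizeInd (p l) (p (l + 1)) ((κ j : ℤ) - (j : ℕ) + (l : ℕ))).submatrix id (Equiv.swap a b)) := by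
    rw [pathWt]
    congr 1
    ext1 j l
    rw [Matrix.submatrix_apply, Matrix.of_apply, Matrix.of_apply, id]
    by_cases hla : l = a
    · subst hla
      rw [Equiv.swap_apply_left]
      show sizeInd (pathToggle B p i k i) (pathToggle B p i k (i + 1)) (_ + ((i : ℕ) : ℤ)) =
        sizeInd (p (i + 1)) (p (i + 2)) (_ + ((i + 1 : ℕ) : ℤ))
      rw [hpi, sizeInd, sizeInd]
      refine if_congr ?_ rfl rfl
      omega
    · by_cases hlb : l = b
      · subst hlb
        rw [Equiv.swap_apply_right]
        show sizeInd (pathToggle B p i k (i + 1)) (pathToggle B p i k (i + 2))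
          (_ + ((i + 1 : ℕ) : ℤ)) = sizeInd (p i) (p (i + 1)) (_ + ((i : ℕ) : ℤ))
        rw [hpi2, sizeInd, sizeInd]
        refine if_congr ?_ rfl rfl
        omega
      · rw [Equiv.swap_apply_of_ne_of_ne hla hlb]
        have h1 : (l : ℕ) ≠ i := fun h => hla (Fin.ext h)
        have h2 : (l : ℕ) ≠ i + 1 := fun h => hlb (Fin.ext h)
        rw [pathToggle_of_ne h2, pathToggle_of_ne (by omega)]
  rw [key, Matrix.det_permute', Equiv.Perm.sign_swap hab, pathWt]
  simp

lemma pathWt_of_lrPath (hκ : Antitone κ) (h : LRPath m κ p) : pathWt m κ p = 1 := by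
  rw [pathWt, ← Matrix.det_one (n := Fin m)]
  congr 1
  ext1 j l
  rw [Matrix.of_apply, sizeInd, Matrix.one_apply, h.size l l.2]
  refine if_congr ?_ rfl rfl
  push_cast
  rw [Fin.ext_iff]
  constructor
  · intro h
    rcases lt_trichotomy (j : ℕ) l with hjl | hjl | hjl
    · have := hκ hjl.le
      omega
    · exact hjl
    · have := hκ hjl.le
      omega
  · intro h
    rw [h]
    omega

lemma lrPath_of_pathWt_ne_zero (hκ : Antitone κ) (hν : Antitone ν) (hp : p ∈ paths ν m)
    (hnv : ¬ ∃ j k, j + 1 < m ∧ ColViol (pathCols p j) (pathCols p (j + 1)) (pathCols p (j + 2)) k)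
    (hw : pathWt m κ p ≠ 0) : LRPath m κ p := by
  obtain ⟨-, h1, -⟩ := mem_paths.1 hp
  have hword : ∀ i, i + 1 < m → ∀ k, colSum (p (i + 2)) (k + 1) + colSum (p i) k ≤
      colSum (p (i + 1)) (k + 1) + colSum (p (i + 1)) k := by
    intro i hi k
    have : ¬ ColViol (pathCols p i) (pathCols p (i + 1)) (pathCols p (i + 2)) k :=
      fun h => hnv ⟨i, k, hi, h⟩
    unfold ColViol at this
    simp only [pathCols, ← colSum_eq_sum] at this
    omega
  refine ⟨fun i _ => antitone_of_mem_paths hν hp i, fun i hi => (mem_strips.1 (h1 i hi)).2.1,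
    fun i hi => (mem_strips.1 (h1 i hi)).2.2, ?_, hword⟩
  have hle : ∀ i a, p i a ≤ ∑ b, ν b + m := fun i a =>
    (le_of_mem_paths hp i a).trans
      (Nat.add_le_add_right (Finset.single_le_sum (fun _ _ => Nat.zero_le _) (Finset.mem_univ a)) m)
  have hstep : ∀ i, i + 1 < m →
      ∑ a, p (i + 2) a + ∑ a, p i a ≤ ∑ a, p (i + 1) a + ∑ a, p (i + 1) a := by
    intro i hi
    have := hword i hi (∑ b, ν b + m)
    rwa [colSum_of_le (hle _), colSum_of_le fun a => (hle _ a).trans (Nat.le_succ _),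
      colSum_of_le (hle _), colSum_of_le fun a => (hle _ a).trans (Nat.le_succ _)] at this
  have hanti : ∀ i j : ℕ, i ≤ j → j < m →
      ((∑ a, p (j + 1) a : ℕ) : ℤ) - (∑ a, p j a : ℕ) ≤ (∑ a, p (i + 1) a : ℕ) - (∑ a, p i a : ℕ) := by
    intro i j hij
    induction j, hij using Nat.le_induction with
    | base => exact fun _ => le_rfl
    | succ j hij ih =>
      intro hj
      have h1 : ∑ a, p (j + 1 + 1) a + ∑ a, p j a ≤ ∑ a, p (j + 1) a + ∑ a, p (j + 1) a :=
        hstep j hj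
      have := ih (by omega)
      omega
  rw [pathWt, Matrix.det_apply] at hw
  obtain ⟨σ, -, hσ⟩ := Finset.exists_ne_zero_of_sum_ne_zero hw
  have hσ' : ∀ l : Fin m, ((∑ a, p (l + 1) a : ℕ) : ℤ) =
      (∑ a, p l a : ℕ) + ((κ (σ l) : ℤ) - ((σ l : Fin m) : ℕ) + (l : ℕ)) := by
    intro l
    by_contra hne
    refine hσ ?_
    rw [Finset.prod_eq_zero (Finset.mem_univ l), smul_zero]
    rw [Matrix.of_apply, sizeInd, if_neg hne]
  have hmono : StrictMono σ := by
    intro a b hab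
    by_contra! hle
    have h2 := hanti a b hab.le b.2
    have h3 := hσ' a
    have h4 := hσ' b
    have h5 : ((σ b : Fin m) : ℕ) ≤ (σ a : Fin m) := hle
    have h6 := hκ h5
    have h7 : (a : ℕ) < b := hab
    omega
  have hσ1 := perm_eq_one_of_strictMono hmono
  intro i hi
  have := hσ' ⟨i, hi⟩
  rw [hσ1] at this
  simp only [Equiv.Perm.coe_one, id_eq] at this
  omega

open Classical in
/-- The Littlewood–Richardson rule in terms of lattice-word paths of vertical strips. -/
lemma dualSchur_mul_altRho_eq (hν : Antitone ν) (m : ℕ) (hκ : Antitone κ) :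
    dualSchur r m κ * altRho ν = ∑ p ∈ (paths ν m).filter (LRPath m κ), altRho (p m) := by
  rw [dualSchur_mul_altRho hν, Finset.sum_filter]
  have hB : ∀ a, ν a + m ≤ ∑ b, ν b + m := fun a =>
    Nat.add_le_add_right (Finset.single_le_sum (fun _ _ => Nat.zero_le _) (Finset.mem_univ a)) m
  set B := ∑ b, ν b + m
  set viol : (ℕ → Fin r → ℕ) → Prop := fun p =>
    ∃ ik : ℕ × ℕ, FirstViol m (pathCols p) ik.1 ik.2 with hviol
  have hLR : ∀ p, LRPath m κ p → ¬ viol p := by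
    rintro p hp ⟨⟨i, k⟩, h⟩
    have h1 := h.viol
    have h2 := hp.word i h.lt k
    unfold ColViol at h1
    simp only [pathCols, ← colSum_eq_sum] at h1
    omega
  rw [← Finset.sum_filter_add_sum_filter_not (paths ν m) viol,
    ← Finset.sum_filter_add_sum_filter_not (paths ν m) viol
      (fun p => if LRPath m κ p then altRho (p m) else 0)]
  congr 1
  · rw [Finset.sum_eq_zero (s := (paths ν m).filter viol) 
      (f := fun p => if LRPath m κ p then altRho (p m) else 0)]
    · refine Finset.sum_involution
        (fun p hp => pathToggle B p (Finset.mem_filter.1 hp).2.choose.1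
          (Finset.mem_filter.1 hp).2.choose.2) ?_ ?_ ?_ ?_
      · intro p hp
        have hspec := (Finset.mem_filter.1 hp).2.choose_spec
        rw [pathWt_pathToggle κ hν hB (Finset.mem_filter.1 hp).1 hspec,
          pathToggle_of_ne (by have := hspec.lt; omega)]
        ring
      · intro p hp hne heq
        have hspec := (Finset.mem_filter.1 hp).2.choose_spec
        have := pathWt_pathToggle κ hν hB (Finset.mem_filter.1 hp).1 hspec
        rw [heq, self_eq_neg] at this
        exact hne (by rw [this, zero_mul])
      · intro p hp
        have hspec := (Finset.mem_filter.1 hp).2.choose_spec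
        exact Finset.mem_filter.2 ⟨pathToggle_mem_paths hν hB (Finset.mem_filter.1 hp).1 hspec,
          _, firstViol_pathToggle hB (Finset.mem_filter.1 hp).1 hspec⟩
      · intro p hp
        have hspec := (Finset.mem_filter.1 hp).2.choose_spec
        have hv := firstViol_pathToggle hB (Finset.mem_filter.1 hp).1 hspec
        generalize_proofs _ h2
        obtain ⟨e1, e2⟩ := h2.choose_spec.unique hv
        rw [e1, e2]
        exact pathToggle_pathToggle hν hB (Finset.mem_filter.1 hp).1 hspec
    · intro p hp
      rw [if_neg fun h => hLR p h (Finset.mem_filter.1 hp).2]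
  · refine Finset.sum_congr rfl fun p hp => ?_
    obtain ⟨hp, hnv⟩ := Finset.mem_filter.1 hp
    split_ifs with h
    · rw [pathWt_of_lrPath hκ h, one_mul]
    · by_cases hw : pathWt m κ p = 0
      · rw [hw, zero_mul]
      · refine absurd (lrPath_of_pathWt_ne_zero hκ hν hp (fun hex => hnv ?_) hw) h
        obtain ⟨i, k, hik⟩ := exists_firstViol (C := pathCols p) hex
        exact ⟨(i, k), hik⟩

end Cancellation

section Expansion

variable {r : ℕ}

lemma eq_of_colSum_eq {ν ν' : Fin r → ℕ} (hν : Antitone ν) (hν' : Antitone ν')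
    (h : ∀ k, colSum ν k = colSum ν' k) : ν = ν' :=
  eq_of_colLen_eq hν hν' fun c => by
    have h1 := h (c + 1)
    rw [colSum_succ, colSum_succ, h c] at h1
    exact Nat.add_left_cancel h1

lemma colSum_min (μ : Fin r → ℕ) (i k : ℕ) :
    colSum (fun a => min (μ a) i) k = colSum μ (min k i) :=
  Finset.sum_congr rfl fun a _ => by rw [min_assoc, min_comm i k]

lemma antitone_min {μ : Fin r → ℕ} (hμ : Antitone μ) (i : ℕ) : Antitone fun a => min (μ a) i :=
  fun _ _ h => min_le_min_right i (hμ h)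

lemma lrPath_min {μ : Fin r → ℕ} (hμ : Antitone μ) (m : ℕ) :
    LRPath m (colLen μ) fun i a => min (μ a) i := by
  refine ⟨fun i _ => antitone_min hμ i, fun i _ a => ?_, fun i _ a => ?_,
    fun i _ => colSum_succ μ i, fun i _ k => ?_⟩
  · show min (μ a) i ≤ min (μ a) (i + 1)
    omega
  · show min (μ a) (i + 1) ≤ min (μ a) i + 1
    omega
  · simp only [colSum_min]
    rcases le_or_gt k i with hk | hk
    · rw [min_eq_left (by omega), min_eq_left (by omega), min_eq_left (by omega),
        min_eq_left (by omega)]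
    · rw [min_eq_right (by omega), min_eq_right (by omega), min_eq_right (by omega),
        min_eq_right (by omega), colSum_succ μ (i + 1), colSum_succ μ i]
      have := colLen_antitone μ (Nat.le_succ i)
      simp only [Nat.succ_eq_add_one] at this
      omega

lemma LRPath.colSum_eq {m : ℕ} {μ : Fin r → ℕ} {p : ℕ → Fin r → ℕ} (h : LRPath m (colLen μ) p)
    (h0 : p 0 = 0) (i : ℕ) (hi : i ≤ m) (k : ℕ) :
    PadicLattice.colSum (p i) k = PadicLattice.colSum μ (min k i) := by
  have hle : ∀ i ≤ m, ∀ a, p i a ≤ i := by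
    intro i hi a
    induction i with
    | zero => rw [h0]; exact le_rfl
    | succ i ih => exact (h.le_succ i hi a).trans (Nat.succ_le_succ (ih (by omega)))
  have hsize : ∀ i ≤ m, ∑ a, p i a = PadicLattice.colSum μ i := by
    intro i hi
    induction i with
    | zero => simp [h0]
    | succ i ih => rw [h.size i hi, ih (by omega), colSum_succ]
  have hbig : ∀ i ≤ m, ∀ k, i ≤ k → PadicLattice.colSum (p i) k =
      PadicLattice.colSum μ (min k i) := by
    intro i hi k hk
    rw [colSum_of_le fun a => (hle i hi a).trans hk, hsize i hi, min_eq_right hk]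
  induction i using Nat.strong_induction_on generalizing k with
  | _ i ih =>
    rcases le_or_gt i k with hk | hk
    · exact hbig i hi k hk
    · obtain _ | k := k
      · simp
      obtain ⟨i, rfl⟩ : ∃ j, i = j + 2 := ⟨i - 2, by omega⟩
      have h1 := h.word i (by omega) k
      have h2 := colSum_mono (h.le (i + 1) (by omega)) (k + 1)
      rw [ih (i + 1) (by omega) (by omega), ih (i + 1) (by omega) (by omega),
        ih i (by omega) (by omega), min_eq_left (by omega), min_eq_left (by omega),
        min_eq_left (by omega)] at h1
      rw [ih (i + 1) (by omega) (by omega), min_eq_left (by omega)] at h2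
      rw [min_eq_left (by omega)]
      exact le_antisymm (by omega) h2

lemma dualSchur_mul_altRho_zero {m : ℕ} {μ : Fin r → ℕ} (hμ : Antitone μ) (hm : ∀ a, μ a ≤ m) :
    dualSchur r m (colLen μ) * altRho 0 = altRho μ := by
  classical
  rw [dualSchur_mul_altRho_eq (fun _ _ _ => le_rfl) m (colLen_antitone μ)]
  have : (paths (0 : Fin r → ℕ) m).filter (LRPath m (colLen μ)) =
      {fun i a => min (μ a) i} := by
    ext p
    rw [Finset.mem_filter, Finset.mem_singleton]
    constructor
    · rintro ⟨hp, h⟩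
      obtain ⟨h0, -, h2⟩ := mem_paths.1 hp
      have key : ∀ i ≤ m, p i = fun a => min (μ a) i := fun i hi =>
        eq_of_colSum_eq (h.anti i hi) (antitone_min hμ i) fun k => by
          rw [h.colSum_eq h0 i hi, colSum_min]
      funext i
      rcases le_total i m with hi | hi
      · exact key i hi
      · rw [h2 i hi, key m le_rfl]
        funext a
        rw [min_eq_left (hm a), min_eq_left ((hm a).trans hi)]
    · rintro rfl
      have h := lrPath_min hμ m
      refine ⟨mem_paths.2 ⟨?_, fun i hi => mem_strips.2 ⟨antitone_min hμ _, h.le i hi,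
        h.le_succ i hi⟩, fun i hi => ?_⟩, h⟩
      · funext a
        exact Nat.min_zero _
      · funext a
        rw [min_eq_left (hm a), min_eq_left ((hm a).trans hi)]
  rw [this, Finset.sum_singleton]
  congr 1
  funext a
  exact min_eq_left (hm a)

lemma altRho_zero_ne_zero (r : ℕ) : altRho (0 : Fin r → ℕ) ≠ 0 := by
  intro h
  have h0 : Antitone (0 : Fin r → ℕ) := fun _ _ _ => le_rfl
  have := coeff_altRho h0 h0
  rw [h] at this
  simp at this

/-- The dual Jacobi–Trudi identity. -/
lemma dualSchur_colLen {m : ℕ} {μ : Fin r → ℕ} (hμ : Antitone μ) (hm : ∀ a, μ a ≤ m) :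
    dualSchur r m (colLen μ) = schurP μ :=
  mul_right_cancel₀ (altRho_zero_ne_zero r)
    ((dualSchur_mul_altRho_zero hμ hm).trans (schurP_mul_alternant μ).symm)

open Classical in
lemma exists_lrPath_iff {B : ℕ} {κ : ℕ → ℕ} {lam : Fin r → ℕ} {P : (Fin r → ℕ) → Prop} :
    (∃ p ∈ (paths lam B).filter (LRPath B κ), P (p B)) ↔
      ∃ f, LRPath B κ f ∧ f 0 = lam ∧ P (f B) := by
  constructor
  · rintro ⟨p, hp, h⟩
    obtain ⟨hp, h1⟩ := Finset.mem_filter.1 hp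
    exact ⟨p, h1, (mem_paths.1 hp).1, h⟩
  · rintro ⟨f, hf, h0, h⟩
    have he : ∀ i ≤ B, f (min i B) = f i := fun i hi => by rw [min_eq_left hi]
    have hf' : LRPath B κ fun i => f (min i B) := by
      refine ⟨fun i hi => ?_, fun i hi => ?_, fun i hi => ?_, fun i hi => ?_, fun i hi => ?_⟩
      · rw [he i hi]; exact hf.anti i hi
      · rw [he i (by omega), he (i + 1) hi]; exact hf.le i hi
      · rw [he i (by omega), he (i + 1) hi]; exact hf.le_succ i hi
      · rw [he i (by omega), he (i + 1) hi]; exact hf.size i hi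
      · rw [he i (by omega), he (i + 1) (by omega), he (i + 2) hi]; exact hf.word i hi
    refine ⟨fun i => f (min i B), Finset.mem_filter.2 ⟨mem_paths.2 ⟨?_, fun i hi =>
      mem_strips.2 ⟨hf'.anti _ hi, hf'.le i hi, hf'.le_succ i hi⟩, fun i hi => ?_⟩, hf'⟩, ?_⟩
    · rw [he 0 (Nat.zero_le _), h0]
    · simp only [min_self, min_eq_right hi]
    · simpa using h

/-- Products of Schur polynomials expand along concatenations of lattice-word paths. -/
lemma exists_prod_schurP_expansion {B : ℕ} (μs : List (Fin r → ℕ))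
    (hμs : ∀ μ ∈ μs, Antitone μ ∧ ∀ a, μ a ≤ B) :
    ∃ S : (Fin r → ℕ) → Multiset (Fin r → ℕ), ∀ lam, Antitone lam →
      (μs.map schurP).prod * altRho lam = ((S lam).map altRho).sum ∧
        ∀ ν, ν ∈ S lam ↔ Reach B (μs.map colLen) lam ν := by
  classical
  induction μs with
  | nil =>
    refine ⟨fun lam => {lam}, fun lam _ => ⟨by simp, fun ν => ?_⟩⟩
    rw [Multiset.mem_singleton]
    exact eq_comm
  | cons μ μs ih =>
    obtain ⟨S, hS⟩ := ih fun μ' h => hμs μ' (List.mem_cons_of_mem _ h)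
    obtain ⟨hμ, hμB⟩ := hμs μ List.mem_cons_self
    refine ⟨fun lam => ((paths lam B).filter (LRPath B (colLen μ))).val.bind fun p => S (p B),
      fun lam hlam => ⟨?_, fun ν => ?_⟩⟩
    · rw [List.map_cons, List.prod_cons, mul_comm (schurP μ), mul_assoc, ← dualSchur_colLen hμ hμB,
        dualSchur_mul_altRho_eq hlam B (colLen_antitone μ), Finset.mul_sum, Multiset.map_bind,
        Multiset.sum_bind]
      refine Finset.sum_congr rfl fun p hp => ?_
      exact (hS (p B) ((Finset.mem_filter.1 hp).2.anti B le_rfl)).1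
    · refine Multiset.mem_bind.trans (Iff.trans ?_
        (exists_lrPath_iff (P := fun s => Reach B (μs.map colLen) s ν)))
      refine exists_congr fun p => and_congr_right fun hp => ?_
      exact (hS (p B) ((Finset.mem_filter.1 hp).2.anti B le_rfl)).2 ν

lemma coeff_sum_altRho {δ : Fin r → ℕ} (hδ : Antitone δ) (S : Multiset (Fin r → ℕ))
    (hS : ∀ ν ∈ S, Antitone ν) :
    MvPolynomial.coeff (Finsupp.equivFunOnFinite.symm fun a : Fin r => δ a + (r - 1 - (a : ℕ)))
      (S.map altRho).sum = S.count δ := by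
  induction S using Multiset.induction_on with
  | empty => simp
  | cons ν S ih =>
    rw [Multiset.map_cons, Multiset.sum_cons, MvPolynomial.coeff_add,
      coeff_altRho hδ (hS ν (Multiset.mem_cons_self ν S)),
      ih fun ν' h => hS ν' (Multiset.mem_cons_of_mem h), Multiset.count_cons]
    push_cast
    rw [add_comm]

lemma multiCoeff_ne_zero_iff {t B : ℕ} {Λ : Fin t → Fin r → ℕ} (hΛ : ∀ j, Antitone (Λ j))
    (hB : ∀ j a, Λ j a ≤ B) {δ : Fin r → ℕ} (hδ : Antitone δ) :
    multiCoeff r Λ δ ≠ 0 ↔ Reach B (List.ofFn fun j => colLen (Λ j)) 0 δ := by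
  have h0 : Antitone (0 : Fin r → ℕ) := fun _ _ _ => le_rfl
  obtain ⟨S, hS⟩ := exists_prod_schurP_expansion (B := B) (List.ofFn Λ) (by
    intro μ hμ
    obtain ⟨j, rfl⟩ := List.mem_ofFn.1 hμ
    exact ⟨hΛ j, hB j⟩)
  obtain ⟨h1, h2⟩ := hS 0 h0
  rw [List.map_ofFn, List.prod_ofFn] at h1
  rw [List.map_ofFn] at h2
  have h3 : multiCoeff r Λ δ = (S 0).count δ := by
    rw [← coeff_sum_altRho hδ (S 0) fun ν hν => Reach.antitone ((h2 ν).1 hν) h0, ← h1, altRho_zero]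
    rfl
  rw [h3, Nat.cast_ne_zero, Multiset.count_ne_zero, h2]
  rfl

lemma colLen_mul {N : ℕ} (hN : 0 < N) (μ : Fin r → ℕ) :
    colLen (fun a => N * μ a) = fun i => colLen μ (i / N) := by
  funext c
  unfold colLen
  congr 1
  ext a
  simp only [Finset.mem_filter, Finset.mem_univ, true_and]
  rw [Nat.div_lt_iff_lt_mul hN, mul_comm]

end Expansion

end PadicLattice

/-- Theorem `S1`, saturation with bounded width.  Let
`V_{Λ 1}, …, V_{Λ t}` be irreducible polynomial representations of `GL(r)` (indexed
by partitions `Λ j` with at most `r` parts), and `N, ℓ` positive integers.  There is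
a `δ` with `δ_1 ≤ ℓ` and an inclusion of `GL(r)`-representations
`V_δ ⊆ V_{Λ 1} ⊗ ⋯ ⊗ V_{Λ t}` (i.e. `s_δ` occurs in `∏_j s_{Λ j}`) iff there is a
`δ'` with `δ'_1 ≤ Nℓ` and an inclusion `V_{δ'} ⊆ V_{N·Λ 1} ⊗ ⋯ ⊗ V_{N·Λ t}`. -/
theorem stmt2 (r t N ℓ : ℕ) (hr : 0 < r) (ht : 0 < t) (hN : 0 < N) (hℓ : 0 < ℓ)
    (Λ : Fin t → Fin r → ℕ) (hΛ : ∀ j, Antitone (Λ j)) :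
    (∃ δ : Fin r → ℕ, Antitone δ ∧ (∀ a, δ a ≤ ℓ) ∧ multiCoeff r Λ δ ≠ 0) ↔
      (∃ δ' : Fin r → ℕ, Antitone δ' ∧ (∀ a, δ' a ≤ N * ℓ) ∧
        multiCoeff r (fun j a => N * Λ j a) δ' ≠ 0) := by
  have h0 : Antitone (0 : Fin r → ℕ) := fun _ _ _ => le_rfl
  have hB : ∀ j a, Λ j a ≤ ∑ j, ∑ a, Λ j a := fun j a =>
    (Finset.single_le_sum (f := Λ j) (fun _ _ => Nat.zero_le _) (Finset.mem_univ a)).trans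
      (Finset.single_le_sum (f := fun j => ∑ a, Λ j a) (fun _ _ => Nat.zero_le _)
        (Finset.mem_univ j))
  set B := ∑ j, ∑ a, Λ j a
  have key := PadicLattice.exists_reach_iff (r := r) (B := B) (ℓ := ℓ) hN
    (List.ofFn fun j => PadicLattice.colLen (Λ j))
  have hmap : (List.ofFn fun j => PadicLattice.colLen (Λ j)).map (fun κ i => κ (i / N)) =
      List.ofFn fun j => PadicLattice.colLen (fun a => N * Λ j a) := by
    rw [List.map_ofFn]
    congr 1
    funext j
    exact (PadicLattice.colLen_mul hN (Λ j)).symm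
  rw [hmap] at key
  refine Iff.trans ?_ (key.trans ?_)
  · refine exists_congr fun δ => ⟨fun ⟨h1, h2, h3⟩ => ⟨h2, ?_⟩, fun ⟨h2, h3⟩ => ?_⟩
    · exact (PadicLattice.multiCoeff_ne_zero_iff hΛ hB h1).1 h3
    · have h1 := h3.antitone h0
      exact ⟨h1, h2, (PadicLattice.multiCoeff_ne_zero_iff hΛ hB h1).2 h3⟩
  · have hΛ' : ∀ j, Antitone fun a => N * Λ j a := fun j _ _ h => Nat.mul_le_mul_left N (hΛ j h)
    have hB' : ∀ j a, N * Λ j a ≤ N * B := fun j a => Nat.mul_le_mul_left N (hB j a)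
    refine exists_congr fun δ => ⟨fun ⟨h2, h3⟩ => ?_, fun ⟨h1, h2, h3⟩ => ⟨h2, ?_⟩⟩
    · have h1 := h3.antitone h0
      exact ⟨h1, h2, (PadicLattice.multiCoeff_ne_zero_iff hΛ' hB' h1).2 h3⟩
    · exact (PadicLattice.multiCoeff_ne_zero_iff hΛ' hB' h1).1 h3
end
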